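/- MPN Coherence: the functor G from MPN to Br is faithful; that is, for all arrow terms f, g : A ⊢ B of MPN, if Gf = Gg in Br then f = g in MPN. -/

import Mathlib

/-! ### The category Br of Brauerian split equivalences of finite ordinals

An arrow `m ⊢ n` of `Br` is represented as a relation on `ℕ ⊕ ℕ`, where
`Sum.inl i` (with `i < m`) is the source copy `i_s` and `Sum.inr j`
(with `j < n`) is the target copy `j_t`. -/

abbrev GRel : Type := (ℕ ⊕ ℕ) → (ℕ ⊕ ℕ) → Prop

/-- The identity arrow of `Br` on `n`: transversals `{i_s, i_t}` for `i < n`. -/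
def gId (n : ℕ) : GRel := fun u v =>
  ∃ i, i < n ∧ (u = Sum.inl i ∨ u = Sum.inr i) ∧ (v = Sum.inl i ∨ v = Sum.inr i)

/-- The Brauerian split equivalence whose transversals are `{i_s, (φ i)_t}` for `i < m`. -/
def gFun (m : ℕ) (φ : ℕ → ℕ) : GRel := fun u v =>
  ∃ i, i < m ∧ (u = Sum.inl i ∨ u = Sum.inr (φ i)) ∧ (v = Sum.inl i ∨ v = Sum.inr (φ i))

/-- The block transposition exchanging the first `a` and the last `b` elements. -/
def gSwap (a b : ℕ) : GRel :=
  gFun (a + b) (fun i => if i < a then i + b else i - a)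

/-- `G Δ̂∧_{B,A}` with `a = GA`, `b = GB`: identity transversals on the stem `A`
together with caps joining the two copies of each letter occurrence of `B` in
the crown `¬B ∨ B` of the target. -/
def gDelta (a b : ℕ) : GRel := fun u v =>
  (∃ i, i < a ∧ (u = Sum.inl i ∨ u = Sum.inr i) ∧ (v = Sum.inl i ∨ v = Sum.inr i)) ∨
  (∃ j, j < b ∧ (u = Sum.inr (a + j) ∨ u = Sum.inr (a + b + j)) ∧
                (v = Sum.inr (a + j) ∨ v = Sum.inr (a + b + j)))

/-- `G Σ̂∨_{B,A}` with `a = GA`, `b = GB`: identity transversals on the stem `A`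
together with cups joining the two copies of each letter occurrence of `B` in
the crown `B ∧ ¬B` of the source. -/
def gSigma (a b : ℕ) : GRel := fun u v =>
  (∃ i, i < a ∧ (u = Sum.inl (2*b + i) ∨ u = Sum.inr i) ∧
                (v = Sum.inl (2*b + i) ∨ v = Sum.inr i)) ∨
  (∃ j, j < b ∧ (u = Sum.inl j ∨ u = Sum.inl (b + j)) ∧
                (v = Sum.inl j ∨ v = Sum.inl (b + j)))

/-- Composition `P ∗ R` in `Br`: glue along the middle copy and take the
transitive closure, restricted to the outer copies. -/
def gComp (Pr R : GRel) : GRel := fun u v =>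
  Relation.TransGen
    (fun x y : ℕ ⊕ ℕ ⊕ ℕ =>
      (∃ x' y', Sum.map id Sum.inl x' = x ∧ Sum.map id Sum.inl y' = y ∧ R x' y') ∨
      (∃ x' y', Sum.inr x' = x ∧ Sum.inr y' = y ∧ Pr x' y'))
    (Sum.map id Sum.inr u) (Sum.map id Sum.inr v)

/-- Shift a split relation by `a` on the source side and by `d` on the target side. -/
def gShift (a d : ℕ) (R : GRel) : GRel := fun u v =>
  ∃ u' v', R u' v' ∧ u = Sum.map (· + a) (· + d) u' ∧ v = Sum.map (· + a) (· + d) v'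

/-- Disjoint union of split relations: `G(f ξ g) = Gf ∪ Gg_{+GD}^{+GA}`. -/
def gPar (a d : ℕ) (R S : GRel) : GRel := fun u v => R u v ∨ gShift a d S u v
/-! ### The language L∧,∨^{¬p} generated from `P ∪ P¬` (negation applied only to letters) -/

inductive Form (P : Type) : Type
  | pos : P → Form P
  | natom : P → Form P
  | conj : Form P → Form P → Form P
  | disj : Form P → Form P → Form P

infixr:70 " ⋏ " => Form.conj
infixr:66 " ⋎ " => Form.disj

/-- The number of occurrences of letters (elements of `P ∪ P¬`) in a formula. -/
def Form.size {P : Type} : Form P → ℕ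
  | .pos _ => 1
  | .natom _ => 1
  | .conj A B => A.size + B.size
  | .disj A B => A.size + B.size
/-! ### Arrow terms of the category MPN -/

inductive Term (P : Type) : Form P → Form P → Type
  | id (A : Form P) : Term P A A
  | comp {A B C : Form P} : Term P B C → Term P A B → Term P A C
  | conj {A B D E : Form P} : Term P A D → Term P B E → Term P (A ⋏ B) (D ⋏ E)
  | disj {A B D E : Form P} : Term P A D → Term P B E → Term P (A ⋎ B) (D ⋎ E)
  | bConjTo (A B C : Form P) : Term P (A ⋏ (B ⋏ C)) ((A ⋏ B) ⋏ C)
  | bConjFrom (A B C : Form P) : Term P ((A ⋏ B) ⋏ C) (A ⋏ (B ⋏ C))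
  | bDisjTo (A B C : Form P) : Term P (A ⋎ (B ⋎ C)) ((A ⋎ B) ⋎ C)
  | bDisjFrom (A B C : Form P) : Term P ((A ⋎ B) ⋎ C) (A ⋎ (B ⋎ C))
  | cConj (A B : Form P) : Term P (A ⋏ B) (B ⋏ A)
  | cDisj (A B : Form P) : Term P (B ⋎ A) (A ⋎ B)
  | d (A B C : Form P) : Term P (A ⋏ (B ⋎ C)) ((A ⋏ B) ⋎ C)
  | delta (p : P) (A : Form P) : Term P A (A ⋏ (Form.natom p ⋎ Form.pos p))
  | sigma (p : P) (A : Form P) : Term P ((Form.pos p ⋏ Form.natom p) ⋎ A) A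
  | mix (A B : Form P) : Term P (A ⋏ B) (A ⋎ B)

infixr:80 " ⬝ " => Term.comp
infixr:70 " ⊼ " => Term.conj
infixr:66 " ⊽ " => Term.disj

/-- The arrow `d^R_{C,B,A} : (C∨B)∧A ⊢ C∨(B∧A)`. -/
def dR {P : Type} (C B A : Form P) : Term P ((C ⋎ B) ⋏ A) (C ⋎ (B ⋏ A)) :=
  Term.cDisj C (B ⋏ A) ⬝ ((Term.cConj A B ⊽ Term.id C) ⬝
    (Term.d A B C ⬝ ((Term.id A ⊼ Term.cDisj B C) ⬝ Term.cConj (C ⋎ B) A)))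

/-- `Σ̂∧_{p,A} = ĉ∧ ∘ Δ̂∧_{p,A} : A ⊢ (¬p∨p)∧A`. -/
def sigmaConj {P : Type} (p : P) (A : Form P) :
    Term P A ((Form.natom p ⋎ Form.pos p) ⋏ A) :=
  Term.cConj A (Form.natom p ⋎ Form.pos p) ⬝ Term.delta p A

/-- `Δ̂∨_{p,A} = Σ̂∨_{p,A} ∘ ĉ∨ : A∨(p∧¬p) ⊢ A`. -/
def deltaDisj {P : Type} (p : P) (A : Form P) :
    Term P (A ⋎ (Form.pos p ⋏ Form.natom p)) A :=
  Term.sigma p A ⬝ Term.cDisj (Form.pos p ⋏ Form.natom p) A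

/-- `Δ̂∧′_{p,A} = (1_A ∧ ĉ∨) ∘ Δ̂∧_{p,A} : A ⊢ A∧(p∨¬p)`. -/
def delta' {P : Type} (p : P) (A : Form P) :
    Term P A (A ⋏ (Form.pos p ⋎ Form.natom p)) :=
  (Term.id A ⊼ Term.cDisj (Form.pos p) (Form.natom p)) ⬝ Term.delta p A

/-- `Σ̂∨′_{p,A} = Σ̂∨_{p,A} ∘ (ĉ∧ ∨ 1_A) : (¬p∧p)∨A ⊢ A`. -/
def sigma' {P : Type} (p : P) (A : Form P) :
    Term P ((Form.natom p ⋏ Form.pos p) ⋎ A) A :=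
  Term.sigma p A ⬝ (Term.cConj (Form.natom p) (Form.pos p) ⊽ Term.id A)

/-- `Σ̂∧′_{p,A} = ĉ∧ ∘ Δ̂∧′_{p,A} : A ⊢ (p∨¬p)∧A`. -/
def sigmaConj' {P : Type} (p : P) (A : Form P) :
    Term P A ((Form.pos p ⋎ Form.natom p) ⋏ A) :=
  Term.cConj A (Form.pos p ⋎ Form.natom p) ⬝ delta' p A

/-- `Δ̂∨′_{p,A} = Σ̂∨′_{p,A} ∘ ĉ∨ : A∨(¬p∧p) ⊢ A`. -/
def deltaDisj' {P : Type} (p : P) (A : Form P) :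
    Term P (A ⋎ (Form.natom p ⋏ Form.pos p)) A :=
  sigma' p A ⬝ Term.cDisj (Form.natom p ⋏ Form.pos p) A
/-! ### The equations of DS, imposed on arrow terms -/

inductive Eqv {P : Type} : ∀ {A B : Form P}, Term P A B → Term P A B → Prop
  -- equivalence and congruence
  | refl {A B : Form P} (f : Term P A B) : Eqv f f
  | symm {A B : Form P} {f g : Term P A B} : Eqv f g → Eqv g f
  | trans {A B : Form P} {f g h : Term P A B} : Eqv f g → Eqv g h → Eqv f h
  | congComp {A B C : Form P} {g g' : Term P B C} {f f' : Term P A B} :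
      Eqv g g' → Eqv f f' → Eqv (g ⬝ f) (g' ⬝ f')
  | congConj {A B D E : Form P} {f f' : Term P A D} {g g' : Term P B E} :
      Eqv f f' → Eqv g g' → Eqv (f ⊼ g) (f' ⊼ g')
  | congDisj {A B D E : Form P} {f f' : Term P A D} {g g' : Term P B E} :
      Eqv f f' → Eqv g g' → Eqv (f ⊽ g) (f' ⊽ g')
  -- (cat 1), (cat 2)
  | catIdR {A B : Form P} (f : Term P A B) : Eqv (f ⬝ Term.id A) f
  | catIdL {A B : Form P} (f : Term P A B) : Eqv (Term.id B ⬝ f) f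
  | catAssoc {A B C D : Form P} (f : Term P A B) (g : Term P B C) (h : Term P C D) :
      Eqv (h ⬝ (g ⬝ f)) ((h ⬝ g) ⬝ f)
  -- bifunctorial equations (ξ 1), (ξ 2)
  | conjOne (A B : Form P) : Eqv (Term.id A ⊼ Term.id B) (Term.id (A ⋏ B))
  | disjOne (A B : Form P) : Eqv (Term.id A ⊽ Term.id B) (Term.id (A ⋎ B))
  | conjTwo {A₁ B₁ C₁ A₂ B₂ C₂ : Form P} (g₁ : Term P B₁ C₁) (f₁ : Term P A₁ B₁)
      (g₂ : Term P B₂ C₂) (f₂ : Term P A₂ B₂) :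
      Eqv ((g₁ ⬝ f₁) ⊼ (g₂ ⬝ f₂)) ((g₁ ⊼ g₂) ⬝ (f₁ ⊼ f₂))
  | disjTwo {A₁ B₁ C₁ A₂ B₂ C₂ : Form P} (g₁ : Term P B₁ C₁) (f₁ : Term P A₁ B₁)
      (g₂ : Term P B₂ C₂) (f₂ : Term P A₂ B₂) :
      Eqv ((g₁ ⬝ f₁) ⊽ (g₂ ⬝ f₂)) ((g₁ ⊽ g₂) ⬝ (f₁ ⊽ f₂))
  -- naturality equations
  | bConjNat {A B C D E F : Form P} (f : Term P A D) (g : Term P B E) (h : Term P C F) :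
      Eqv (((f ⊼ g) ⊼ h) ⬝ Term.bConjTo A B C) (Term.bConjTo D E F ⬝ (f ⊼ (g ⊼ h)))
  | bDisjNat {A B C D E F : Form P} (f : Term P A D) (g : Term P B E) (h : Term P C F) :
      Eqv (((f ⊽ g) ⊽ h) ⬝ Term.bDisjTo A B C) (Term.bDisjTo D E F ⬝ (f ⊽ (g ⊽ h)))
  | cConjNat {A B D E : Form P} (f : Term P A D) (g : Term P B E) :
      Eqv ((g ⊼ f) ⬝ Term.cConj A B) (Term.cConj D E ⬝ (f ⊼ g))
  | cDisjNat {A B D E : Form P} (f : Term P A D) (g : Term P B E) :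
      Eqv ((g ⊽ f) ⬝ Term.cDisj B A) (Term.cDisj E D ⬝ (f ⊽ g))
  | dNat {A B C D E F : Form P} (f : Term P A D) (g : Term P B E) (h : Term P C F) :
      Eqv (((f ⊼ g) ⊽ h) ⬝ Term.d A B C) (Term.d D E F ⬝ (f ⊼ (g ⊽ h)))
  -- (b̂ξ b̂ξ)
  | bConjIso₁ (A B C : Form P) :
      Eqv (Term.bConjFrom A B C ⬝ Term.bConjTo A B C) (Term.id (A ⋏ (B ⋏ C)))
  | bConjIso₂ (A B C : Form P) :
      Eqv (Term.bConjTo A B C ⬝ Term.bConjFrom A B C) (Term.id ((A ⋏ B) ⋏ C))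
  | bDisjIso₁ (A B C : Form P) :
      Eqv (Term.bDisjFrom A B C ⬝ Term.bDisjTo A B C) (Term.id (A ⋎ (B ⋎ C)))
  | bDisjIso₂ (A B C : Form P) :
      Eqv (Term.bDisjTo A B C ⬝ Term.bDisjFrom A B C) (Term.id ((A ⋎ B) ⋎ C))
  -- (b̂ξ 5)
  | bConjPent (A B C D : Form P) :
      Eqv (Term.bConjFrom A B (C ⋏ D) ⬝ Term.bConjFrom (A ⋏ B) C D)
        ((Term.id A ⊼ Term.bConjFrom B C D) ⬝
          (Term.bConjFrom A (B ⋏ C) D ⬝ (Term.bConjFrom A B C ⊼ Term.id D)))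
  | bDisjPent (A B C D : Form P) :
      Eqv (Term.bDisjFrom A B (C ⋎ D) ⬝ Term.bDisjFrom (A ⋎ B) C D)
        ((Term.id A ⊽ Term.bDisjFrom B C D) ⬝
          (Term.bDisjFrom A (B ⋎ C) D ⬝ (Term.bDisjFrom A B C ⊽ Term.id D)))
  -- (ĉ∧ ĉ∧), (ĉ∨ ĉ∨)
  | cConjIso (A B : Form P) : Eqv (Term.cConj B A ⬝ Term.cConj A B) (Term.id (A ⋏ B))
  | cDisjIso (A B : Form P) : Eqv (Term.cDisj A B ⬝ Term.cDisj B A) (Term.id (A ⋎ B))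
  -- (b̂∧ ĉ∧), (b̂∨ ĉ∨)
  | bcConj (A B C : Form P) :
      Eqv ((Term.id B ⊼ Term.cConj C A) ⬝ (Term.bConjFrom B C A ⬝
            (Term.cConj A (B ⋏ C) ⬝ (Term.bConjFrom A B C ⬝ (Term.cConj B A ⊼ Term.id C)))))
        (Term.bConjFrom B A C)
  | bcDisj (A B C : Form P) :
      Eqv ((Term.id B ⊽ Term.cDisj A C) ⬝ (Term.bDisjFrom B C A ⬝
            (Term.cDisj (B ⋎ C) A ⬝ (Term.bDisjFrom A B C ⬝ (Term.cDisj A B ⊽ Term.id C)))))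
        (Term.bDisjFrom B A C)
  -- (d ∧), (d ∨)
  | dConj (A B C D : Form P) :
      Eqv ((Term.bConjFrom A B C ⊽ Term.id D) ⬝ Term.d (A ⋏ B) C D)
        (Term.d A (B ⋏ C) D ⬝ ((Term.id A ⊼ Term.d B C D) ⬝ Term.bConjFrom A B (C ⋎ D)))
  | dDisj (D C B A : Form P) :
      Eqv (Term.d D C (B ⋎ A) ⬝ (Term.id D ⊼ Term.bDisjFrom C B A))
        (Term.bDisjFrom (D ⋏ C) B A ⬝ ((Term.d D C B ⊽ Term.id A) ⬝ Term.d D (C ⋎ B) A))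
  -- (d b̂∧), (d b̂∨)
  | dBConj (A B C D : Form P) :
      Eqv (dR (A ⋏ B) C D ⬝ (Term.d A B C ⊼ Term.id D))
        (Term.d A B (C ⋏ D) ⬝ ((Term.id A ⊼ dR B C D) ⬝ Term.bConjFrom A (B ⋎ C) D))
  | dBDisj (D C B A : Form P) :
      Eqv ((Term.id D ⊽ Term.d C B A) ⬝ dR D C (B ⋎ A))
        (Term.bDisjFrom D (C ⋏ B) A ⬝ ((dR D C B ⊽ Term.id A) ⬝ Term.d (D ⋎ C) B A))
  -- (Δ̂∧ nat)
  | deltaNat {A D : Form P} (p : P) (f : Term P A D) :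
      Eqv ((f ⊼ Term.id (Form.natom p ⋎ Form.pos p)) ⬝ Term.delta p A) (Term.delta p D ⬝ f)
  -- (Σ̂∨ nat)
  | sigmaNat {A D : Form P} (p : P) (f : Term P A D) :
      Eqv (f ⬝ Term.sigma p A) (Term.sigma p D ⬝ (Term.id (Form.pos p ⋏ Form.natom p) ⊽ f))
  -- (b̂∧ Δ̂∧)
  | bDelta (A B : Form P) (p : P) :
      Eqv (Term.bConjFrom A B (Form.natom p ⋎ Form.pos p) ⬝ Term.delta p (A ⋏ B))
        (Term.id A ⊼ Term.delta p B)
  -- (b̂∨ Σ̂∨)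
  | bSigma (p : P) (B A : Form P) :
      Eqv (Term.sigma p (B ⋎ A) ⬝ Term.bDisjFrom (Form.pos p ⋏ Form.natom p) B A)
        (Term.sigma p B ⊽ Term.id A)
  -- (d Σ̂∧)
  | dSigmaConj (p : P) (B C : Form P) :
      Eqv (Term.d (Form.natom p ⋎ Form.pos p) B C ⬝ sigmaConj p (B ⋎ C))
        (sigmaConj p B ⊽ Term.id C)
  -- (d Δ̂∨)
  | dDeltaDisj (p : P) (C B : Form P) :
      Eqv (deltaDisj p (C ⋏ B) ⬝ Term.d C B (Form.pos p ⋏ Form.natom p))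
        (Term.id C ⊼ deltaDisj p B)
  -- (Σ̂∨ Δ̂∧)
  | sigmaDelta (p : P) :
      Eqv (Term.sigma p (Form.pos p) ⬝
            (Term.d (Form.pos p) (Form.natom p) (Form.pos p) ⬝ Term.delta p (Form.pos p)))
        (Term.id (Form.pos p))
  -- (Σ̂∨′ Δ̂∧′)
  | sigmaDelta' (p : P) :
      Eqv (sigma' p (Form.natom p) ⬝
            (Term.d (Form.natom p) (Form.pos p) (Form.natom p) ⬝ delta' p (Form.natom p)))
        (Term.id (Form.natom p))
  -- (m nat)
  | mixNat {A B D E : Form P} (f : Term P A D) (g : Term P B E) :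
      Eqv ((f ⊽ g) ⬝ Term.mix A B) (Term.mix D E ⬝ (f ⊼ g))
  -- (b̂∧ m)
  | mixBConj (A B C : Form P) :
      Eqv (Term.mix (A ⋏ B) C ⬝ Term.bConjTo A B C) (Term.d A B C ⬝ (Term.id A ⊼ Term.mix B C))
  -- (b̂∨ m)
  | mixBDisj (C B A : Form P) :
      Eqv (Term.bDisjTo C B A ⬝ Term.mix C (B ⋎ A)) ((Term.mix C B ⊽ Term.id A) ⬝ Term.d C B A)
  -- (c m)
  | mixC (A B : Form P) :
      Eqv (Term.mix B A ⬝ Term.cConj A B) (Term.cDisj B A ⬝ Term.mix A B)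
/-- The functor `G` from DS to Br on arrow terms. -/
def Term.G {P : Type} : ∀ {A B : Form P}, Term P A B → GRel
  | _, _, .id A => gId A.size
  | _, _, .comp g f => gComp (Term.G g) (Term.G f)
  | _, _, @Term.conj _ A _ D _ f g => gPar A.size D.size (Term.G f) (Term.G g)
  | _, _, @Term.disj _ A _ D _ f g => gPar A.size D.size (Term.G f) (Term.G g)
  | _, _, .bConjTo A B C => gId (A.size + (B.size + C.size))
  | _, _, .bConjFrom A B C => gId (A.size + B.size + C.size)
  | _, _, .bDisjTo A B C => gId (A.size + (B.size + C.size))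
  | _, _, .bDisjFrom A B C => gId (A.size + B.size + C.size)
  | _, _, .cConj A B => gSwap A.size B.size
  | _, _, .cDisj A B => gSwap B.size A.size
  | _, _, .d A B C => gId (A.size + (B.size + C.size))
  | _, _, .delta _ A => gDelta A.size 1
  | _, _, .sigma _ A => gSigma A.size 1
  | _, _, .mix A B => gId (A.size + B.size)

open CategoryTheory

section QuotientCategory

variable {P : Type}

/-- Arrow terms up to provable equality. -/
instance eqvSetoid (A B : Form P) : Setoid (Term P A B) where
  r := Eqv
  iseqv := ⟨Eqv.refl, Eqv.symm, Eqv.trans⟩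

/-- The syntactic category MPN. -/
instance formCat : Category (Form P) where
  Hom A B := Quotient (eqvSetoid A B)
  id A := Quotient.mk _ (Term.id A)
  comp f g := Quotient.map₂ (fun f g => g ⬝ f)
    (fun _ _ hf _ _ hg => Eqv.congComp hg hf) f g
  id_comp := by rintro A B ⟨f⟩; exact Quotient.sound (Eqv.catIdR f)
  comp_id := by rintro A B ⟨f⟩; exact Quotient.sound (Eqv.catIdL f)
  assoc := by rintro A B C D ⟨f⟩ ⟨g⟩ ⟨h⟩; exact Quotient.sound (Eqv.catAssoc f g h)

/-- The arrow of MPN given by an arrow term. -/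
def qq {A B : Form P} (f : Term P A B) : A ⟶ B := Quotient.mk _ f

theorem qq_eq {A B : Form P} {f g : Term P A B} : qq f = qq g ↔ Eqv f g := Quotient.eq

theorem qq_ex {A B : Form P} (f : A ⟶ B) : ∃ g, f = qq g := by
  obtain ⟨g⟩ := f; exact ⟨g, rfl⟩

theorem qq_comp {A B C : Form P} (f : Term P A B) (g : Term P B C) :
    qq (g ⬝ f) = qq f ≫ qq g := rfl
theorem qq_id (A : Form P) : qq (Term.id A) = 𝟙 A := rfl

/-- Conjunction of arrows. -/
def cj {A B D E : Form P} (f : A ⟶ D) (g : B ⟶ E) : (A ⋏ B) ⟶ (D ⋏ E) :=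
  Quotient.map₂ (fun f g => f ⊼ g) (fun _ _ hf _ _ hg => Eqv.congConj hf hg) f g
/-- Disjunction of arrows. -/
def dj {A B D E : Form P} (f : A ⟶ D) (g : B ⟶ E) : (A ⋎ B) ⟶ (D ⋎ E) :=
  Quotient.map₂ (fun f g => f ⊽ g) (fun _ _ hf _ _ hg => Eqv.congDisj hf hg) f g

theorem qq_cj {A B D E : Form P} (f : Term P A D) (g : Term P B E) :
    qq (f ⊼ g) = cj (qq f) (qq g) := rfl
theorem qq_dj {A B D E : Form P} (f : Term P A D) (g : Term P B E) :
    qq (f ⊽ g) = dj (qq f) (qq g) := rfl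

def aT (A B C : Form P) : (A ⋏ (B ⋏ C)) ⟶ ((A ⋏ B) ⋏ C) := qq (Term.bConjTo A B C)
def aF (A B C : Form P) : ((A ⋏ B) ⋏ C) ⟶ (A ⋏ (B ⋏ C)) := qq (Term.bConjFrom A B C)
def oT (A B C : Form P) : (A ⋎ (B ⋎ C)) ⟶ ((A ⋎ B) ⋎ C) := qq (Term.bDisjTo A B C)
def oF (A B C : Form P) : ((A ⋎ B) ⋎ C) ⟶ (A ⋎ (B ⋎ C)) := qq (Term.bDisjFrom A B C)
def ca (A B : Form P) : (A ⋏ B) ⟶ (B ⋏ A) := qq (Term.cConj A B)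
def co (A B : Form P) : (A ⋎ B) ⟶ (B ⋎ A) := qq (Term.cDisj B A)
def dd (A B C : Form P) : (A ⋏ (B ⋎ C)) ⟶ ((A ⋏ B) ⋎ C) := qq (Term.d A B C)
def mx (A B : Form P) : (A ⋏ B) ⟶ (A ⋎ B) := qq (Term.mix A B)
def dl (p : P) (A : Form P) : A ⟶ (A ⋏ (Form.natom p ⋎ Form.pos p)) := qq (Term.delta p A)
def sg (p : P) (A : Form P) : ((Form.pos p ⋏ Form.natom p) ⋎ A) ⟶ A := qq (Term.sigma p A)
/-- The right distribution. -/
def dr (C B A : Form P) : ((C ⋎ B) ⋏ A) ⟶ (C ⋎ (B ⋏ A)) := qq (dR C B A)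

variable {A B C D E F A' B' C' : Form P}

theorem cj_id (A B : Form P) : cj (𝟙 A) (𝟙 B) = 𝟙 _ := Quotient.sound (Eqv.conjOne A B)
theorem dj_id (A B : Form P) : dj (𝟙 A) (𝟙 B) = 𝟙 _ := Quotient.sound (Eqv.disjOne A B)

theorem cj_cj (f : A ⟶ B) (g : B ⟶ C) (f' : A' ⟶ B') (g' : B' ⟶ C') :
    cj f f' ≫ cj g g' = cj (f ≫ g) (f' ≫ g') := by
  obtain ⟨f⟩ := f; obtain ⟨g⟩ := g; obtain ⟨f'⟩ := f'; obtain ⟨g'⟩ := g'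
  exact Quotient.sound (Eqv.symm (Eqv.conjTwo _ _ _ _))
theorem dj_dj (f : A ⟶ B) (g : B ⟶ C) (f' : A' ⟶ B') (g' : B' ⟶ C') :
    dj f f' ≫ dj g g' = dj (f ≫ g) (f' ≫ g') := by
  obtain ⟨f⟩ := f; obtain ⟨g⟩ := g; obtain ⟨f'⟩ := f'; obtain ⟨g'⟩ := g'
  exact Quotient.sound (Eqv.symm (Eqv.disjTwo _ _ _ _))
theorem cj_cj_assoc {X : Form P} (f : A ⟶ B) (g : B ⟶ C) (f' : A' ⟶ B') (g' : B' ⟶ C')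
    (h : (C ⋏ C') ⟶ X) : cj f f' ≫ cj g g' ≫ h = cj (f ≫ g) (f' ≫ g') ≫ h := by
  rw [← Category.assoc, cj_cj]
theorem dj_dj_assoc {X : Form P} (f : A ⟶ B) (g : B ⟶ C) (f' : A' ⟶ B') (g' : B' ⟶ C')
    (h : (C ⋎ C') ⟶ X) : dj f f' ≫ dj g g' ≫ h = dj (f ≫ g) (f' ≫ g') ≫ h := by
  rw [← Category.assoc, dj_dj]

theorem aT_nat (f : A ⟶ D) (g : B ⟶ E) (h : C ⟶ F) :
    aT A B C ≫ cj (cj f g) h = cj f (cj g h) ≫ aT D E F := by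
  obtain ⟨f⟩ := f; obtain ⟨g⟩ := g; obtain ⟨h⟩ := h
  exact Quotient.sound (Eqv.bConjNat _ _ _)
theorem oT_nat (f : A ⟶ D) (g : B ⟶ E) (h : C ⟶ F) :
    oT A B C ≫ dj (dj f g) h = dj f (dj g h) ≫ oT D E F := by
  obtain ⟨f⟩ := f; obtain ⟨g⟩ := g; obtain ⟨h⟩ := h
  exact Quotient.sound (Eqv.bDisjNat _ _ _)
theorem ca_nat (f : A ⟶ D) (g : B ⟶ E) : ca A B ≫ cj g f = cj f g ≫ ca D E := by
  obtain ⟨f⟩ := f; obtain ⟨g⟩ := g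
  exact Quotient.sound (Eqv.cConjNat _ _)
theorem co_nat (f : A ⟶ D) (g : B ⟶ E) : co A B ≫ dj g f = dj f g ≫ co D E := by
  obtain ⟨f⟩ := f; obtain ⟨g⟩ := g
  exact Quotient.sound (Eqv.cDisjNat _ _)
theorem dd_nat (f : A ⟶ D) (g : B ⟶ E) (h : C ⟶ F) :
    dd A B C ≫ dj (cj f g) h = cj f (dj g h) ≫ dd D E F := by
  obtain ⟨f⟩ := f; obtain ⟨g⟩ := g; obtain ⟨h⟩ := h
  exact Quotient.sound (Eqv.dNat _ _ _)
theorem mx_nat (f : A ⟶ D) (g : B ⟶ E) : mx A B ≫ dj f g = cj f g ≫ mx D E := by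
  obtain ⟨f⟩ := f; obtain ⟨g⟩ := g
  exact Quotient.sound (Eqv.mixNat _ _)
theorem dl_nat (p : P) (f : A ⟶ D) : dl p A ≫ cj f (𝟙 _) = f ≫ dl p D := by
  obtain ⟨f⟩ := f
  exact Quotient.sound (Eqv.deltaNat _ _)
theorem sg_nat (p : P) (f : A ⟶ D) : sg p A ≫ f = dj (𝟙 _) f ≫ sg p D := by
  obtain ⟨f⟩ := f
  exact Quotient.sound (Eqv.sigmaNat _ _)

theorem aT_aF (A B C : Form P) : aT A B C ≫ aF A B C = 𝟙 _ := Quotient.sound (Eqv.bConjIso₁ _ _ _)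
theorem aF_aT (A B C : Form P) : aF A B C ≫ aT A B C = 𝟙 _ := Quotient.sound (Eqv.bConjIso₂ _ _ _)
theorem oT_oF (A B C : Form P) : oT A B C ≫ oF A B C = 𝟙 _ := Quotient.sound (Eqv.bDisjIso₁ _ _ _)
theorem oF_oT (A B C : Form P) : oF A B C ≫ oT A B C = 𝟙 _ := Quotient.sound (Eqv.bDisjIso₂ _ _ _)
theorem ca_ca (A B : Form P) : ca A B ≫ ca B A = 𝟙 _ := Quotient.sound (Eqv.cConjIso _ _)
theorem co_co (A B : Form P) : co A B ≫ co B A = 𝟙 _ := Quotient.sound (Eqv.cDisjIso _ _)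

theorem aT_aF_assoc (A B C : Form P) {X : Form P} (h : _ ⟶ X) :
    aT A B C ≫ aF A B C ≫ h = h := by rw [← Category.assoc, aT_aF, Category.id_comp]
theorem aF_aT_assoc (A B C : Form P) {X : Form P} (h : _ ⟶ X) :
    aF A B C ≫ aT A B C ≫ h = h := by rw [← Category.assoc, aF_aT, Category.id_comp]
theorem oT_oF_assoc (A B C : Form P) {X : Form P} (h : _ ⟶ X) :
    oT A B C ≫ oF A B C ≫ h = h := by rw [← Category.assoc, oT_oF, Category.id_comp]
theorem oF_oT_assoc (A B C : Form P) {X : Form P} (h : _ ⟶ X) :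
    oF A B C ≫ oT A B C ≫ h = h := by rw [← Category.assoc, oF_oT, Category.id_comp]
theorem ca_ca_assoc (A B : Form P) {X : Form P} (h : _ ⟶ X) :
    ca A B ≫ ca B A ≫ h = h := by rw [← Category.assoc, ca_ca, Category.id_comp]
theorem co_co_assoc (A B : Form P) {X : Form P} (h : _ ⟶ X) :
    co A B ≫ co B A ≫ h = h := by rw [← Category.assoc, co_co, Category.id_comp]

theorem aF_pent (A B C D : Form P) : aF (A ⋏ B) C D ≫ aF A B (C ⋏ D) =
    cj (aF A B C) (𝟙 D) ≫ aF A (B ⋏ C) D ≫ cj (𝟙 A) (aF B C D) := by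
  rw [← Category.assoc]; exact Quotient.sound (Eqv.trans (Eqv.bConjPent A B C D) (Eqv.congComp (Eqv.refl _) (Eqv.refl _)))
theorem oF_pent (A B C D : Form P) : oF (A ⋎ B) C D ≫ oF A B (C ⋎ D) =
    dj (oF A B C) (𝟙 D) ≫ oF A (B ⋎ C) D ≫ dj (𝟙 A) (oF B C D) := by
  rw [← Category.assoc]; exact Quotient.sound (Eqv.bDisjPent A B C D)
theorem aF_hex (A B C : Form P) :
    cj (ca B A) (𝟙 C) ≫ aF A B C ≫ ca A (B ⋏ C) ≫ aF B C A ≫ cj (𝟙 B) (ca C A) = aF B A C := by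
  have h := qq_eq.2 (Eqv.bcConj A B C)
  simp only [qq_comp, Category.assoc] at h; exact h
theorem oF_hex (A B C : Form P) :
    dj (co B A) (𝟙 C) ≫ oF A B C ≫ co A (B ⋎ C) ≫ oF B C A ≫ dj (𝟙 B) (co C A) = oF B A C := by
  have h := qq_eq.2 (Eqv.bcDisj A B C)
  simp only [qq_comp, Category.assoc] at h; exact h

theorem dd_aF (A B C D : Form P) : dd (A ⋏ B) C D ≫ dj (aF A B C) (𝟙 D) =
    aF A B (C ⋎ D) ≫ cj (𝟙 A) (dd B C D) ≫ dd A (B ⋏ C) D := by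
  have h := qq_eq.2 (Eqv.dConj A B C D)
  simp only [qq_comp, Category.assoc] at h; exact h
theorem dd_oF (D C B A : Form P) : cj (𝟙 D) (oF C B A) ≫ dd D C (B ⋎ A) =
    dd D (C ⋎ B) A ≫ dj (dd D C B) (𝟙 A) ≫ oF (D ⋏ C) B A := by
  have h := qq_eq.2 (Eqv.dDisj D C B A)
  simp only [qq_comp, Category.assoc] at h; exact h
theorem dd_dr_aF (A B C D : Form P) : cj (dd A B C) (𝟙 D) ≫ dr (A ⋏ B) C D =
    aF A (B ⋎ C) D ≫ cj (𝟙 A) (dr B C D) ≫ dd A B (C ⋏ D) := by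
  have h := qq_eq.2 (Eqv.dBConj A B C D)
  simp only [qq_comp, Category.assoc] at h; exact h
theorem dd_dr_oF (D C B A : Form P) : dr D C (B ⋎ A) ≫ dj (𝟙 D) (dd C B A) =
    dd (D ⋎ C) B A ≫ dj (dr D C B) (𝟙 A) ≫ oF D (C ⋏ B) A := by
  have h := qq_eq.2 (Eqv.dBDisj D C B A)
  simp only [qq_comp, Category.assoc] at h; exact h
theorem dl_aF (A B : Form P) (p : P) : dl p (A ⋏ B) ≫ aF A B _ = cj (𝟙 A) (dl p B) :=
  qq_eq.2 (Eqv.bDelta A B p)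
theorem oF_sg (p : P) (B A : Form P) : oF _ B A ≫ sg p (B ⋎ A) = dj (sg p B) (𝟙 A) :=
  qq_eq.2 (Eqv.bSigma p B A)
theorem dl_dd (p : P) (B C : Form P) : dl p (B ⋎ C) ≫ ca _ _ ≫ dd _ B C =
    dj (dl p B ≫ ca _ _) (𝟙 C) := by
  rw [← Category.assoc]; exact qq_eq.2 (Eqv.dSigmaConj p B C)
theorem dd_sg (p : P) (C B : Form P) : dd C B _ ≫ co _ _ ≫ sg p (C ⋏ B) =
    cj (𝟙 C) (co _ _ ≫ sg p B) := by
  exact qq_eq.2 (Eqv.dDeltaDisj p C B)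
theorem dl_sg (p : P) : dl p (Form.pos p) ≫ dd _ _ _ ≫ sg p (Form.pos p) = 𝟙 _ := by
  rw [← Category.assoc]; exact qq_eq.2 (Eqv.sigmaDelta p)
theorem dl_sg' (p : P) : dl p (Form.natom p) ≫ cj (𝟙 _) (co _ _) ≫ dd _ _ _ ≫
    dj (ca _ _) (𝟙 _) ≫ sg p (Form.natom p) = 𝟙 _ := by
  have := qq_eq.2 (Eqv.sigmaDelta' p)
  simp only [sigma', delta', qq_comp, Category.assoc] at this; exact this
theorem aT_mx (A B C : Form P) : aT A B C ≫ mx (A ⋏ B) C = cj (𝟙 A) (mx B C) ≫ dd A B C :=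
  qq_eq.2 (Eqv.mixBConj A B C)
theorem mx_oT (C B A : Form P) : mx C (B ⋎ A) ≫ oT C B A = dd C B A ≫ dj (mx C B) (𝟙 A) :=
  qq_eq.2 (Eqv.mixBDisj C B A)
theorem mx_c (A B : Form P) : ca A B ≫ mx B A = mx A B ≫ co A B := qq_eq.2 (Eqv.mixC A B)

theorem dr_def (C B A : Form P) : dr C B A =
    ca _ _ ≫ cj (𝟙 A) (co C B) ≫ dd A B C ≫ dj (ca A B) (𝟙 C) ≫ co _ _ := by
  simp only [dr, dR, qq_comp, Category.assoc]; rfl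

end QuotientCategory

open CategoryTheory

section Extrusion

variable {P : Type} {A B C D E F : Form P}

theorem cj_split (f : A ⟶ C) (g : B ⟶ D) : cj f g = cj f (𝟙 B) ≫ cj (𝟙 C) g := by
  rw [cj_cj, Category.id_comp, Category.comp_id]

theorem cj_one_comp (X : Form P) (f : A ⟶ B) (g : B ⟶ C) :
    cj (𝟙 X) (f ≫ g) = cj (𝟙 X) f ≫ cj (𝟙 X) g := by rw [cj_cj, Category.id_comp]
theorem cj_comp_one (X : Form P) (f : A ⟶ B) (g : B ⟶ C) :
    cj (f ≫ g) (𝟙 X) = cj f (𝟙 X) ≫ cj g (𝟙 X) := by rw [cj_cj, Category.id_comp]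
theorem dj_one_comp (X : Form P) (f : A ⟶ B) (g : B ⟶ C) :
    dj (𝟙 X) (f ≫ g) = dj (𝟙 X) f ≫ dj (𝟙 X) g := by rw [dj_dj, Category.id_comp]
theorem dj_comp_one (X : Form P) (f : A ⟶ B) (g : B ⟶ C) :
    dj (f ≫ g) (𝟙 X) = dj f (𝟙 X) ≫ dj g (𝟙 X) := by rw [dj_dj, Category.id_comp]

/-- The associativity of disjunction as an isomorphism. -/
def oI (A B C : Form P) : ((A ⋎ B) ⋎ C) ≅ (A ⋎ (B ⋎ C)) := ⟨oF A B C, oT A B C, oF_oT _ _ _, oT_oF _ _ _⟩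
def aI (A B C : Form P) : ((A ⋏ B) ⋏ C) ≅ (A ⋏ (B ⋏ C)) := ⟨aF A B C, aT A B C, aF_aT _ _ _, aT_aF _ _ _⟩
def coI (A B : Form P) : (A ⋎ B) ≅ (B ⋎ A) := ⟨co A B, co B A, co_co _ _, co_co _ _⟩
def caI (A B : Form P) : (A ⋏ B) ≅ (B ⋏ A) := ⟨ca A B, ca B A, ca_ca _ _, ca_ca _ _⟩

instance (A B C : Form P) : IsIso (oF A B C) := (oI A B C).isIso_hom
instance (A B C : Form P) : IsIso (oT A B C) := (oI A B C).isIso_inv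
instance (A B C : Form P) : IsIso (aF A B C) := (aI A B C).isIso_hom
instance (A B C : Form P) : IsIso (aT A B C) := (aI A B C).isIso_inv
instance (A B : Form P) : IsIso (co A B) := (coI A B).isIso_hom
instance (A B : Form P) : IsIso (ca A B) := (caI A B).isIso_hom

instance (f : A ⟶ B) (g : C ⟶ D) [IsIso f] [IsIso g] : IsIso (dj f g) :=
  ⟨dj (inv f) (inv g), by simp [dj_dj, dj_id], by simp [dj_dj, dj_id]⟩
instance (f : A ⟶ B) (g : C ⟶ D) [IsIso f] [IsIso g] : IsIso (cj f g) :=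
  ⟨cj (inv f) (inv g), by simp [cj_cj, cj_id], by simp [cj_cj, cj_id]⟩

theorem aF_nat (f : A ⟶ D) (g : B ⟶ E) (h : C ⟶ F) :
    aF A B C ≫ cj f (cj g h) = cj (cj f g) h ≫ aF D E F := by
  have := aT_nat f g h
  rw [← cancel_epi (aT A B C)]
  rw [aT_aF_assoc, ← Category.assoc, this, Category.assoc, aT_aF, Category.comp_id]
theorem oF_nat (f : A ⟶ D) (g : B ⟶ E) (h : C ⟶ F) :
    oF A B C ≫ dj f (dj g h) = dj (dj f g) h ≫ oF D E F := by
  have := oT_nat f g h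
  rw [← cancel_epi (oT A B C)]
  rw [oT_oF_assoc, ← Category.assoc, this, Category.assoc, oT_oF, Category.comp_id]

theorem cj_inv (f : A ⟶ B) (g : B ⟶ A) (h : f ≫ g = 𝟙 _) (X : Form P) :
    cj (𝟙 X) f ≫ cj (𝟙 X) g = 𝟙 _ := by rw [← cj_one_comp, h, cj_id]
theorem dj_inv (f : A ⟶ B) (g : B ⟶ A) (h : f ≫ g = 𝟙 _) (X : Form P) :
    dj (𝟙 X) f ≫ dj (𝟙 X) g = 𝟙 _ := by rw [← dj_one_comp, h, dj_id]
theorem dj_inv' (f : A ⟶ B) (g : B ⟶ A) (h : f ≫ g = 𝟙 _) (X : Form P) :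
    dj f (𝟙 X) ≫ dj g (𝟙 X) = 𝟙 _ := by rw [← dj_comp_one, h, dj_id]
theorem cj_inv' (f : A ⟶ B) (g : B ⟶ A) (h : f ≫ g = 𝟙 _) (X : Form P) :
    cj f (𝟙 X) ≫ cj g (𝟙 X) = 𝟙 _ := by rw [← cj_comp_one, h, cj_id]

theorem o_hex1 (A B C : Form P) : oF A B C ≫ co A (B ⋎ C) ≫ oF B C A =
    dj (co A B) (𝟙 C) ≫ oF B A C ≫ dj (𝟙 B) (co A C) := by
  rw [← oF_hex A B C]
  simp only [Category.assoc]
  rw [dj_inv _ _ (co_co C A), Category.comp_id, ← Category.assoc (dj _ _) (dj _ _),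
    dj_inv' _ _ (co_co A B), Category.id_comp]

theorem o_hex2 (A B C : Form P) : oT A B C ≫ co (A ⋎ B) C ≫ oT C A B =
    dj (𝟙 A) (co B C) ≫ oT A C B ≫ dj (co A C) (𝟙 B) := by
  have h := o_hex1 C A B
  rw [← cancel_epi (oF C A B ≫ co C (A ⋎ B) ≫ oF A B C)]
  conv_rhs => rw [h]
  simp only [Category.assoc, oF_oT_assoc, co_co_assoc, oF_oT]
  rw [← Category.assoc (dj (𝟙 _) _), dj_inv _ _ (co_co C B), Category.id_comp, oF_oT_assoc,
    dj_inv' _ _ (co_co C A)]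

theorem o_rev (D E C : Form P) : oF D E C ≫ co D (E ⋎ C) ≫ dj (co E C) (𝟙 D) =
    co (D ⋎ E) C ≫ dj (𝟙 C) (co D E) ≫ oT C E D := by
  have h1 : oF D E C ≫ co D (E ⋎ C) =
      dj (co D E) (𝟙 C) ≫ oF E D C ≫ dj (𝟙 E) (co D C) ≫ oT E C D := by
    have := congrArg (fun z => z ≫ oT E C D) (o_hex1 D E C)
    simpa only [Category.assoc, oF_oT, Category.comp_id] using this
  rw [← Category.assoc, h1]
  simp only [Category.assoc]
  rw [← o_hex2, oF_oT_assoc, ← Category.assoc, ← Category.assoc, ← co_nat, Category.assoc]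

theorem o_rev' (D E C : Form P) : dj (co C E) (𝟙 D) ≫ co (E ⋎ C) D ≫ oT D E C =
    oF C E D ≫ dj (𝟙 C) (co E D) ≫ co C (D ⋎ E) := by
  have h := o_rev D E C
  rw [← cancel_epi (oF D E C ≫ co D (E ⋎ C) ≫ dj (co E C) (𝟙 D))]
  conv_rhs => rw [h]
  simp only [Category.assoc, oT_oF_assoc]
  rw [← Category.assoc (dj _ _) (dj _ _), dj_inv' _ _ (co_co _ _), Category.id_comp,
    co_co_assoc, oF_oT, ← Category.assoc (dj _ _) (dj _ _), dj_inv _ _ (co_co _ _),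
    Category.id_comp, co_co]

/-- Extrusion of a disjunct out of a conjunction. -/
def xx (A D C : Form P) : (A ⋏ (D ⋎ C)) ⟶ (D ⋎ (A ⋏ C)) :=
  cj (𝟙 A) (co D C) ≫ dd A C D ≫ co (A ⋏ C) D

theorem xx_nat {A' D' C' : Form P} (f : A ⟶ A') (g : D ⟶ D') (h : C ⟶ C') :
    cj f (dj g h) ≫ xx A' D' C' = xx A D C ≫ dj g (cj f h) := by
  simp only [xx, Category.assoc]
  rw [co_nat, ← Category.assoc (dd _ _ _), dd_nat, cj_cj_assoc, Category.assoc, cj_cj_assoc,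
    co_nat, Category.comp_id, Category.id_comp]

theorem dr_xx (D C W : Form P) : dr D C W = ca _ _ ≫ xx W D C ≫ dj (𝟙 D) (ca W C) := by
  simp only [dr_def, xx, Category.assoc, co_nat]

theorem xx_oF (A D E C : Form P) : xx A (D ⋎ E) C ≫ oF D E (A ⋏ C) =
    cj (𝟙 A) (oF D E C) ≫ xx A D (E ⋎ C) ≫ dj (𝟙 D) (xx A E C) := by
  have hR : cj (𝟙 A) (oF D E C) ≫ xx A D (E ⋎ C) ≫ dj (𝟙 D) (xx A E C) =
      cj (𝟙 A) (oF D E C ≫ co D (E ⋎ C) ≫ dj (co E C) (𝟙 D)) ≫ dd A (C ⋎ E) D ≫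
        dj (dd A C E) (𝟙 D) ≫ dj (co _ _) (𝟙 D) ≫ co _ _ := by
    simp only [xx, Category.assoc, co_nat]
    simp only [dj_comp_one, cj_one_comp, Category.assoc]
    rw [← Category.assoc (dd A (E ⋎ C) D), dd_nat, Category.assoc,
      cj_cj_assoc (𝟙 A) (𝟙 A) (co D (E ⋎ C)), co_nat, ← cj_cj_assoc]
  have hd : cj (𝟙 A) (oT C E D) ≫ dd A (C ⋎ E) D ≫ dj (dd A C E) (𝟙 D) =
      dd A C (E ⋎ D) ≫ oT _ _ _ := by
    have := congrArg (fun z => cj (𝟙 A) (oT C E D) ≫ z ≫ oT _ _ _) (dd_oF A C E D)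
    simp only [Category.assoc, oF_oT, Category.comp_id] at this
    rw [← this, cj_cj_assoc, oT_oF, Category.id_comp, cj_id, Category.id_comp]
  rw [hR, o_rev, cj_one_comp, cj_one_comp]
  simp only [Category.assoc]
  have hd' := congrArg (fun z => z ≫ dj (co (A ⋏ C) E) (𝟙 D) ≫ co _ _) hd
  simp only [Category.assoc] at hd'
  rw [hd', ← Category.assoc (cj (𝟙 A) (dj _ _)), ← dd_nat]
  simp only [xx, Category.assoc, cj_id]
  congr 2
  have := o_rev' D E (A ⋏ C)
  have h2 := congrArg (fun z => oT (A ⋏ C) E D ≫ z ≫ oF _ _ _) this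
  simp only [Category.assoc, oT_oF, Category.comp_id, oT_oF_assoc] at h2
  rw [h2, dj_dj_assoc, co_co, Category.id_comp, dj_id, Category.id_comp]

theorem xx_aF (A B D C : Form P) : xx (A ⋏ B) D C ≫ dj (𝟙 D) (aF A B C) =
    aF A B (D ⋎ C) ≫ cj (𝟙 A) (xx B D C) ≫ xx A D (B ⋏ C) := by
  simp only [xx, Category.assoc, cj_one_comp]
  rw [co_nat, ← Category.assoc (dd _ _ _), dd_aF, cj_cj_assoc (𝟙 A) (𝟙 A) (co (B ⋏ C) D),
    co_co, Category.id_comp, cj_id, Category.id_comp]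
  simp only [← Category.assoc]
  congr 3
  rw [aF_nat, cj_id]

theorem link_swap (G A D C : Form P) : dr G A (D ⋎ C) ≫ dj (𝟙 G) (xx A D C) =
    ca _ _ ≫ dr D C (G ⋎ A) ≫ dj (𝟙 D) (xx C G A ≫ dj (𝟙 G) (ca C A)) ≫
      oT D G _ ≫ dj (co D G) (𝟙 _) ≫ oF G D _ := by
  have hdr : ∀ (g : D ⋎ C ⟶ C ⋎ D), cj (𝟙 (G ⋎ A)) g ≫ dr G A (C ⋎ D) =
      dr G A (D ⋎ C) ≫ dj (𝟙 G) (cj (𝟙 A) g) := by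
    intro g
    rw [dr_xx, dr_xx]
    simp only [Category.assoc]
    rw [← Category.assoc, ← ca_nat, Category.assoc]
    rw [← dj_id G A, ← Category.assoc (cj g _), xx_nat, Category.assoc, dj_dj, dj_dj, ca_nat]
  have h1 : dr G A (D ⋎ C) ≫ dj (𝟙 G) (xx A D C) = cj (𝟙 _) (co D C) ≫ dd (G ⋎ A) C D ≫
      dj (dr G A C) (𝟙 _) ≫ oF G (A ⋏ C) D ≫ dj (𝟙 G) (co _ _) := by
    have h := dd_dr_oF G A C D
    simp only [xx, dj_one_comp]
    rw [← Category.assoc, ← hdr, Category.assoc, ← Category.assoc (dr _ _ _), h]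
    simp only [Category.assoc]
  have h2 : cj (𝟙 (G ⋎ A)) (co D C) ≫ dd (G ⋎ A) C D = xx (G ⋎ A) D C ≫ co _ _ := by
    simp only [xx, Category.assoc, co_co, Category.comp_id]
  have h3 : ca (G ⋎ A) (D ⋎ C) ≫ dr D C (G ⋎ A) = xx _ _ _ ≫ dj (𝟙 D) (ca _ _) := by
    rw [dr_xx, ca_ca_assoc]
  have h4 : co D (G ⋎ (A ⋏ C)) ≫ oF G (A ⋏ C) D ≫ dj (𝟙 G) (co (A ⋏ C) D) =
      oT D G _ ≫ dj (co D G) (𝟙 _) ≫ oF G D (A ⋏ C) := by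
    have h := o_hex1 D G (A ⋏ C)
    have h' := congrArg (fun z => oT _ _ _ ≫ z ≫ dj (𝟙 G) (co (A ⋏ C) D)) h
    simp only [Category.assoc, oT_oF_assoc, dj_inv _ _ (co_co D (A ⋏ C)), Category.comp_id] at h'
    exact h'
  rw [h1, ← Category.assoc, h2, ← Category.assoc (ca _ _), h3]
  simp only [Category.assoc]
  rw [← Category.assoc (co _ _), co_nat, Category.assoc, h4]
  rw [dj_dj_assoc, Category.comp_id, dr_xx]

theorem dr_mx (X Y Z : Form P) : dr X Y Z ≫ dj (𝟙 X) (mx Y Z) = mx (X ⋎ Y) Z ≫ oF X Y Z := by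
  rw [dr_def]
  simp only [Category.assoc, co_nat]
  rw [dj_dj_assoc, mx_c, Category.comp_id, ← Category.id_comp (𝟙 X), ← dj_dj_assoc,
    ← Category.assoc (dd _ _ _), ← mx_oT, Category.assoc, ← Category.assoc (cj _ _), ← mx_nat,
    Category.assoc, ← Category.assoc (ca _ _), mx_c, Category.assoc]
  have h := congrArg (fun z => z ≫ dj (co Z Y) (𝟙 X) ≫ co _ _) (o_rev X Y Z)
  simp only [Category.assoc] at h
  rw [← h, dj_dj_assoc, co_co, Category.id_comp, dj_id, Category.id_comp, co_co,
    Category.comp_id]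

end Extrusion

open CategoryTheory MonoidalCategory

section Points

variable {P : Type} {A B C D E F : Form P}

theorem a_hex (X B C : Form P) : aF X B C ≫ cj (𝟙 X) (ca B C) =
    ca (X ⋏ B) C ≫ aT C X B ≫ cj (ca C X) (𝟙 B) ≫ aF X C B := by
  rw [← aF_hex C X B, cj_cj_assoc, ca_ca, Category.id_comp, cj_id, Category.id_comp, aT_aF_assoc,
    ca_ca_assoc]

/-- A point of `B`: a virtual arrow from the (absent) unit to `B`. -/
structure Pt (B : Form P) where
  app : ∀ X : Form P, X ⟶ X ⋏ B
  nat : ∀ {X Y : Form P} (f : X ⟶ Y), f ≫ app Y = app X ≫ cj f (𝟙 B)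
  bl : ∀ X Y : Form P, app (X ⋏ Y) ≫ aF X Y B = cj (𝟙 X) (app Y)
  dlaw : ∀ X Y : Form P, app (X ⋎ Y) ≫ ca _ _ ≫ dd B X Y = dj (app X ≫ ca _ _) (𝟙 Y)

theorem Pt.ext' {t u : Pt B} (h : ∀ X, t.app X = u.app X) : t = u := by
  cases t; cases u; simp only [Pt.mk.injEq]; funext X; exact h X

/-- Composition of a point with an arrow. -/
def Pt.map (t : Pt B) (f : B ⟶ C) : Pt C where
  app X := t.app X ≫ cj (𝟙 X) f
  nat g := by
    rw [← Category.assoc, t.nat, Category.assoc, Category.assoc, cj_cj, cj_cj]; simp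
  bl X Y := by
    rw [Category.assoc, ← cj_id X Y, ← aF_nat, ← Category.assoc, t.bl, cj_cj, Category.id_comp]
  dlaw X Y := by
    rw [Category.assoc, ← Category.assoc (cj _ _), ← ca_nat, Category.assoc, ← dj_id X Y, ← dd_nat,
      ← Category.assoc (ca _ _), ← Category.assoc, t.dlaw, dj_dj, Category.assoc, Category.assoc,
      ca_nat, Category.id_comp]

theorem Pt.map_app (t : Pt B) (f : B ⟶ C) (X : Form P) : (t.map f).app X = t.app X ≫ cj (𝟙 X) f := rfl
theorem Pt.map_id (t : Pt B) : t.map (𝟙 B) = t := Pt.ext' fun X => by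
  rw [Pt.map_app, cj_id, Category.comp_id]
theorem Pt.map_map (t : Pt B) (f : B ⟶ C) (g : C ⟶ D) : (t.map f).map g = t.map (f ≫ g) :=
  Pt.ext' fun X => by simp only [Pt.map_app, cj_one_comp, Category.assoc]

theorem Pt.dlaw' (t : Pt B) (X Y : Form P) : t.app (X ⋎ Y) ≫ dr X Y B = dj (𝟙 X) (t.app Y) := by
  rw [dr_def, ← Category.assoc (ca _ _), ca_nat, Category.assoc, ← Category.assoc, ← t.nat,
    Category.assoc, ← Category.assoc (ca _ _), ← Category.assoc (t.app _), t.dlaw, dj_dj_assoc,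
    Category.assoc, ca_ca, Category.comp_id, Category.id_comp, ← co_nat, co_co_assoc]

theorem Pt.slide (t : Pt B) (X C : Form P) :
    cj (t.app X) (𝟙 C) ≫ aF X B C ≫ cj (𝟙 X) (ca B C) = cj (𝟙 X) (t.app C) := by
  rw [a_hex, ← Category.assoc, ← ca_nat, Category.assoc, ← t.bl C X, Category.assoc, aF_aT_assoc,
    ← Category.assoc (t.app _), ← t.nat, Category.assoc, ca_ca_assoc, t.bl]

theorem Pt.comm (t : Pt B) (u : Pt C) : (t.map (u.app B)).map (ca B C) = u.map (t.app C) :=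
  Pt.ext' fun X => by
    simp only [Pt.map_app, Category.assoc]
    rw [← u.bl, ← Category.assoc, ← Category.assoc, u.nat, Category.assoc, Category.assoc, t.slide]

/-- The basic point. -/
def dPt (p : P) : Pt (Form.natom p ⋎ Form.pos p) where
  app X := dl p X
  nat f := (dl_nat p f).symm
  bl X Y := dl_aF X Y p
  dlaw X Y := dl_dd p X Y

end Points

/-- Formulae together with a unit for disjunction. -/
inductive Ob (P : Type) : Type
  | un : Ob P
  | of : Form P → Ob P

namespace Ob

variable {P : Type}

/-- Arrows of the extended category. -/
def Hm : Ob P → Ob P → Type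
  | un, un => PUnit
  | un, of B => Pt B
  | of _, un => PEmpty
  | of A, of B => A ⟶ B

/-- Identities. -/
def idm : ∀ X : Ob P, Hm X X
  | un => PUnit.unit
  | of A => 𝟙 A

/-- Composition. -/
def cmp : ∀ {X Y Z : Ob P}, Hm X Y → Hm Y Z → Hm X Z
  | un, un, un, _, _ => PUnit.unit
  | un, un, of _, _, t => t
  | un, of _, of _, t, f => Pt.map t f
  | of A, of B, of C, f, g => @CategoryStruct.comp (Form P) _ A B C f g
  | of _, un, _, f, _ => PEmpty.elim f
  | _, of _, un, _, f => PEmpty.elim f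

instance : Category (Ob P) where
  Hom := Hm
  id := idm
  comp := cmp
  id_comp := by
    rintro (_ | A) (_ | B) f
    · rfl
    · rfl
    · exact PEmpty.elim f
    · exact Category.id_comp (obj := Form P) f
  comp_id := by
    rintro (_ | A) (_ | B) f
    · rfl
    · exact Pt.map_id f
    · exact PEmpty.elim f
    · exact Category.comp_id (obj := Form P) f
  assoc := by
    rintro (_ | A) (_ | B) (_ | C) (_ | D) f g h <;>
      first
        | exact PEmpty.elim f
        | exact PEmpty.elim g
        | exact PEmpty.elim h
        | rfl
        | exact Pt.map_map f g h
        | exact Category.assoc (obj := Form P) f g h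

/-- Arrows between formulae as arrows of the extended category. -/
def ar {A B : Form P} (f : A ⟶ B) : of A ⟶ of B := f
/-- Points as arrows. -/
def pt {B : Form P} (t : Pt B) : un ⟶ of B := t

theorem ar_comp {A B C : Form P} (f : A ⟶ B) (g : B ⟶ C) : ar (f ≫ g) = ar f ≫ ar g := rfl
theorem ar_id (A : Form P) : ar (𝟙 A) = 𝟙 (of A) := rfl
theorem pt_ar {A B : Form P} (t : Pt A) (f : A ⟶ B) : pt t ≫ ar f = pt (t.map f) := rfl
theorem ar_ex {A B : Form P} (f : of A ⟶ of B) : ∃ g, f = ar g := ⟨f, rfl⟩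
theorem pt_ex {B : Form P} (f : un ⟶ of B) : ∃ g, f = pt g := ⟨f, rfl⟩
theorem ar_inj {A B : Form P} {f g : A ⟶ B} (h : ar f = ar g) : f = g := h

instance : Subsingleton ((un : Ob P) ⟶ un) := inferInstanceAs (Subsingleton PUnit)
instance (A : Form P) : IsEmpty (of A ⟶ un) := inferInstanceAs (IsEmpty PEmpty)

/-- The formula `X ∨ B`. -/
def orf : Ob P → Form P → Form P
  | un, B => B
  | of A, B => A ⋎ B

/-- Disjunction with unit. -/
def ten (X : Ob P) : Ob P → Ob P
  | un => X
  | of B => of (orf X B)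

def wl : ∀ (X : Ob P) {Y Z : Ob P}, (Y ⟶ Z) → (ten X Y ⟶ ten X Z)
  | un, un, un, _ => PUnit.unit
  | un, un, of _, t => t
  | un, of _, of _, f => f
  | of A, un, un, _ => 𝟙 (of A)
  | of A, un, of B, t => ar ((show Pt B from t).app A ≫ mx A B)
  | of A, of _, of _, f => ar (dj (𝟙 A) f)
  | _, of _, un, f => PEmpty.elim f

def wr : ∀ {X Y : Ob P} (_ : X ⟶ Y) (Z : Ob P), (ten X Z ⟶ ten Y Z)
  | _, _, f, un => f
  | un, un, _, of B => 𝟙 (of B)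
  | un, of C, t, of B => ar ((show Pt C from t).app B ≫ mx B C ≫ co B C)
  | of _, of _, f, of B => ar (dj f (𝟙 B))
  | of _, un, f, of _ => PEmpty.elim f

def asc : ∀ (X Y Z : Ob P), ten (ten X Y) Z ≅ ten X (ten Y Z)
  | X, Y, un => Iso.refl (ten X Y)
  | X, un, of C => Iso.refl (ten X (of C))
  | un, of B, of C => Iso.refl (of (B ⋎ C))
  | of A, of B, of C => ⟨ar (oF A B C), ar (oT A B C), oF_oT A B C, oT_oF A B C⟩

def bra : ∀ (X Y : Ob P), ten X Y ≅ ten Y X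
  | un, un => Iso.refl un
  | un, of B => Iso.refl (of B)
  | of A, un => Iso.refl (of A)
  | of A, of B => ⟨ar (co A B), ar (co B A), co_co A B, co_co B A⟩

def lun : ∀ X : Ob P, ten un X ≅ X
  | un => Iso.refl un
  | of B => Iso.refl (of B)

theorem wl_id (X Y : Ob P) : wl X (𝟙 Y) = 𝟙 _ := by
  cases X <;> cases Y
  · rfl
  · rfl
  · rfl
  · exact dj_id _ _
theorem wr_id (X Y : Ob P) : wr (𝟙 X) Y = 𝟙 _ := by
  cases X <;> cases Y
  · rfl
  · rfl
  · rfl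
  · exact dj_id _ _

theorem wl_comp (X : Ob P) {Y Z W : Ob P} (f : Y ⟶ Z) (g : Z ⟶ W) :
    wl X (f ≫ g) = wl X f ≫ wl X g := by
  cases X <;> cases Y <;> cases Z <;> first | exact (IsEmpty.false f).elim | skip
  all_goals cases W <;> first | exact (IsEmpty.false g).elim | skip
  · rfl
  · rfl
  · rfl
  · rfl
  · exact (Category.id_comp _).symm
  · exact (Category.id_comp _).symm
  · obtain ⟨t, ef⟩ : ∃ t : Pt _, f = t := ⟨f, rfl⟩; rw [ef]; clear ef
    obtain ⟨h, eg⟩ : ∃ t : (_ : Form P) ⟶ _, g = t := ⟨g, rfl⟩; rw [eg]; clear eg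
    change ar ((t.app _ ≫ cj (𝟙 _) h) ≫ mx _ _) = ar ((t.app _ ≫ mx _ _) ≫ dj (𝟙 _) h)
    rw [Category.assoc, Category.assoc, mx_nat]
  · exact congrArg ar (dj_one_comp _ _ _)

theorem wr_comp {X Y Z : Ob P} (f : X ⟶ Y) (g : Y ⟶ Z) (W : Ob P) :
    wr (f ≫ g) W = wr f W ≫ wr g W := by
  cases W
  · rfl
  cases X <;> cases Y <;> first | exact (IsEmpty.false f).elim | skip
  all_goals cases Z <;> first | exact (IsEmpty.false g).elim | skip
  · exact (Category.id_comp _).symm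
  · exact (Category.id_comp _).symm
  · obtain ⟨t, ef⟩ : ∃ t : Pt _, f = t := ⟨f, rfl⟩; rw [ef]; clear ef
    obtain ⟨h, eg⟩ : ∃ t : (_ : Form P) ⟶ _, g = t := ⟨g, rfl⟩; rw [eg]; clear eg
    change ar ((t.app _ ≫ cj (𝟙 _) h) ≫ mx _ _ ≫ co _ _) =
      ar ((t.app _ ≫ mx _ _ ≫ co _ _) ≫ dj h (𝟙 _))
    simp only [Category.assoc, co_nat]
    rw [← Category.assoc (mx _ _), mx_nat, Category.assoc]
  · exact congrArg ar (dj_comp_one _ _ _)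

theorem bra_wl (Z : Ob P) {X Y : Ob P} (f : X ⟶ Y) :
    wr f Z ≫ (bra Y Z).hom = (bra X Z).hom ≫ wl Z f := by
  cases Z <;> cases X <;> cases Y <;> first | exact (IsEmpty.false f).elim | skip
  · rfl
  · exact (Category.comp_id f).trans (Category.id_comp f).symm
  · exact (Category.comp_id f).trans (Category.id_comp f).symm
  · rfl
  · obtain ⟨t, ef⟩ : ∃ t : Pt _, f = t := ⟨f, rfl⟩; rw [ef]; clear ef
    change ar ((t.app _ ≫ mx _ _ ≫ co _ _) ≫ co _ _) = ar (𝟙 _ ≫ (t.app _ ≫ mx _ _))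
    simp only [Category.assoc, co_co, Category.comp_id, Category.id_comp]
  · exact congrArg ar (co_nat _ _).symm

theorem bra_symm (X Y : Ob P) : (bra X Y).hom ≫ (bra Y X).hom = 𝟙 _ := by
  cases X <;> cases Y
  · rfl
  · exact Category.id_comp (𝟙 _)
  · exact Category.id_comp (𝟙 _)
  · exact congrArg ar (co_co _ _)

theorem bra_wr (Z : Ob P) {X Y : Ob P} (f : X ⟶ Y) :
    wl Z f ≫ (bra Z Y).hom = (bra Z X).hom ≫ wr f Z := by
  have h := bra_wl Z f
  calc wl Z f ≫ (bra Z Y).hom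
      = (bra Z X).hom ≫ ((bra X Z).hom ≫ wl Z f) ≫ (bra Z Y).hom := by
        rw [← Category.assoc, ← Category.assoc, bra_symm, Category.id_comp]
    _ = (bra Z X).hom ≫ wr f Z := by rw [← h, Category.assoc, bra_symm, Category.comp_id]

theorem wexch {X Y Z W : Ob P} (f : X ⟶ Y) (g : Z ⟶ W) :
    wl X g ≫ wr f W = wr f Z ≫ wl Y g := by
  cases X <;> cases Y <;> first | exact (IsEmpty.false f).elim | skip
  all_goals cases Z <;> cases W <;> first | exact (IsEmpty.false g).elim | skip
  · rfl
  · exact (Category.comp_id (obj := Ob P) g)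
  · exact (Category.comp_id (obj := Ob P) g).trans (Category.id_comp (obj := Ob P) g).symm
  · exact (Category.comp_id (obj := Ob P) f).symm
  · obtain ⟨t, ef⟩ : ∃ t : Pt _, f = t := ⟨f, rfl⟩; rw [ef]; clear ef
    obtain ⟨u, eg⟩ : ∃ t : Pt _, g = t := ⟨g, rfl⟩; rw [eg]; clear eg
    change pt (u.map (t.app _ ≫ mx _ _ ≫ co _ _)) = pt (t.map (u.app _ ≫ mx _ _))
    rw [← Pt.map_map, ← Pt.comm, Pt.map_map, Pt.map_map, ← Category.assoc (ca _ _), mx_c,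
      Category.assoc, co_co, Category.comp_id]
  · obtain ⟨t, ef⟩ : ∃ t : Pt _, f = t := ⟨f, rfl⟩; rw [ef]; clear ef
    obtain ⟨h, eg⟩ : ∃ t : (_ : Form P) ⟶ _, g = t := ⟨g, rfl⟩; rw [eg]; clear eg
    change ar (h ≫ (t.app _ ≫ mx _ _ ≫ co _ _)) = ar ((t.app _ ≫ mx _ _ ≫ co _ _) ≫ dj (𝟙 _) h)
    simp only [Category.assoc, co_nat]
    rw [← Category.assoc, t.nat, ← Category.assoc (mx _ _), mx_nat]
    simp only [Category.assoc]
  · exact (Category.id_comp (obj := Ob P) f).trans (Category.comp_id (obj := Ob P) f).symm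
  · obtain ⟨h, ef⟩ : ∃ t : (_ : Form P) ⟶ _, f = t := ⟨f, rfl⟩; rw [ef]; clear ef
    obtain ⟨t, eg⟩ : ∃ t : Pt _, g = t := ⟨g, rfl⟩; rw [eg]; clear eg
    change ar ((t.app _ ≫ mx _ _) ≫ dj h (𝟙 _)) = ar (h ≫ (t.app _ ≫ mx _ _))
    rw [← Category.assoc, t.nat, Category.assoc, mx_nat, Category.assoc]
  · obtain ⟨h, ef⟩ : ∃ t : (_ : Form P) ⟶ _, f = t := ⟨f, rfl⟩; rw [ef]; clear ef
    obtain ⟨k, eg⟩ : ∃ t : (_ : Form P) ⟶ _, g = t := ⟨g, rfl⟩; rw [eg]; clear eg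
    change ar (dj (𝟙 _) k ≫ dj h (𝟙 _)) = ar (dj h (𝟙 _) ≫ dj (𝟙 _) k)
    rw [dj_dj, dj_dj]; simp only [Category.id_comp, Category.comp_id]

theorem asc_nat3 (X Y : Ob P) {Z W : Ob P} (f : Z ⟶ W) :
    wl (ten X Y) f ≫ (asc X Y W).hom = (asc X Y Z).hom ≫ wl X (wl Y f) := by
  cases Z <;> cases W <;> first | exact (IsEmpty.false f).elim | skip
  · change wl (ten X Y) (𝟙 un) ≫ 𝟙 _ = 𝟙 _ ≫ wl X (wl Y (𝟙 un))
    rw [wl_id, wl_id, wl_id]; rfl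
  · cases Y
    · cases X
      · exact Category.comp_id (obj := Ob P) f |>.trans (Category.id_comp (obj := Ob P) f).symm
      · exact Category.comp_id (obj := Ob P) _ |>.trans (Category.id_comp (obj := Ob P) _).symm
    · cases X
      · exact Category.comp_id (obj := Ob P) _ |>.trans (Category.id_comp (obj := Ob P) _).symm
      · obtain ⟨t, ef⟩ : ∃ t : Pt _, f = t := ⟨f, rfl⟩; rw [ef]; clear ef
        change ar ((t.app _ ≫ mx _ _) ≫ oF _ _ _) = ar (𝟙 _ ≫ dj (𝟙 _) (t.app _ ≫ mx _ _))
        rw [Category.id_comp, dj_one_comp, ← t.dlaw', Category.assoc, Category.assoc, dr_mx]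
  · cases Y
    · cases X
      · exact Category.comp_id (obj := Ob P) f |>.trans (Category.id_comp (obj := Ob P) f).symm
      · exact Category.comp_id (obj := Ob P) _ |>.trans (Category.id_comp (obj := Ob P) _).symm
    · cases X
      · exact Category.comp_id (obj := Ob P) _ |>.trans (Category.id_comp (obj := Ob P) _).symm
      · obtain ⟨t, ef⟩ : ∃ t : (_ : Form P) ⟶ _, f = t := ⟨f, rfl⟩; rw [ef]; clear ef
        change ar (dj (𝟙 _) t ≫ oF _ _ _) = ar (oF _ _ _ ≫ dj (𝟙 _) (dj (𝟙 _) t))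
        rw [oF_nat, dj_id]

theorem hexF (X Y Z : Ob P) : (asc X Y Z).hom ≫ (bra X (ten Y Z)).hom ≫ (asc Y Z X).hom =
    wr (bra X Y).hom Z ≫ (asc Y X Z).hom ≫ wl Y (bra X Z).hom := by
  cases X
  · cases Y <;> cases Z
    · rfl
    · change 𝟙 _ ≫ 𝟙 _ ≫ 𝟙 _ = 𝟙 _ ≫ 𝟙 _ ≫ 𝟙 _; rfl
    · change 𝟙 _ ≫ 𝟙 _ ≫ 𝟙 _ = 𝟙 _ ≫ 𝟙 _ ≫ 𝟙 _; rfl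
    · change 𝟙 _ ≫ 𝟙 _ ≫ 𝟙 _ = ar (dj (𝟙 _) (𝟙 _)) ≫ 𝟙 _ ≫ ar (dj (𝟙 _) (𝟙 _))
      rw [dj_id]; rfl
  · cases Y <;> cases Z
    · change 𝟙 _ ≫ 𝟙 _ ≫ 𝟙 _ = 𝟙 _ ≫ 𝟙 _ ≫ 𝟙 _; rfl
    · change 𝟙 _ ≫ ar (co _ _) ≫ 𝟙 _ = ar (dj (𝟙 _) (𝟙 _)) ≫ 𝟙 _ ≫ ar (co _ _)
      rw [dj_id, ar_id]; simp only [Category.id_comp, Category.comp_id]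
    · change 𝟙 _ ≫ ar (co _ _) ≫ 𝟙 _ = ar (co _ _) ≫ 𝟙 _ ≫ ar (dj (𝟙 _) (𝟙 _))
      rw [dj_id, ar_id]; simp only [Category.id_comp, Category.comp_id]
    · exact congrArg ar (o_hex1 _ _ _)

theorem pentF (W X Y Z : Ob P) : wr (asc W X Y).hom Z ≫ (asc W (ten X Y) Z).hom ≫
    wl W (asc X Y Z).hom = (asc (ten W X) Y Z).hom ≫ (asc W X (ten Y Z)).hom := by
  cases Z
  · change (asc W X Y).hom ≫ 𝟙 _ ≫ wl W (𝟙 _) = 𝟙 _ ≫ (asc W X Y).hom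
    rw [wl_id]; simp only [Category.id_comp]; exact Category.comp_id _
  cases Y
  · change wr (𝟙 _) _ ≫ (asc W X _).hom ≫ wl W (𝟙 _) = 𝟙 _ ≫ (asc W X _).hom
    rw [wl_id, wr_id]; simp only [Category.id_comp]; exact Category.comp_id _
  cases X
  · change wr (𝟙 _) _ ≫ (asc W _ _).hom ≫ wl W (𝟙 _) = (asc W _ _).hom ≫ 𝟙 _
    rw [wl_id, wr_id]; simp only [Category.id_comp, Category.comp_id]
  cases W
  · change ar (dj (𝟙 _) (𝟙 _)) ≫ 𝟙 _ ≫ ar (oF _ _ _) = ar (oF _ _ _) ≫ 𝟙 _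
    rw [dj_id, ar_id]; simp only [Category.id_comp, Category.comp_id]
  · exact congrArg ar (oF_pent _ _ _ _).symm

end Ob

open CategoryTheory MonoidalCategory

namespace Ob

variable {P : Type}

theorem bra_inv (X Y : Ob P) : (bra X Y).inv = (bra Y X).hom := by
  rw [← cancel_epi (bra X Y).hom, bra_symm, Iso.hom_inv_id]

theorem wl_inv (X : Ob P) {Y Z : Ob P} (f : Y ⟶ Z) (g : Z ⟶ Y) (h : f ≫ g = 𝟙 _) :
    wl X f ≫ wl X g = 𝟙 _ := by rw [← wl_comp, h, wl_id]
theorem wr_inv {Y Z : Ob P} (f : Y ⟶ Z) (g : Z ⟶ Y) (X : Ob P) (h : f ≫ g = 𝟙 _) :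
    wr f X ≫ wr g X = 𝟙 _ := by rw [← wr_comp, h, wr_id]

theorem asc_eq (X Y Z : Ob P) : (asc Y Z X).hom = (bra (ten Y Z) X).hom ≫ (asc X Y Z).inv ≫
    wr (bra X Y).hom Z ≫ (asc Y X Z).hom ≫ wl Y (bra X Z).hom := by
  rw [← hexF X Y Z, Iso.inv_hom_id_assoc, ← Category.assoc, bra_symm, Category.id_comp]

theorem asc_eq' (X Y Z : Ob P) : (asc X Y Z).hom = wr (bra X Y).hom Z ≫ (asc Y X Z).hom ≫
    wl Y (bra X Z).hom ≫ (asc Y Z X).inv ≫ (bra (ten Y Z) X).hom := by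
  have h := congrArg (fun k => k ≫ (asc Y Z X).inv ≫ (bra (ten Y Z) X).hom) (hexF X Y Z)
  simp only [Category.assoc, Iso.hom_inv_id_assoc, bra_symm, Category.comp_id] at h
  exact h

theorem asc_nat3' (X Y : Ob P) {Z W : Ob P} (f : Z ⟶ W) :
    wl X (wl Y f) ≫ (asc X Y W).inv = (asc X Y Z).inv ≫ wl (ten X Y) f := by
  rw [Iso.comp_inv_eq, Category.assoc, asc_nat3, Iso.inv_hom_id_assoc]

/-- slot 2 from slot 3 -/
theorem asc_nat2 (Y : Ob P) {Z Z' : Ob P} (f : Z ⟶ Z') (X : Ob P) :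
    wr (wl Y f) X ≫ (asc Y Z' X).hom = (asc Y Z X).hom ≫ wl Y (wr f X) := by
  rw [asc_eq X Y Z', asc_eq X Y Z, ← Category.assoc, bra_wl, Category.assoc,
    ← Category.assoc (wl X _), asc_nat3']
  simp only [Category.assoc]
  rw [← Category.assoc (wl _ f), wexch, Category.assoc, ← Category.assoc (wl _ f), asc_nat3,
    Category.assoc, ← wl_comp, bra_wr, wl_comp]

theorem asc_nat2' (Y : Ob P) {Z Z' : Ob P} (f : Z ⟶ Z') (X : Ob P) :
    wl Y (wr f X) ≫ (asc Y Z' X).inv = (asc Y Z X).inv ≫ wr (wl Y f) X := by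
  rw [Iso.comp_inv_eq, Category.assoc, asc_nat2, Iso.inv_hom_id_assoc]

theorem asc_nat1 {X X' : Ob P} (f : X ⟶ X') (Y Z : Ob P) :
    wr (wr f Y) Z ≫ (asc X' Y Z).hom = (asc X Y Z).hom ≫ wr f (ten Y Z) := by
  rw [asc_eq' X' Y Z, asc_eq' X Y Z, ← Category.assoc, ← wr_comp, bra_wl, wr_comp]
  simp only [Category.assoc]
  rw [← Category.assoc (wr (wl Y f) Z), asc_nat2, Category.assoc, ← Category.assoc (wl Y (wr f Z)),
    ← wl_comp, bra_wl, wl_comp, Category.assoc, ← Category.assoc (wl Y (wl Z f)), asc_nat3',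
    Category.assoc, bra_wr]

instance : MonoidalCategory (Ob P) where
  tensorObj := ten
  whiskerLeft X _ _ f := wl X f
  whiskerRight f Z := wr f Z
  tensorUnit := un
  associator := asc
  leftUnitor := lun
  rightUnitor X := Iso.refl X
  tensorHom f g := wr f _ ≫ wl _ g
  tensorHom_def _ _ := rfl
  id_tensorHom_id X Y := by
    change wr (𝟙 X) Y ≫ wl X (𝟙 Y) = 𝟙 (ten X Y)
    rw [wr_id, wl_id]; exact Category.comp_id (obj := Ob P) _
  tensorHom_comp_tensorHom f1 f2 g1 g2 := by
    change (wr f1 _ ≫ wl _ f2) ≫ wr g1 _ ≫ wl _ g2 = wr (f1 ≫ g1) _ ≫ wl _ (f2 ≫ g2)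
    rw [wr_comp, wl_comp, Category.assoc, Category.assoc, ← Category.assoc (wl _ f2), wexch,
      Category.assoc]
  whiskerLeft_id := wl_id
  id_whiskerRight := wr_id
  associator_naturality f1 f2 f3 := by
    change (wr (wr f1 _ ≫ wl _ f2) _ ≫ wl _ f3) ≫ (asc _ _ _).hom =
      (asc _ _ _).hom ≫ wr f1 _ ≫ wl _ (wr f2 _ ≫ wl _ f3)
    rw [wr_comp, wl_comp, Category.assoc, asc_nat3, Category.assoc, ← Category.assoc (wr (wl _ f2) _),
      asc_nat2, Category.assoc, ← Category.assoc, asc_nat1, Category.assoc]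
  leftUnitor_naturality {X Y} f := by
    cases X <;> cases Y <;> first | exact (IsEmpty.false f).elim | skip
    · rfl
    all_goals exact (Category.comp_id (obj := Ob P) f).trans (Category.id_comp (obj := Ob P) f).symm
  rightUnitor_naturality f := (Category.comp_id f).trans (Category.id_comp f).symm
  pentagon := pentF
  triangle X Y := by
    change (asc X un Y).hom ≫ wl X (lun Y).hom = wr (𝟙 X) Y
    rw [wr_id]
    cases Y
    · change 𝟙 _ ≫ wl X (𝟙 _) = _
      rw [wl_id]; exact Category.comp_id (obj := Ob P) _
    · change 𝟙 _ ≫ wl X (𝟙 _) = _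
      rw [wl_id]; exact Category.comp_id (obj := Ob P) _

instance : BraidedCategory (Ob P) where
  braiding := bra
  braiding_naturality_right X _ _ f := bra_wr X f
  braiding_naturality_left f Z := bra_wl Z f
  hexagon_forward := hexF
  hexagon_reverse X Y Z := by
    have h := hexF Z X Y
    have h1 : (asc Z X Y).hom ≫ (bra Z (ten X Y)).hom ≫ (asc X Y Z).hom ≫
        wl X (bra Y Z).hom ≫ (asc X Z Y).inv ≫ wr (bra X Z).hom Y = 𝟙 _ := by
      have h2 := congrArg (fun k => k ≫ wl X (bra Y Z).hom ≫ (asc X Z Y).inv ≫ wr (bra X Z).hom Y) h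
      simp only [Category.assoc] at h2
      rw [h2, ← Category.assoc (wl X _) (wl X _), wl_inv _ _ _ (bra_symm _ _), Category.id_comp,
        Iso.hom_inv_id_assoc, wr_inv _ _ _ (bra_symm _ _)]
    change (asc X Y Z).inv ≫ (bra (ten X Y) Z).hom ≫ (asc Z X Y).inv =
      wl X (bra Y Z).hom ≫ (asc X Z Y).inv ≫ wr (bra X Z).hom Y
    rw [← Category.comp_id (asc Z X Y).inv, ← h1, Iso.inv_hom_id_assoc, ← Category.assoc (bra _ _).hom,
      bra_symm, Category.id_comp, Iso.inv_hom_id_assoc]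

instance : SymmetricCategory (Ob P) where
  symmetry := bra_symm

end Ob

open CategoryTheory MonoidalCategory

section Lk

variable {P : Type} {A C D E G : Form P}

theorem xx_oF' {Z : Form P} (v : Z ⟶ A ⋏ ((D ⋎ E) ⋎ C)) : (v ≫ xx A (D ⋎ E) C) ≫ oF D E (A ⋏ C) =
    ((v ≫ cj (𝟙 A) (oF D E C)) ≫ xx A D (E ⋎ C)) ≫ dj (𝟙 D) (xx A E C) := by
  simp only [Category.assoc, xx_oF]

theorem xx_mx {Z : Form P} (v : Z ⟶ A ⋏ (D ⋎ C)) : (v ≫ xx A D C) ≫ dj (𝟙 D) (mx A C) =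
    (v ≫ mx A (D ⋎ C)) ≫ oT _ _ _ ≫ dj (co A D) (𝟙 _) ≫ oF _ _ _ := by
  have h1 : xx A D C = ca _ _ ≫ dr D C A ≫ dj (𝟙 D) (ca C A) := by
    rw [dr_xx, Category.assoc, ca_ca_assoc, Category.assoc, dj_dj, ca_ca, Category.id_comp, dj_id,
      Category.comp_id]
  have h2 := o_hex1 A D C
  have h3 : dj (co A D) (𝟙 C) ≫ oF D A C = oF A D C ≫ co A (D ⋎ C) ≫ oF D C A ≫ dj (𝟙 D) (co C A) := by
    have := congrArg (fun k => k ≫ dj (𝟙 D) (co C A)) h2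
    simp only [Category.assoc, dj_dj, co_co, Category.id_comp, dj_id, Category.comp_id] at this
    exact this.symm
  rw [h3, oT_oF_assoc, h1]
  simp only [Category.assoc, dj_dj, mx_c, Category.id_comp]
  rw [dj_one_comp, ← Category.assoc (dr _ _ _), dr_mx, Category.assoc, ← Category.assoc (ca _ _), mx_c,
    Category.assoc]

theorem lk1 (t : Pt A) (u : Pt C) : t.map (u.app A ≫ 𝟙 _) =
    u.map (((t.app C ≫ 𝟙 _) ≫ ca C A) ≫ 𝟙 _) := by
  rw [← u.map_map _ (𝟙 _)]
  rw [Category.comp_id, Category.comp_id, Pt.map_id, ← Pt.map_map, u.comm]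

theorem lk2 (t : Pt A) (u : Pt (D ⋎ C)) : t.map (u.app A ≫ xx A D C) =
    u.map (dj (𝟙 _) ((t.app C ≫ 𝟙 _) ≫ ca C A) ≫ 𝟙 _) := by
  rw [← u.map_map _ (𝟙 _)]
  rw [Category.comp_id, Pt.map_id, dj_one_comp, ← t.dlaw', dr_xx, ← Pt.map_map, ← Pt.map_map,
    ← Pt.map_map, ← Pt.map_map, u.comm, ← Pt.map_map, Pt.map_map _ (dj _ _)]
  simp [dj_dj, dj_id, ca_ca, Pt.map_id]

theorem lk3 (t : Pt (G ⋎ A)) (u : Pt C) : t.map (dj (𝟙 _) (u.app A ≫ 𝟙 _)) =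
    u.map (((t.app C ≫ xx _ _ _) ≫ dj (𝟙 _) (ca C A)) ≫ 𝟙 _) := by
  rw [← u.map_map _ (𝟙 _)]
  rw [Category.comp_id, Pt.map_id, ← u.dlaw', dr_xx, ← Pt.map_map, ← Pt.map_map, t.comm, Pt.map_map,
    Category.assoc]

theorem lk4 (t : Pt (G ⋎ A)) (u : Pt (D ⋎ C)) : t.map (dj (𝟙 _) (u.app A ≫ xx _ _ _)) =
    u.map (dj (𝟙 _) ((t.app C ≫ xx _ _ _) ≫ dj (𝟙 _) (ca C A)) ≫
        oT _ _ _ ≫ dj (co _ _) (𝟙 _) ≫ oF _ _ _) := by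
  rw [dj_one_comp, ← u.dlaw', Category.assoc, link_swap]
  rw [← Pt.map_map, ← Pt.map_map, t.comm, Pt.map_map]
  congr 1
  simp only [dj_one_comp, Category.assoc, ← t.dlaw']

end Lk

namespace Ob

variable {P : Type}

/-- `ox : A ∧ (Δ ∨ C) → Δ ∨ (A ∧ C)`. -/
def ox : ∀ (A : Form P) (X : Ob P) (C : Form P), (A ⋏ orf X C) ⟶ orf X (A ⋏ C)
  | A, un, C => 𝟙 (A ⋏ C)
  | A, of D, C => xx A D C

/-- underlying arrow of a point -/
def unpt {B : Form P} (t : un ⟶ of B) : Pt B := t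

def ac (A : Form P) (X : Ob P) (C : Form P) : of (A ⋏ orf X C) ⟶ X ⊗ of (A ⋏ C) := ar (ox A X C)

def act0 {X : Ob P} {C : Form P} (u : un ⟶ X ⊗ of C) (A : Form P) : A ⟶ orf X (A ⋏ C) :=
  (unpt (B := orf X C) u).app A ≫ ox A X C

def act {X : Ob P} {C : Form P} (u : un ⟶ X ⊗ of C) (A : Form P) : of A ⟶ X ⊗ of (A ⋏ C) :=
  ar (act0 u A)

/-- exchange of the first two of three -/
def sw (X Y Z : Ob P) : X ⊗ (Y ⊗ Z) ⟶ Y ⊗ (X ⊗ Z) :=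
  (α_ X Y Z).inv ≫ (β_ X Y).hom ▷ Z ≫ (α_ Y X Z).hom

theorem sw_un1 (X : Ob P) (C : Form P) : sw un X (of C) = 𝟙 (X ⊗ of C) := by
  cases X
  · change 𝟙 _ ≫ wr (𝟙 un) (of C) ≫ 𝟙 _ = 𝟙 _
    rw [wr_id]; erw [Category.id_comp, Category.id_comp]
  · change 𝟙 _ ≫ wr (𝟙 (of _)) (of C) ≫ 𝟙 _ = 𝟙 _
    rw [wr_id]; erw [Category.id_comp, Category.id_comp]

theorem sw_un2 (X : Ob P) (C : Form P) : sw X un (of C) = 𝟙 (X ⊗ of C) := by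
  cases X
  · change 𝟙 _ ≫ wr (𝟙 un) (of C) ≫ 𝟙 _ = 𝟙 _
    rw [wr_id]; erw [Category.id_comp, Category.id_comp]
  · change 𝟙 _ ≫ wr (𝟙 (of _)) (of C) ≫ 𝟙 _ = 𝟙 _
    rw [wr_id]; erw [Category.id_comp, Category.id_comp]

theorem act_nat1 {X Y : Ob P} {C : Form P} (u : un ⟶ X ⊗ of C) (f : X ⟶ Y) (A : Form P) :
    act (u ≫ f ▷ of C) A = act u A ≫ f ▷ of (A ⋏ C) := by
  cases X <;> cases Y <;> first | exact (IsEmpty.false f).elim | skip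
  · have : f = 𝟙 _ := Subsingleton.elim _ _
    subst this
    rw [id_whiskerRight, id_whiskerRight, Category.comp_id, Category.comp_id]
  · obtain ⟨t, ef⟩ : ∃ t : Pt _, f = t := ⟨f, rfl⟩; rw [ef]; clear ef
    obtain ⟨v, ef⟩ : ∃ t : Pt C, u = t := ⟨u, rfl⟩; rw [ef]; clear ef
    change ar ((v.app A ≫ cj (𝟙 A) (t.app C ≫ mx C _ ≫ co C _)) ≫ xx A _ C) =
      ar ((v.app A ≫ 𝟙 _) ≫ t.app (A ⋏ C) ≫ mx _ _ ≫ co _ _)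
    have h : t.app (A ⋏ C) = cj (𝟙 A) (t.app C) ≫ aT _ _ _ := by
      rw [← t.bl, Category.assoc, aF_aT, Category.comp_id]
    rw [h, Category.comp_id]
    congr 1
    simp only [Category.assoc, xx, cj_one_comp]
    rw [← Category.assoc (aT _ _ _), aT_mx, cj_cj_assoc (𝟙 A) (𝟙 A) (co _ _), co_co, Category.id_comp, cj_id,
      Category.id_comp, Category.assoc]
  · obtain ⟨t, ef⟩ : ∃ t : (_ : Form P) ⟶ _, f = t := ⟨f, rfl⟩; rw [ef]; clear ef
    obtain ⟨v, ef⟩ : ∃ t : Pt (_ ⋎ C), u = t := ⟨u, rfl⟩; rw [ef]; clear ef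
    change ar ((v.app A ≫ cj (𝟙 A) (dj t (𝟙 C))) ≫ xx A _ C) =
      ar ((v.app A ≫ xx A _ C) ≫ dj t (𝟙 _))
    rw [Category.assoc, xx_nat, Category.assoc, cj_id]

theorem act_nat2 {X : Ob P} {C D : Form P} (u : un ⟶ X ⊗ of C) (f : C ⟶ D) (A : Form P) :
    act (u ≫ X ◁ ar f) A = act u A ≫ X ◁ ar (cj (𝟙 A) f) := by
  cases X
  · obtain ⟨v, ef⟩ : ∃ t : Pt C, u = t := ⟨u, rfl⟩; rw [ef]; clear ef
    change ar ((v.app A ≫ cj (𝟙 A) f) ≫ 𝟙 _) = ar ((v.app A ≫ 𝟙 _) ≫ cj (𝟙 A) f)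
    simp
  · obtain ⟨v, ef⟩ : ∃ t : Pt (_ ⋎ C), u = t := ⟨u, rfl⟩; rw [ef]; clear ef
    change ar ((v.app A ≫ cj (𝟙 A) (dj (𝟙 _) f)) ≫ xx A _ D) =
      ar ((v.app A ≫ xx A _ C) ≫ dj (𝟙 _) (cj (𝟙 A) f))
    rw [Category.assoc, xx_nat, Category.assoc]

theorem act_nat3 {X : Ob P} {C A B : Form P} (u : un ⟶ X ⊗ of C) (f : A ⟶ B) :
    ar f ≫ act u B = act u A ≫ X ◁ ar (cj f (𝟙 C)) := by
  cases X
  · obtain ⟨v, ef⟩ : ∃ t : Pt C, u = t := ⟨u, rfl⟩; rw [ef]; clear ef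
    change ar (f ≫ (v.app B) ≫ 𝟙 _) = ar ((v.app A ≫ 𝟙 _) ≫ cj f (𝟙 _))
    simp [v.nat]
  · obtain ⟨v, ef⟩ : ∃ t : Pt (_ ⋎ C), u = t := ⟨u, rfl⟩; rw [ef]; clear ef
    change ar (f ≫ v.app B ≫ xx B _ C) =
      ar ((v.app A ≫ xx A _ C) ≫ dj (𝟙 _) (cj f (𝟙 _)))
    rw [Category.assoc, ← xx_nat, dj_id, ← Category.assoc, v.nat, Category.assoc]

theorem ac_nat (A B : Form P) (X : Ob P) {C D : Form P} (f : A ⟶ B) (g : C ⟶ D) :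
    ar (cj f (X ◁ ar g)) ≫ ac B X D = ac A X C ≫ X ◁ ar (cj f g) := by
  cases X
  · change ar (cj f g ≫ 𝟙 _) = ar (𝟙 _ ≫ cj f g)
    simp
  · change ar (cj f (dj (𝟙 _) g) ≫ xx _ _ _) = ar (xx _ _ _ ≫ dj (𝟙 _) (cj f g))
    rw [xx_nat]

theorem act_asc {X Y : Ob P} {C : Form P} (u : un ⟶ (X ⊗ Y) ⊗ of C) (A : Form P) :
    act u A ≫ (α_ X Y (of (A ⋏ C))).hom =
      act (X := X) (C := orf Y C) (u ≫ (α_ X Y (of C)).hom) A ≫ X ◁ ac A Y C := by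
  cases Y
  · change act u A ≫ 𝟙 _ = act (u ≫ 𝟙 _) A ≫ X ◁ 𝟙 _
    rw [whiskerLeft_id]
    exact congrArg (fun k => act k A ≫ 𝟙 (X ⊗ of (A ⋏ C))) (Category.comp_id u).symm
  cases X
  · obtain ⟨v, ef⟩ : ∃ t : Pt _, u = t := ⟨u, rfl⟩; rw [ef]; clear ef
    change ar ((v.app A ≫ xx _ _ _) ≫ 𝟙 _) = ar (((v.app A ≫ cj (𝟙 A) (𝟙 _)) ≫ 𝟙 _) ≫ xx _ _ _)
    rw [cj_id, Category.comp_id, Category.comp_id, Category.comp_id]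
  · obtain ⟨v, ef⟩ : ∃ t : Pt _, u = t := ⟨u, rfl⟩; rw [ef]; clear ef
    change ar ((v.app A ≫ xx _ (_ ⋎ _) _) ≫ oF _ _ _) =
      ar (((v.app A ≫ cj (𝟙 A) (oF _ _ _)) ≫ xx _ _ _) ≫ dj (𝟙 _) (xx _ _ _))
    exact congrArg ar (xx_oF' (v.app A))

theorem act_aF {X : Ob P} {C : Form P} (u : un ⟶ X ⊗ of C) (A B : Form P) :
    act u (A ⋏ B) ≫ X ◁ ar (aF A B C) = ar (cj (𝟙 A) (act0 u B)) ≫ ac A X (B ⋏ C) := by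
  cases X
  · obtain ⟨v, ef⟩ : ∃ t : Pt C, u = t := ⟨u, rfl⟩; rw [ef]; clear ef
    change ar ((v.app _ ≫ 𝟙 _) ≫ aF A B C) = ar (cj (𝟙 A) (v.app B ≫ 𝟙 _) ≫ 𝟙 _)
    simp [v.bl]
  · obtain ⟨v, ef⟩ : ∃ t : Pt (_ ⋎ C), u = t := ⟨u, rfl⟩; rw [ef]; clear ef
    change ar ((v.app _ ≫ xx _ _ _) ≫ dj (𝟙 _) (aF A B C)) =
      ar (cj (𝟙 A) (v.app B ≫ xx _ _ _) ≫ xx _ _ _)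
    rw [cj_one_comp, ← v.bl]
    simp only [Category.assoc, xx_aF]

theorem act_mx {X : Ob P} {C : Form P} (u : un ⟶ X ⊗ of C) (A : Form P) :
    act u A ≫ X ◁ ar (mx A C) = of A ◁ u ≫ sw (of A) X (of C) := by
  cases X
  · obtain ⟨v, ef⟩ : ∃ t : Pt C, u = t := ⟨u, rfl⟩; rw [ef]; clear ef
    rw [sw_un2]
    change ar ((v.app _ ≫ 𝟙 _) ≫ mx A C) = ar ((v.app _ ≫ mx A C) ≫ 𝟙 _)
    rw [Category.comp_id, Category.comp_id]
  · obtain ⟨v, ef⟩ : ∃ t : Pt (_ ⋎ C), u = t := ⟨u, rfl⟩; rw [ef]; clear ef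
    change ar ((v.app _ ≫ xx _ _ _) ≫ dj (𝟙 _) (mx A C)) =
      ar ((v.app _ ≫ mx _ _) ≫ oT _ _ _ ≫ dj (co _ _) (𝟙 _) ≫ oF _ _ _)
    exact congrArg ar (xx_mx (v.app A))

theorem link_comm {X Y : Ob P} {A C : Form P} (t : un ⟶ X ⊗ of A) (u : un ⟶ Y ⊗ of C) :
    t ≫ X ◁ act u A = u ≫ Y ◁ (act t C ≫ X ◁ ar (ca C A)) ≫ sw Y X (of (A ⋏ C)) := by
  cases X <;> cases Y
  · rw [sw_un1]
    exact congrArg pt (lk1 (unpt t) (unpt u))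
  · rw [sw_un2]
    exact congrArg pt (lk2 (unpt t) (unpt u))
  · rw [sw_un1]
    exact congrArg pt (lk3 (unpt t) (unpt u))
  · exact congrArg pt (lk4 (unpt t) (unpt u))

end Ob

open CategoryTheory MonoidalCategory

section Coh

universe v u
variable {C : Type u} [Category.{v} C] [MonoidalCategory C] [SymmetricCategory C]

/-- right commutation -/
def rc (X Y Z : C) : (X ⊗ Y) ⊗ Z ⟶ (X ⊗ Z) ⊗ Y :=
  (α_ X Y Z).hom ≫ X ◁ (β_ Y Z).hom ≫ (α_ X Z Y).inv

theorem rc_nat1 {X X' : C} (f : X ⟶ X') (Y Z : C) :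
    (f ▷ Y) ▷ Z ≫ rc X' Y Z = rc X Y Z ≫ (f ▷ Z) ▷ Y := by
  simp only [rc, Category.assoc]
  rw [associator_naturality_left_assoc, ← associator_inv_naturality_left, whisker_exchange_assoc]

theorem rc_nat3 (X Y : C) {Z Z' : C} (f : Z ⟶ Z') :
    (X ⊗ Y) ◁ f ≫ rc X Y Z' = rc X Y Z ≫ (X ◁ f) ▷ Y := by
  simp only [rc, Category.assoc]
  rw [associator_naturality_right_assoc, ← associator_inv_naturality_middle, ← whiskerLeft_comp_assoc,
    BraidedCategory.braiding_naturality_right, whiskerLeft_comp_assoc]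

theorem rc_rc (X Y Z : C) : rc X Y Z ≫ rc X Z Y = 𝟙 _ := by
  simp only [rc, Category.assoc, Iso.inv_hom_id_assoc]
  rw [← whiskerLeft_comp_assoc, SymmetricCategory.symmetry]
  simp

theorem coh5 (V K Y Z : C) : rc V K Y ▷ Z ≫ rc (V ⊗ Y) K Z ≫ (α_ V Y Z).hom ▷ K =
    (α_ (V ⊗ K) Y Z).hom ≫ rc V K (Y ⊗ Z) := by
  simp only [rc, BraidedCategory.braiding_tensor_right_hom]
  monoidal

theorem coh6 (X V K Z : C) : (α_ X V K).inv ▷ Z ≫ rc (X ⊗ V) K Z ≫ (α_ X V Z).hom ▷ K =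
    (α_ X (V ⊗ K) Z).hom ≫ X ◁ rc V K Z ≫ (α_ X (V ⊗ Z) K).inv := by
  simp only [rc]
  monoidal

theorem coh7 (X Y V K : C) : (α_ (X ⊗ Y) V K).inv ≫ (α_ X Y V).hom ▷ K =
    (α_ X Y (V ⊗ K)).hom ≫ X ◁ (α_ Y V K).inv ≫ (α_ X (Y ⊗ V) K).inv := by
  monoidal

theorem coh11 (X V K : C) : (α_ X V K).inv ≫ (β_ X V).hom ▷ K = (β_ X (V ⊗ K)).hom ≫ rc V K X := by
  simp only [rc, BraidedCategory.braiding_tensor_right_hom, Category.assoc, Iso.inv_hom_id_assoc]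
  rw [← whiskerLeft_comp_assoc, SymmetricCategory.symmetry]
  simp

theorem coh12 (V K Y : C) : rc V K Y ≫ (β_ V Y).hom ▷ K = (β_ (V ⊗ K) Y).hom ≫ (α_ Y V K).inv := by
  have h := coh11 Y V K
  rw [← cancel_epi (β_ Y (V ⊗ K)).hom, SymmetricCategory.symmetry_assoc, ← Category.assoc, ← h, Category.assoc,
    ← comp_whiskerRight, SymmetricCategory.symmetry, id_whiskerRight, Category.comp_id]

end Coh

open CategoryTheory MonoidalCategory

namespace Ob

variable {P : Type}

/-- Structural arrows. -/
inductive Str : ∀ {X Y : Ob P}, (X ⟶ Y) → Prop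
  | id (X : Ob P) : Str (𝟙 X)
  | comp {X Y Z : Ob P} {f : X ⟶ Y} {g : Y ⟶ Z} : Str f → Str g → Str (f ≫ g)
  | wl (X : Ob P) {Y Z : Ob P} {f : Y ⟶ Z} : Str f → Str (X ◁ f)
  | wr {Y Z : Ob P} {f : Y ⟶ Z} (X : Ob P) : Str f → Str (f ▷ X)
  | asc (X Y Z : Ob P) : Str (α_ X Y Z).hom
  | ascI (X Y Z : Ob P) : Str (α_ X Y Z).inv
  | bra (X Y : Ob P) : Str (β_ X Y).hom

theorem Str.inv {X Y : Ob P} {f : X ⟶ Y} (h : Str f) :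
    ∃ g : Y ⟶ X, Str g ∧ f ≫ g = 𝟙 _ ∧ g ≫ f = 𝟙 _ := by
  induction h with
  | id X => exact ⟨𝟙 _, .id _, by simp, by simp⟩
  | comp _ _ ih1 ih2 =>
    obtain ⟨g1, h1, a1, b1⟩ := ih1
    obtain ⟨g2, h2, a2, b2⟩ := ih2
    refine ⟨g2 ≫ g1, h2.comp h1, ?_, ?_⟩
    · rw [Category.assoc, ← Category.assoc _ g2, a2, Category.id_comp, a1]
    · rw [Category.assoc, ← Category.assoc g1, b1, Category.id_comp, b2]
  | wl X _ ih =>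
    obtain ⟨g1, h1, a1, b1⟩ := ih
    exact ⟨X ◁ g1, h1.wl X, by rw [← whiskerLeft_comp, a1, whiskerLeft_id],
      by rw [← whiskerLeft_comp, b1, whiskerLeft_id]⟩
  | wr X _ ih =>
    obtain ⟨g1, h1, a1, b1⟩ := ih
    exact ⟨g1 ▷ X, h1.wr X, by rw [← comp_whiskerRight, a1, id_whiskerRight],
      by rw [← comp_whiskerRight, b1, id_whiskerRight]⟩
  | asc X Y Z => exact ⟨_, .ascI X Y Z, by simp, by simp⟩
  | ascI X Y Z => exact ⟨_, .asc X Y Z, by simp, by simp⟩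
  | bra X Y => exact ⟨_, .bra Y X, by simp, by simp⟩

theorem Str.rc (X Y Z : Ob P) : Str (rc X Y Z) :=
  (Str.asc _ _ _).comp ((Str.wl _ (.bra _ _)).comp (.ascI _ _ _))

theorem Str.sw (X Y Z : Ob P) : Str (sw X Y Z) :=
  (Str.ascI _ _ _).comp ((Str.wr _ (.bra _ _)).comp (.asc _ _ _))

/-- Formulae that are not disjunctions. -/
def Irr : Form P → Prop
  | .disj _ _ => False
  | _ => True

/-- Disjuncts of a formula. -/
def fc : Form P → Multiset (Form P)
  | .disj A B => fc A + fc B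
  | A => {A}

def comps : Ob P → Multiset (Form P)
  | un => 0
  | of A => fc A

theorem comps_ten (X Y : Ob P) : comps (X ⊗ Y) = comps X + comps Y := by
  cases Y
  · exact (add_zero _).symm
  · cases X
    · exact (zero_add _).symm
    · rfl

theorem fc_irr {K : Form P} (h : Irr K) : fc K = {K} := by
  cases K <;> first | rfl | exact h.elim

theorem Str.comps_eq {X Y : Ob P} {f : X ⟶ Y} (h : Str f) : comps X = comps Y := by
  induction h with
  | id => rfl
  | comp _ _ a b => exact a.trans b
  | wl _ _ a => rw [comps_ten, comps_ten, a]
  | wr _ _ a => rw [comps_ten, comps_ten, a]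
  | asc => simp only [comps_ten, add_assoc]
  | ascI => simp only [comps_ten, add_assoc]
  | bra => simp only [comps_ten, add_comm]

/-- Occurrences of an irreducible formula. -/
inductive Occ (K : Form P) : ∀ (X Y : Ob P), (X ⟶ Y ⊗ of K) → Prop
  | here : Irr K → Occ K (of K) un (𝟙 (of K))
  | left {A B : Form P} {Y : Ob P} {e : of A ⟶ Y ⊗ of K} : Occ K (of A) Y e →
      Occ K (of (A ⋎ B)) (Y ⊗ of B) ((e ▷ of B ≫ rc Y (of K) (of B) :))
  | right {A B : Form P} {Y : Ob P} {e : of B ⟶ Y ⊗ of K} : Occ K (of B) Y e →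
      Occ K (of (A ⋎ B)) (of A ⊗ Y) ((of A ◁ e ≫ (α_ _ _ _).inv :))

variable {K : Form P}

theorem rc_un (Y : Ob P) (K : Form P) : rc Y (of K) un = 𝟙 (Y ⊗ of K) := by
  change 𝟙 _ ≫ Y ◁ (𝟙 _) ≫ 𝟙 _ = 𝟙 _
  rw [whiskerLeft_id]; erw [Category.id_comp, Category.id_comp]

theorem Occ.tl {X Y : Ob P} {e : X ⟶ Y ⊗ of K} (h : Occ K X Y e) (Z : Ob P) :
    Occ K (X ⊗ Z) (Y ⊗ Z) (e ▷ Z ≫ rc Y (of K) Z) := by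
  cases Z
  · rw [rc_un]
    have : e ▷ un ≫ 𝟙 (Y ⊗ of K) = e := Category.comp_id e
    exact (congrArg (Occ K _ _) this).mpr h
  · cases X
    · cases h
    · exact h.left

theorem Occ.tr {Z Y : Ob P} {e : Z ⟶ Y ⊗ of K} (h : Occ K Z Y e) (X : Ob P) :
    Occ K (X ⊗ Z) (X ⊗ Y) (X ◁ e ≫ (α_ _ _ _).inv) := by
  cases Z
  · cases h
  cases X
  · cases Y
    · have : un ◁ e ≫ (α_ un un (of K)).inv = e := Category.comp_id e
      exact (congrArg (Occ K _ _) this).mpr h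
    · have : un ◁ e ≫ (α_ un (of _) (of K)).inv = e := Category.comp_id e
      exact (congrArg (Occ K _ _) this).mpr h
  · exact h.right

theorem Occ.elim {X Z W : Ob P} {e : X ⊗ Z ⟶ W ⊗ of K} (h : Occ K (X ⊗ Z) W e)
    (C : ∀ W : Ob P, (X ⊗ Z ⟶ W ⊗ of K) → Prop)
    (hl : ∀ Y e, Occ K X Y e → C (Y ⊗ Z) (e ▷ Z ≫ rc Y (of K) Z))
    (hr : ∀ Y e, Occ K Z Y e → C (X ⊗ Y) (X ◁ e ≫ (α_ _ _ _).inv)) : C W e := by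
  cases Z
  · have := hl W e h
    rw [rc_un] at this
    have h2 : e ▷ un ≫ 𝟙 (W ⊗ of K) = e := Category.comp_id e
    exact h2 ▸ this
  · rename_i B
    cases X
    · have := hr W e h
      cases W
      · have h2 : un ◁ e ≫ (α_ un un (of K)).inv = e := Category.comp_id e
        exact h2 ▸ this
      · have h2 : un ◁ e ≫ (α_ un (of _) (of K)).inv = e := Category.comp_id e
        exact h2 ▸ this
    · rename_i A
      change Occ K (of (A ⋎ B)) W e at h
      cases h with
      | here h => exact h.elim
      | left h => exact hl _ _ h
      | right h => exact hr _ _ h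

theorem Occ.str {X Y : Ob P} {e : X ⟶ Y ⊗ of K} (h : Occ K X Y e) : Str e := by
  induction h with
  | here => exact .id _
  | left _ ih => exact (ih.wr _).comp (.rc _ _ _)
  | right _ ih => exact (ih.wl _).comp (.ascI _ _ _)

theorem Occ.irr {X Y : Ob P} {e : X ⟶ Y ⊗ of K} (h : Occ K X Y e) : Irr K := by
  induction h with
  | here h => exact h
  | left _ ih => exact ih
  | right _ ih => exact ih

theorem Occ.comps {X Y : Ob P} {e : X ⟶ Y ⊗ of K} (h : Occ K X Y e) : comps X = comps Y + {K} := by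
  rw [h.str.comps_eq, comps_ten]; congr 1; exact fc_irr h.irr

theorem Occ.ex_aux (A : Form P) (hK : K ∈ fc A) : ∃ Y e, Occ K (of A) Y e := by
  induction A with
  | pos p => obtain rfl := Multiset.mem_singleton.1 (show K ∈ ({_} : Multiset (Form P)) from hK); exact ⟨_, _, .here trivial⟩
  | natom p => obtain rfl := Multiset.mem_singleton.1 (show K ∈ ({_} : Multiset (Form P)) from hK); exact ⟨_, _, .here trivial⟩
  | conj A B => obtain rfl := Multiset.mem_singleton.1 (show K ∈ ({_} : Multiset (Form P)) from hK); exact ⟨_, _, .here trivial⟩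
  | disj A B ihA ihB =>
    rw [fc, Multiset.mem_add] at hK
    rcases hK with hK | hK
    · obtain ⟨_, _, h⟩ := ihA hK; exact ⟨_, _, h.left⟩
    · obtain ⟨_, _, h⟩ := ihB hK; exact ⟨_, _, h.right⟩

theorem Occ.ex {X : Ob P} (hK : K ∈ Ob.comps X) : ∃ Y e, Occ K X Y e := by
  cases X
  · exact (Multiset.notMem_zero _ hK).elim
  · exact Occ.ex_aux _ hK

theorem Str.extract {X Y : Ob P} {f : X ⟶ Y} (h : Str f) : ∀ {W : Ob P} {o : Y ⟶ W ⊗ of K},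
    Occ K Y W o → ∃ (V : Ob P) (o' : X ⟶ V ⊗ of K) (f' : V ⟶ W), Occ K X V o' ∧ Str f' ∧
      o' ≫ f' ▷ of K = f ≫ o := by
  induction h with
  | id X => intro W o h; exact ⟨_, _, 𝟙 _, h, .id _, by simp⟩
  | comp _ _ ih1 ih2 =>
    intro W o h
    obtain ⟨V, o1, f1, a1, b1, c1⟩ := ih2 h
    obtain ⟨V2, o2, f2, a2, b2, c2⟩ := ih1 a1
    refine ⟨V2, o2, f2 ≫ f1, a2, b2.comp b1, ?_⟩
    rw [comp_whiskerRight, ← Category.assoc, c2, Category.assoc, c1, Category.assoc]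
  | @wl X Y Z f hf ih =>
    intro W o h
    refine h.elim (fun W o => ∃ (V : Ob P) (o' : _ ⟶ V ⊗ of K) (f' : V ⟶ W), Occ K _ V o' ∧ Str f' ∧
      o' ≫ f' ▷ of K = _ ≫ o) ?_ ?_
    · intro V o1 h1
      refine ⟨_, _, V ◁ f, h1.tl _, hf.wl _, ?_⟩
      rw [Category.assoc, ← rc_nat3, whisker_exchange_assoc]
    · intro V o1 h1
      obtain ⟨U, o2, f2, a, b, c⟩ := ih h1
      refine ⟨_, _, X ◁ f2, a.tr _, b.wl _, ?_⟩
      rw [Category.assoc, ← associator_inv_naturality_middle, ← whiskerLeft_comp_assoc, c,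
        whiskerLeft_comp_assoc]
  | @wr Y Z f X hf ih =>
    intro W o h
    refine h.elim (fun W o => ∃ (V : Ob P) (o' : _ ⟶ V ⊗ of K) (f' : V ⟶ W), Occ K _ V o' ∧ Str f' ∧
      o' ≫ f' ▷ of K = _ ≫ o) ?_ ?_
    · intro V o1 h1
      obtain ⟨U, o2, f2, a, b, c⟩ := ih h1
      refine ⟨_, _, f2 ▷ X, a.tl _, b.wr _, ?_⟩
      rw [Category.assoc, ← rc_nat1, ← comp_whiskerRight_assoc, c, comp_whiskerRight_assoc]
    · intro V o1 h1
      refine ⟨_, _, f ▷ V, h1.tr _, hf.wr _, ?_⟩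
      rw [Category.assoc, ← associator_inv_naturality_left, whisker_exchange_assoc]
  | asc X Y Z =>
    intro W o h
    refine h.elim (fun W o => ∃ (V : Ob P) (o' : _ ⟶ V ⊗ of K) (f' : V ⟶ W), Occ K _ V o' ∧ Str f' ∧
      o' ≫ f' ▷ of K = _ ≫ o) ?_ ?_
    · intro V o1 h1
      refine ⟨_, _, _, (h1.tl Y).tl Z, .asc _ _ _, ?_⟩
      rw [Category.assoc, comp_whiskerRight_assoc, coh5, associator_naturality_left_assoc]
    · intro V o1 h1
      refine h1.elim (fun W o => ∃ (V : Ob P) (o' : _ ⟶ V ⊗ of K) (f' : V ⟶ _ ⊗ W), Occ K _ V o' ∧ Str f' ∧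
        o' ≫ f' ▷ of K = _ ≫ X ◁ o ≫ (α_ X W (of K)).inv) ?_ ?_
      · intro V o1 h1
        refine ⟨_, _, _, (h1.tr X).tl Z, .asc _ _ _, ?_⟩
        rw [Category.assoc, comp_whiskerRight_assoc, coh6, associator_naturality_middle_assoc,
          whiskerLeft_comp_assoc]
      · intro V o1 h1
        refine ⟨_, _, _, h1.tr (X ⊗ Y), .asc _ _ _, ?_⟩
        rw [Category.assoc, coh7, associator_naturality_right_assoc, whiskerLeft_comp_assoc]
  | ascI X Y Z =>
    intro W o h
    refine h.elim (fun W o => ∃ (V : Ob P) (o' : _ ⟶ V ⊗ of K) (f' : V ⟶ W), Occ K _ V o' ∧ Str f' ∧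
      o' ≫ f' ▷ of K = _ ≫ o) ?_ ?_
    · intro V o1 h1
      refine h1.elim (fun W o => ∃ (V : Ob P) (o' : _ ⟶ V ⊗ of K) (f' : V ⟶ W ⊗ _), Occ K _ V o' ∧ Str f' ∧
        o' ≫ f' ▷ of K = _ ≫ o ▷ Z ≫ _root_.rc W (of K) Z) ?_ ?_
      · intro V o1 h1
        refine ⟨_, _, _, h1.tl (Y ⊗ Z), .ascI _ _ _, ?_⟩
        rw [Iso.eq_inv_comp, ← cancel_mono ((α_ V Y Z).hom ▷ of K)]
        simp only [Category.assoc, inv_hom_whiskerRight, Category.comp_id]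
        rw [comp_whiskerRight_assoc, coh5, associator_naturality_left_assoc]
      · intro V o1 h1
        refine ⟨_, _, _, (h1.tl Z).tr X, .ascI _ _ _, ?_⟩
        rw [Iso.eq_inv_comp, ← cancel_mono ((α_ X V Z).hom ▷ of K)]
        simp only [Category.assoc, inv_hom_whiskerRight, Category.comp_id]
        rw [comp_whiskerRight_assoc, coh6, associator_naturality_middle_assoc,
          whiskerLeft_comp_assoc]
    · intro V o1 h1
      refine ⟨_, _, _, (h1.tr Y).tr X, .ascI _ _ _, ?_⟩
      rw [Iso.eq_inv_comp, ← cancel_mono ((α_ X Y V).hom ▷ of K)]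
      simp only [Category.assoc, inv_hom_whiskerRight, Category.comp_id]
      rw [coh7, associator_naturality_right_assoc, whiskerLeft_comp_assoc]
  | bra X Y =>
    intro W o h
    refine h.elim (fun W o => ∃ (V : Ob P) (o' : _ ⟶ V ⊗ of K) (f' : V ⟶ W), Occ K _ V o' ∧ Str f' ∧
      o' ≫ f' ▷ of K = _ ≫ o) ?_ ?_
    · intro V o1 h1
      refine ⟨_, _, _, h1.tr X, .bra _ _, ?_⟩
      rw [Category.assoc, coh11, BraidedCategory.braiding_naturality_right_assoc]
    · intro V o1 h1
      refine ⟨_, _, _, h1.tl Y, .bra _ _, ?_⟩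
      rw [Category.assoc, coh12, BraidedCategory.braiding_naturality_left_assoc]

theorem comps_nil {X : Ob P} (h : comps X = 0) : X = un := by
  cases X with
  | un => rfl
  | of A =>
    exfalso
    have : ∀ A : Form P, fc A ≠ 0 := by
      intro A
      induction A with
      | disj A B ihA _ => intro h; rw [fc] at h; exact ihA (add_eq_zero.1 h).1
      | _ => exact Multiset.singleton_ne_zero _
    exact this A h

theorem Str.exists {X Y : Ob P} (h : comps X = comps Y) : ∃ f : X ⟶ Y, Str f := by
  generalize hn : Multiset.card (comps X) = n
  induction n generalizing X Y with
  | zero =>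
    have h1 : comps X = 0 := Multiset.card_eq_zero.1 hn
    have h2 : comps Y = 0 := h ▸ h1
    obtain rfl := comps_nil h1
    obtain rfl := comps_nil h2
    exact ⟨_, .id _⟩
  | succ n ih =>
    obtain ⟨K, hK⟩ := Multiset.exists_mem_of_ne_zero (s := comps X)
      (by intro h; rw [h] at hn; simp at hn)
    obtain ⟨V, o, ho⟩ := Occ.ex hK
    obtain ⟨W, o', ho'⟩ := Occ.ex (h ▸ hK)
    have h1 : comps V = comps W := by
      have a := ho.comps; have b := ho'.comps
      rw [a, b] at h; exact add_right_cancel h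
    have h2 : Multiset.card (comps V) = n := by
      have a := ho.comps
      rw [a, Multiset.card_add, Multiset.card_singleton] at hn; omega
    obtain ⟨f, hf⟩ := ih h1 h2
    obtain ⟨g, hg, -⟩ := ho'.str.inv
    exact ⟨o ≫ f ▷ of K ≫ g, ho.str.comp ((hf.wr _).comp hg)⟩

theorem Occ.mem {X Y : Ob P} {e : X ⟶ Y ⊗ of K} (h : Occ K X Y e) : K ∈ Ob.comps X := by
  rw [h.comps]; simp

theorem Occ.uniq {X Y : Ob P} {e : X ⟶ Y ⊗ of K} (h : Occ K X Y e) (hn : (Ob.comps X).Nodup) :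
    ∀ {Y' : Ob P} {e' : X ⟶ Y' ⊗ of K}, Occ K X Y' e' →
    (⟨Y, e⟩ : Σ Y : Ob P, X ⟶ Y ⊗ of K) = ⟨Y', e'⟩ := by
  induction h with
  | here h =>
    intro Y' e' h'
    cases h' with
    | here => rfl
    | left => exact h.elim
    | right => exact h.elim
  | @left A B Y e h ih =>
    have hn' : (fc A + fc B).Nodup := hn
    rw [Multiset.nodup_add] at hn'
    intro Y' e' h'
    cases h' with
    | here h => exact h.elim
    | left h2 => cases ih hn'.1 h2; rfl
    | right h2 => exact (Multiset.disjoint_left.1 hn'.2.2 h.mem h2.mem).elim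
  | @right A B Y e h ih =>
    have hn' : (fc A + fc B).Nodup := hn
    rw [Multiset.nodup_add] at hn'
    intro Y' e' h'
    cases h' with
    | here h => exact h.elim
    | right h2 => cases ih hn'.2.1 h2; rfl
    | left h2 => exact (Multiset.disjoint_left.1 hn'.2.2 h2.mem h.mem).elim

theorem Str.uniq {X Y : Ob P} {f g : X ⟶ Y} (hf : Str f) (hg : Str g) (hn : (comps Y).Nodup) :
    f = g := by
  generalize hc : Multiset.card (comps Y) = n
  induction n generalizing X Y with
  | zero =>
    have h1 : comps Y = 0 := Multiset.card_eq_zero.1 hc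
    have h2 : X = un := comps_nil (hf.comps_eq.trans h1)
    have h3 := comps_nil h1
    subst h2; subst h3
    exact Subsingleton.elim _ _
  | succ n ih =>
    obtain ⟨K, hK⟩ := Multiset.exists_mem_of_ne_zero (s := comps Y)
      (by intro h; rw [h] at hc; simp at hc)
    obtain ⟨V, o, ho⟩ := Occ.ex hK
    obtain ⟨V1, o1, f1, a1, b1, c1⟩ := hf.extract ho
    obtain ⟨V2, o2, g1, a2, b2, c2⟩ := hg.extract ho
    cases a1.uniq (hf.comps_eq ▸ hn) a2
    have a := ho.comps
    rw [a, Multiset.nodup_add] at hn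
    rw [a, Multiset.card_add, Multiset.card_singleton] at hc
    have := ih b1 b2 hn.1 (by omega)
    subst this
    obtain ⟨k, -, hk, -⟩ := ho.str.inv
    have h5 := congrArg (· ≫ k) (c1.symm.trans c2)
    simpa only [Category.assoc, hk, Category.comp_id] using h5

end Ob

open CategoryTheory MonoidalCategory

section Coh2
universe v u
variable {C : Type u} [Category.{v} C] [MonoidalCategory C] [SymmetricCategory C]

theorem rc_unit {X V K : C} (o : X ⟶ V ⊗ K) :
    (ρ_ X).inv ≫ o ▷ 𝟙_ C ≫ rc V K (𝟙_ C) = o ≫ (ρ_ V).inv ▷ K := by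
  rw [← rightUnitor_inv_naturality_assoc]
  congr 1
  simp [rc, braiding_tensorUnit_right]

theorem mix_comm0 {X Y : C} (t : 𝟙_ C ⟶ X) (u : 𝟙_ C ⟶ Y) :
    t ≫ (ρ_ X).inv ≫ X ◁ u = u ≫ (λ_ Y).inv ≫ t ▷ Y := by
  rw [leftUnitor_inv_naturality_assoc, whisker_exchange, rightUnitor_inv_naturality_assoc,
          unitors_inv_equal]

theorem mix_r {Y V K : C} (o : Y ⟶ V ⊗ K) : (λ_ Y).inv ≫ 𝟙_ C ◁ o ≫ (α_ (𝟙_ C) V K).inv =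
    o ≫ (λ_ V).inv ▷ K := by
  rw [← leftUnitor_inv_naturality_assoc]; simp

theorem coh13 (V K X Z : C) : ((α_ (V ⊗ K) X Z).inv ≫ (β_ (V ⊗ K) X).hom ▷ Z ≫ (α_ X (V ⊗ K) Z).hom) ≫
    X ◁ rc V K Z ≫ (α_ X (V ⊗ Z) K).inv =
    rc V K (X ⊗ Z) ≫ ((α_ V X Z).inv ≫ (β_ V X).hom ▷ Z ≫ (α_ X V Z).hom) ▷ K := by
  simp only [rc, BraidedCategory.braiding_tensor_left_hom, BraidedCategory.braiding_tensor_right_hom]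
  trans 𝟙 _ ⊗≫ V ◁ (β_ K X).hom ▷ Z ⊗≫ ((β_ V X).hom ▷ (K ⊗ Z) ≫ (X ⊗ V) ◁ (β_ K Z).hom) ⊗≫ 𝟙 _
  · monoidal
  · rw [← whisker_exchange]; monoidal
end Coh2

namespace Ob

variable {P : Type}

theorem sw_nat_assoc {X X' : Ob P} (f : X ⟶ X') (Y Z : Ob P) {W : Ob P} (h : _ ⟶ W) :
    f ▷ (Y ⊗ Z) ≫ sw X' Y Z ≫ h = sw X Y Z ≫ Y ◁ (f ▷ Z) ≫ h := by
  simp only [sw, Category.assoc]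
  rw [associator_inv_naturality_left_assoc, ← comp_whiskerRight_assoc,
    BraidedCategory.braiding_naturality_left, comp_whiskerRight_assoc, associator_naturality_middle_assoc]

theorem Str.rho (X : Ob P) : Str (ρ_ X).hom := Str.id X
theorem Str.rhoI (X : Ob P) : Str (ρ_ X).inv := Str.id X
theorem Str.lam (X : Ob P) : Str (λ_ X).hom := by cases X <;> exact Str.id _
theorem Str.lamI (X : Ob P) : Str (λ_ X).inv := by cases X <;> exact Str.id _

/-- Cut-free points. -/
inductive CF : ∀ {X : Ob P}, (un ⟶ X) → Prop
  | nil : CF (𝟙 un)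
  | ax (p : P) : CF (pt (dPt p))
  | mix {X Y : Ob P} {t : un ⟶ X} {u : un ⟶ Y} : CF t → CF u → CF (t ≫ (ρ_ X).inv ≫ X ◁ u)
  | tensor {X Y : Ob P} {A C : Form P} {t : un ⟶ X ⊗ of A} {u : un ⟶ Y ⊗ of C} : CF t → CF u →
      CF (t ≫ X ◁ act u A)
  | exch {X Y : Ob P} {t : un ⟶ X} {e : X ⟶ Y} : CF t → Str e → CF (t ≫ e)

/-- Arrows preserving cut-free points in any context. -/
def Nice {X Y : Ob P} (f : X ⟶ Y) : Prop :=
  ∀ (Z : Ob P) (s : un ⟶ X ⊗ Z), CF s → CF (s ≫ f ▷ Z)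

theorem Nice.str {X Y : Ob P} {f : X ⟶ Y} (h : Str f) : Nice f := fun Z _ hs => hs.exch (h.wr Z)

theorem Nice.cf {X Y : Ob P} {f : X ⟶ Y} (h : Nice f) {s : un ⟶ X} (hs : CF s) : CF (s ≫ f) := h un s hs

theorem Nice.comp {X Y Z : Ob P} {f : X ⟶ Y} {g : Y ⟶ Z} (hf : Nice f) (hg : Nice g) : Nice (f ≫ g) := by
  intro W s hs
  rw [comp_whiskerRight, ← Category.assoc]
  exact hg _ _ (hf _ _ hs)

theorem Nice.wr {X Y : Ob P} {f : X ⟶ Y} (hf : Nice f) (W : Ob P) : Nice (f ▷ W) := by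
  intro Z s hs
  have h := (hf _ _ (hs.exch (.asc X W Z))).exch (.ascI Y W Z)
  convert h using 1
  simp

theorem Nice.wl {X Y : Ob P} {f : X ⟶ Y} (hf : Nice f) (W : Ob P) : Nice (W ◁ f) := by
  have h := ((Nice.str (.bra W X)).comp (hf.wr W)).comp (Nice.str (.bra Y W))
  convert h using 1
  simp

/-- Good arrows. -/
theorem Nice.of_wl {X Y : Ob P} {f : X ⟶ Y} (h : ∀ (Z : Ob P) (s : un ⟶ Z ⊗ X), CF s → CF (s ≫ Z ◁ f)) :
    Nice f := by
  intro Z s hs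
  have := (h Z _ (hs.exch (.bra X Z))).exch (.bra Z Y)
  convert this using 1
  simp

theorem Nice.lcf {X Y : Ob P} {f : X ⟶ Y} (h : Nice f) {Z : Ob P} {s : un ⟶ Z ⊗ X} (hs : CF s) :
    CF (s ≫ Z ◁ f) := (h.wl Z).cf hs

theorem Nice.pt {X : Ob P} {u : un ⟶ X} (hu : CF u) : Nice u := by
  refine .of_wl fun Z s hs => ?_
  have := hs.exch (.rho Z) |>.mix hu
  convert this using 1
  simp

theorem Nice.act {X : Ob P} {C : Form P} {u : un ⟶ X ⊗ of C} (hu : CF u) (A : Form P) : Nice (act u A) :=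
  .of_wl fun _ _ hs => hs.tensor hu

theorem Str.nice_iff {X Y Z : Ob P} {e : Y ⟶ Z} (he : Str e) {f : X ⟶ Y} (h : Nice (f ≫ e)) : Nice f := by
  obtain ⟨g, hg, h1, -⟩ := he.inv
  have := h.comp (.str hg)
  rwa [Category.assoc, h1, Category.comp_id] at this

theorem Nice.act' {X : Ob P} {C : Form P} {t : un ⟶ X ⊗ of C} (ht : CF t) (A : Form P) :
    Nice (Ob.act t A ≫ X ◁ ar (ca A C)) := by
  refine .of_wl fun Y u hu => ?_
  obtain ⟨g, hg, h1, -⟩ := (Str.sw Y X (of (C ⋏ A))).inv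
  have := (ht.tensor hu).exch hg
  convert this using 1
  rw [link_comm, Category.assoc, Category.assoc, h1, Category.comp_id]

theorem CF.focus {K : Form P} (Q : ∀ X : Ob P, (un ⟶ X ⊗ of K) → Prop)
    (hN : ∀ {X Y : Ob P} (s : un ⟶ X ⊗ of K) (f : X ⟶ Y), Nice f → Q X s → Q Y (s ≫ f ▷ of K))
    (hax : ∀ (p : P) (V : Ob P) (o : _ ⟶ V ⊗ of K), Occ K _ V o → Q V (pt (dPt p) ≫ o))
    (hten : ∀ (X Y : Ob P) (A C : Form P) (t : un ⟶ X ⊗ of A) (u : un ⟶ Y ⊗ of C), CF t → CF u →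
      ∀ (V : Ob P) (o : of (A ⋏ C) ⟶ V ⊗ of K), Occ K _ V o →
        Q (X ⊗ (Y ⊗ V)) ((t ≫ X ◁ act u A) ≫ X ◁ (Y ◁ o ≫ (α_ _ _ _).inv) ≫ (α_ _ _ _).inv))
    {X : Ob P} {t : un ⟶ X} (ht : CF t) : ∀ {V : Ob P} {o : X ⟶ V ⊗ of K}, Occ K X V o → Q V (t ≫ o) := by
  induction ht with
  | nil => intro V o h; cases h
  | ax p => exact hax p _ _
  | @mix X Y t u ht hu iht ihu =>
    intro W o h
    refine h.elim (fun W o => Q W (_ ≫ o)) ?_ ?_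
    · intro V o h
      have := hN _ ((ρ_ V).inv ≫ V ◁ u) ((Nice.str (.rhoI V)).comp ((Nice.pt hu).wl V)) (iht h)
      convert this using 1
      simp only [Category.assoc, whisker_exchange_assoc, rc_nat3]
      have h1 := rc_unit o
      simp only [comp_whiskerRight, ← Category.assoc] at h1 ⊢
      congr 1
      rw [Category.assoc, Category.assoc t]
      rw [Category.assoc] at h1
      rw [Category.assoc]
      exact congrArg (t ≫ ·) h1
    · intro V o h
      have := hN _ ((λ_ V).inv ≫ t ▷ V) ((Nice.str (.lamI V)).comp ((Nice.pt ht).wr V)) (ihu h)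
      convert this using 1
      have h1 : t ≫ (ρ_ X).inv ≫ X ◁ u = u ≫ (λ_ Y).inv ≫ t ▷ Y := mix_comm0 t u
      rw [h1]; simp only [Category.assoc]
      rw [← whisker_exchange_assoc, associator_inv_naturality_left, comp_whiskerRight]
      have h2 := congrArg (fun k => u ≫ k ≫ t ▷ V ▷ of K) (mix_r o)
      simp only [Category.assoc] at h2
      exact h2
  | @tensor X Y A C t u ht hu iht ihu =>
    intro W o h
    refine h.elim (fun W o => Q W (_ ≫ o)) ?_ ?_
    · intro V o h
      have := hN _ (V ◁ act u A) ((Nice.act hu A).wl V) (iht (h.tl _))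
      convert this using 1
      simp only [Category.assoc, whisker_exchange_assoc, rc_nat3]
    · intro V o h
      refine h.elim (fun V o => Q (X ⊗ V) ((t ≫ X ◁ act u A) ≫ X ◁ o ≫ (α_ X V (of K)).inv)) ?_ ?_
      · intro V o h
        have := hN _ _ (((Nice.act' ht C).wl V).comp (Nice.str (.sw V X (of (A ⋏ C))))) (ihu (h.tl _))
        convert this using 1
        rw [link_comm]
        simp only [Category.assoc]
        congr 1
        rw [comp_whiskerRight, ← Category.assoc, ← Category.assoc (rc _ _ _), ← rc_nat3]
        simp only [Category.assoc]
        rw [← whisker_exchange_assoc, whiskerLeft_comp X (o ▷ _), Category.assoc, ← sw_nat_assoc]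
        congr 2
        have := coh13 V (of K) X (of (A ⋏ C))
        exact this
      · intro V o h
        have := hten X Y A C t u ht hu V o h
        convert this using 1
  | exch ht he ih =>
    intro W o h
    obtain ⟨V, o', f', a, b, c⟩ := he.extract h
    have := hN _ f' (Nice.str b) (ih a)
    rw [Category.assoc, c, ← Category.assoc] at this
    exact this

end Ob

open CategoryTheory MonoidalCategory

namespace Ob

variable {P : Type}

theorem Occ.last {K : Form P} (hK : Irr K) (Z : Ob P) : Occ K (Z ⊗ of K) Z (𝟙 _) := by
  have h := (Occ.here hK).tr Z
  have e : Z ◁ 𝟙 (of K) ≫ (α_ Z un (of K)).inv = 𝟙 (Z ⊗ of K) := by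
    rw [whiskerLeft_id]; exact Category.id_comp (obj := Ob P) _
  exact (congrArg (Occ K _ _) e).mp h

theorem CF.eq {X : Ob P} {t s : un ⟶ X} (h : CF t) (e : s = t) : CF s := e ▸ h
theorem Nice.eq {X Y : Ob P} {t s : X ⟶ Y} (h : Nice t) (e : s = t) : Nice s := e ▸ h

theorem act_asc' {X Y : Ob P} {C : Form P} (v : un ⟶ X ⊗ (Y ⊗ of C)) (A : Form P) :
    act (v ≫ (α_ X Y (of C)).inv) A ≫ (α_ X Y (of (A ⋏ C))).hom =
      act (X := X) (C := orf Y C) v A ≫ X ◁ ac A Y C :=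
  (act_asc _ _).trans (congrArg (fun k => act (X := X) (C := orf Y C) k A ≫ X ◁ ac A Y C)
    (show (v ≫ (α_ X Y (of C)).inv) ≫ (α_ X Y (of C)).hom = v by simp))

theorem Nice.conj {A C : Form P} {Y : Ob P} (f : of (A ⋏ C) ⟶ Y)
    (h : ∀ (X Z : Ob P) (t : un ⟶ X ⊗ of A) (u : un ⟶ Z ⊗ of C), CF t → CF u →
      CF (t ≫ X ◁ (Ob.act u A ≫ Z ◁ f))) : Nice f := by
  refine .of_wl fun Z s hs => ?_
  have := hs.focus (K := A ⋏ C) (fun X s => CF (s ≫ X ◁ f)) ?_ ?_ ?_ (Occ.last (K := A ⋏ C) trivial Z)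
  · rwa [Category.comp_id] at this
  · intro X Y s g hg hs
    rw [Category.assoc, ← whisker_exchange, ← Category.assoc]
    exact hg _ _ hs
  · intro p V o ho
    cases ho with
    | left ho => cases ho
    | right ho => cases ho
  · intro X Z A' C' t u ht hu V o ho
    cases ho
    have e : X ◁ (Z ◁ 𝟙 (of (A ⋏ C)) ≫ (α_ Z un (of (A ⋏ C))).inv) = 𝟙 _ := by
      rw [whiskerLeft_id]
      exact (congrArg (fun k => X ◁ k) (Category.id_comp (obj := Ob P) _)).trans (whiskerLeft_id (C := Ob P) _ _)
    have e2 : ((t ≫ X ◁ Ob.act u A) ≫ 𝟙 _ ≫ (α_ X Z (of (A ⋏ C))).inv) ≫ (X ⊗ Z) ◁ f =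
        (t ≫ X ◁ (Ob.act u A ≫ Z ◁ f)) ≫ (α_ X Z Y).inv := by simp
    refine CF.eq ((h X Z t u ht hu).exch (.ascI X Z Y)) (Eq.trans ?_ e2)
    exact congrArg (fun k => ((t ≫ X ◁ Ob.act u A) ≫ k ≫ (α_ X Z (of (A ⋏ C))).inv) ≫ (X ⊗ Z) ◁ f) e

theorem Nice.cj {A B C D : Form P} {f : A ⟶ B} {g : C ⟶ D} (hf : Nice (ar f)) (hg : Nice (ar g)) :
    Nice (ar (cj f g)) := by
  refine .conj _ fun X Z t u ht hu => ?_
  have := (hf.lcf ht).tensor (hg.lcf hu)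
  convert this using 1
  rw [act_nat2, Category.assoc, ← whiskerLeft_comp, ← Category.assoc (ar f), act_nat3, Category.assoc,
    ← whiskerLeft_comp, ← ar_comp, cj_cj, Category.comp_id, Category.id_comp]

theorem Nice.ca (A C : Form P) : Nice (ar (ca A C)) := by
  refine .conj _ fun X Z t u ht hu => ?_
  exact (Nice.act' hu A).lcf ht

theorem Nice.aF (A B C : Form P) : Nice (ar (aF A B C)) := by
  refine .conj _ fun X Z t u ht hu => ?_
  suffices h : Nice (Ob.act u (A ⋏ B) ≫ Z ◁ ar (_root_.aF A B C)) from h.lcf ht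
  refine .conj _ fun X Y t1 t2 h1 h2 => ?_
  have := (h1.tensor (C := B ⋏ C) ((h2.tensor hu).exch (.ascI _ _ _))).exch (.wl _ (.asc _ _ _))
  refine CF.eq this ?_
  rw [act_aF, Category.assoc, ← whiskerLeft_comp, act_asc', whiskerLeft_comp Y, ← Category.assoc (Ob.act t2 A),
    ← act_nat2]
  rfl

theorem ca_nat_assoc' {A B C D X : Form P} (f : A ⟶ C) (g : B ⟶ D) (h : _ ⟶ X) :
    cj f g ≫ ca C D ≫ h = ca A B ≫ cj g f ≫ h := by
  rw [← Category.assoc, ← ca_nat, Category.assoc]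

theorem aT_eq (A B C : Form P) : aT A B C = ca _ _ ≫ aF B C A ≫ ca _ _ ≫ aF C A B ≫ ca _ _ := by
  have h : ∀ X Y Z : Form P, aF X Y Z ≫ ca _ _ ≫ aF Y Z X = cj (ca X Y) (𝟙 _) ≫ aF Y X Z ≫ cj (𝟙 _) (ca X Z) := by
    intro X Y Z
    rw [← aF_hex X Y Z]
    simp only [Category.assoc, cj_cj_assoc, cj_cj, ca_ca, Category.id_comp, cj_id, Category.comp_id]
  have h1 := h B C A
  have h2 := h A C B
  rw [← cancel_epi (aF A B C), aF_aT]
  have h3 : aF A B C ≫ ca A (B ⋏ C) ≫ (aF B C A ≫ ca B (C ⋏ A) ≫ aF C A B) ≫ ca C (A ⋏ B) = 𝟙 _ := by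
    rw [h1]
    simp only [Category.assoc]
    rw [← ca_nat, ← ca_nat_assoc', ← Category.assoc (aF A B C), a_hex]
    simp only [Category.assoc]
    rw [reassoc_of% h2]
    simp only [cj_cj_assoc, ca_ca, Category.id_comp, cj_id, aT_aF_assoc]
    rw [ca_nat_assoc', ca_ca_assoc, cj_cj, ca_ca, Category.id_comp, cj_id]
  simpa only [Category.assoc] using h3.symm

theorem Nice.aT (A B C : Form P) : Nice (ar (aT A B C)) := by
  rw [aT_eq]
  exact (Nice.ca _ _).comp ((Nice.aF _ _ _).comp ((Nice.ca _ _).comp ((Nice.aF _ _ _).comp (Nice.ca _ _))))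

theorem dd_xx (A B C : Form P) : dd A B C = cj (𝟙 A) (co B C) ≫ xx A C B ≫ co _ _ := by
  rw [xx, Category.assoc, Category.assoc, co_co, Category.comp_id, ← Category.assoc, cj_cj, co_co,
    Category.id_comp, cj_id, Category.id_comp]

theorem Str.co (A B : Form P) : Str (ar (co A B)) := Str.bra (of A) (of B)

theorem Nice.dd (A B C : Form P) : Nice (ar (dd A B C)) := by
  refine .conj _ fun X Z t u ht hu => ?_
  obtain ⟨v, ev⟩ : ∃ v : un ⟶ Z ⊗ (of C ⊗ of B), v = u ≫ Z ◁ ar (_root_.co B C) := ⟨_, rfl⟩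
  have hv : CF v := CF.eq (hu.exch (.wl Z (.co B C))) ev
  have e : Ob.act u A ≫ Z ◁ ar (_root_.dd A B C) =
      (Ob.act (v ≫ (α_ Z (of C) (of B)).inv) A ≫ (α_ Z (of C) (of (A ⋏ B))).hom) ≫
        Z ◁ (β_ (of C) (of (A ⋏ B))).hom := by
    rw [act_asc', dd_xx, ar_comp, ar_comp, whiskerLeft_comp, whiskerLeft_comp, ← Category.assoc, ← act_nat2,
      ← Category.assoc, ev]
    rfl
  exact ((((Nice.act (hv.exch (.ascI Z (of C) (of B))) A).comp (.str (.asc _ _ _))).comp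
    (.str (.wl Z (.bra _ _)))).eq e).lcf ht

theorem Nice.mx (A B : Form P) : Nice (ar (mx A B)) := by
  refine .conj _ fun X Z t u ht hu => ?_
  rw [act_mx]
  exact (((Nice.pt hu).wl (of A)).comp (.str (.sw _ _ _))).lcf ht

theorem Nice.dl (p : P) (A : Form P) : Nice (ar (dl p A)) := by
  have := Nice.act (X := un) (C := .natom p ⋎ .pos p) (.ax p) A
  exact Nice.eq this (Category.comp_id (obj := Form P) (_root_.dl p A)).symm

theorem Nice.dj {A B C D : Form P} {f : A ⟶ B} {g : C ⟶ D} (hf : Nice (ar f)) (hg : Nice (ar g)) :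
    Nice (ar (dj f g)) := by
  have := (hf.wr (of C)).comp (hg.wl (of B))
  refine Nice.eq this ?_
  change _ = ar (_root_.dj f (𝟙 C) ≫ _root_.dj (𝟙 B) g)
  rw [dj_dj, Category.comp_id, Category.id_comp]

end Ob

open CategoryTheory MonoidalCategory

namespace Ob

variable {P : Type}

theorem sg_oT (p : P) (E D : Form P) :
    oT E D (.pos p ⋏ .natom p) ≫ co (E ⋎ D) _ ≫ sg p (E ⋎ D) = dj (𝟙 E) (co D _ ≫ sg p D) := by
  have h := o_rev E D (.pos p ⋏ .natom p)
  rw [← cancel_epi (oF E D (.pos p ⋏ .natom p)), oF_oT_assoc]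
  have h2 : dj (𝟙 E) (co D _ ≫ sg p D) = co E _ ≫ dj (co D _ ≫ sg p D) (𝟙 E) ≫ co D E := by
    rw [← co_nat, co_co_assoc]
  rw [h2, dj_comp_one, Category.assoc, ← oF_sg, Category.assoc, sg_nat]
  have h3 := congrArg (fun k => k ≫ oF _ _ _ ≫ dj (𝟙 _) (co D E) ≫ sg p (E ⋎ D)) h
  simp only [Category.assoc] at h3
  rw [h3, oT_oF_assoc, dj_dj_assoc, co_co, Category.id_comp, dj_id, Category.id_comp]

/-- Cut with the identity link. -/
def sgx (p : P) (D : Form P) : of D ⊗ of (.pos p ⋏ .natom p) ⟶ of D := ar (co D _ ≫ sg p D)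

def SQ (p : P) : ∀ X : Ob P, (un ⟶ X ⊗ of (.pos p ⋏ .natom p)) → Prop
  | un, _ => False
  | of D, s => CF (s ≫ sgx p D)

theorem SQ.nice {p : P} {X Y : Ob P} (s : un ⟶ X ⊗ of (.pos p ⋏ .natom p)) (f : X ⟶ Y) (hf : Nice f)
    (hs : SQ p X s) : SQ p Y (s ≫ f ▷ of _) := by
  cases X
  · exact hs.elim
  cases Y
  · exact (IsEmpty.false f).elim
  refine CF.eq (hf.cf hs) ?_
  rw [Category.assoc, Category.assoc]
  congr 1
  obtain ⟨g, e⟩ : ∃ g : (_ : Form P) ⟶ _, f = ar g := ⟨f, rfl⟩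
  rw [e]
  change ar (dj g (𝟙 _) ≫ co _ _ ≫ sg p _) = ar ((co _ _ ≫ sg p _) ≫ g)
  rw [Category.assoc, sg_nat, ← Category.assoc, ← Category.assoc, ← co_nat]

theorem sgx_sw (p : P) (X : Ob P) (D : Form P) (s : un ⟶ X ⊗ (of D ⊗ of (.pos p ⋏ .natom p)))
    (h : CF (s ≫ X ◁ sgx p D)) : SQ p (of D ⊗ X) (s ≫ sw X (of D) (of _) ≫ (α_ _ _ _).inv) := by
  cases X with
  | un =>
    refine CF.eq h ?_
    rw [sw_un1]
    change (s ≫ 𝟙 _ ≫ 𝟙 _) ≫ sgx p D = s ≫ sgx p D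
    erw [Category.comp_id, Category.comp_id]
  | of E =>
    refine CF.eq (h.exch (.bra _ _)) ?_
    refine (Category.assoc (obj := Ob P) s _ _).trans (Eq.trans ?_ (Category.assoc (obj := Ob P) s _ _).symm)
    refine congrArg (fun k => s ≫ k) ?_
    have h : ((oT E D (.pos p ⋏ .natom p) ≫ dj (co E D) (𝟙 _) ≫ oF _ _ _) ≫ oT D E _) ≫ co (D ⋎ E) _ ≫ sg p _ =
      dj (𝟙 E) (co D _ ≫ sg p D) ≫ co E D := by
      simp only [Category.assoc]
      rw [oF_oT_assoc, ← Category.assoc (dj _ _) (co _ _), ← co_nat, Category.assoc, ← sg_nat, ← sg_oT]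
      simp only [Category.assoc]
    exact congrArg ar h

theorem tri (p : P) : act (X := of (.natom p)) (C := .pos p) (pt (dPt p)) (.natom p) ≫
    of (.natom p) ◁ ar (ca _ _) ≫ sgx p (.natom p) = 𝟙 _ := by
  have h : (dl p (.natom p) ≫ xx (.natom p) (.natom p) (.pos p)) ≫ dj (𝟙 _) (ca (.natom p) (.pos p)) ≫
    co _ _ ≫ sg p _ = 𝟙 _ := by
    refine Eq.trans ?_ (dl_sg' p)
    rw [xx]
    simp only [Category.assoc]
    rw [← Category.assoc (dj _ _) (co _ _), ← co_nat, Category.assoc, co_co_assoc]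
  exact congrArg ar h

theorem SQ.base {p : P} {X : Ob P} (u : un ⟶ X ⊗ of (.natom p)) (hu : CF u) :
    SQ p (of (.natom p) ⊗ X) ((show un ⟶ of (.natom p) ⊗ of (.pos p) from pt (dPt p)) ≫
      of (.natom p) ◁ act u (.pos p) ≫ (α_ _ _ _).inv) := by
  have h := sgx_sw p X (.natom p) (u ≫ X ◁ (act (X := of (.natom p)) (C := .pos p) (pt (dPt p)) (.natom p) ≫
    of (.natom p) ◁ ar (ca _ _))) ?_
  · refine (congrArg (SQ p _) ?_).mp h
    have h2 := link_comm (X := of (.natom p)) (A := .pos p) (pt (dPt p)) u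
    have h3 := congrArg (fun k => k ≫ (α_ (of (.natom p)) X (of (.pos p ⋏ .natom p))).inv) h2
    simp only [Category.assoc] at h3 ⊢
    refine h3.symm.trans ?_
    exact Category.assoc (obj := Ob P) _ _ _
  · refine CF.eq hu ?_
    rw [Category.assoc, ← whiskerLeft_comp, Category.assoc, tri, whiskerLeft_id, Category.comp_id]

theorem SQ.step {p : P} {X Y : Ob P} {t : un ⟶ Y ⊗ of (.pos p)} {u : un ⟶ X ⊗ of (.natom p)}
    (ht : CF t) (hu : CF u) : SQ p (Y ⊗ X) (t ≫ Y ◁ act u (.pos p) ≫ (α_ _ _ _).inv) := by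
  have := ht.focus (K := .pos p) (fun Y t => SQ p (Y ⊗ X) (t ≫ Y ◁ act u (.pos p) ≫ (α_ _ _ _).inv)) ?_ ?_ ?_
    (Occ.last (K := .pos p) trivial Y)
  · rwa [Category.comp_id] at this
  · intro Y Z s f hf hs
    have := SQ.nice _ _ (hf.wr X) hs
    refine (congrArg (SQ p _) ?_).mp this
    simp only [Category.assoc]
    rw [← associator_inv_naturality_left, whisker_exchange_assoc]
  · intro q V o ho
    cases ho with
    | left ho => cases ho
    | right ho =>
      cases ho
      refine (congrArg (SQ p _) ?_).mp (SQ.base u hu)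
      have e : of (.natom p) ◁ 𝟙 (of (.pos p)) ≫ (α_ (of (.natom p)) un (of (.pos p))).inv = 𝟙 _ := by
        rw [whiskerLeft_id]; exact Category.id_comp (obj := Ob P) _
      have e2 := congrArg (fun k => (pt (dPt p) ≫ k) ≫ of (.natom p) ◁ act u (.pos p) ≫
        (α_ (of (.natom p)) X _).inv) e
      have e3 : (show un ⟶ of (.natom p) ⊗ of (.pos p) from pt (dPt p)) ≫ 𝟙 _ = pt (dPt p) := Category.comp_id _
      have e4 := congrArg (fun k => k ≫ of (.natom p) ◁ act u (.pos p) ≫ (α_ (of (.natom p)) X _).inv) e3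
      exact (e2.trans e4).symm
  · intro _ _ _ _ _ _ _ _ V o ho
    cases ho

theorem SQ.all {p : P} {Z : Ob P} {s : un ⟶ Z ⊗ of (.pos p ⋏ .natom p)} (hs : CF s) : SQ p Z s := by
  have := hs.focus (K := .pos p ⋏ .natom p) (SQ p) SQ.nice ?_ ?_ (Occ.last (K := .pos p ⋏ .natom p) trivial Z)
  · rwa [Category.comp_id] at this
  · intro p V o ho
    cases ho with
    | left ho => cases ho
    | right ho => cases ho
  · intro X Z A' C' t u ht hu V o ho
    cases ho
    refine (congrArg (SQ p _) ?_).mp (SQ.step ht hu)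
    have e : X ◁ (Z ◁ 𝟙 (of (.pos p ⋏ .natom p)) ≫ (α_ Z un (of (.pos p ⋏ .natom p))).inv) = 𝟙 _ := by
      rw [whiskerLeft_id]
      exact (congrArg (fun k => X ◁ k) (Category.id_comp (obj := Ob P) _)).trans (whiskerLeft_id (C := Ob P) _ _)
    have e2 := congrArg (fun k => (t ≫ X ◁ act u (.pos p)) ≫ k ≫ (α_ X Z _).inv) e
    refine Eq.trans ?_ e2.symm
    simp only [Category.id_comp, Category.assoc]
    rfl

theorem Nice.sg (p : P) (A : Form P) : Nice (ar (sg p A)) := by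
  refine .of_wl fun Z s hs => ?_
  obtain ⟨v, ev⟩ : ∃ v : un ⟶ Z ⊗ (of (.pos p ⋏ .natom p) ⊗ of A), v = s := ⟨s, rfl⟩
  have hv : CF v := CF.eq hs ev
  have h := SQ.all (Z := Z ⊗ of A) ((hv.exch (.wl Z (.bra _ _))).exch (.ascI _ _ _))
  refine CF.eq h ?_
  subst ev
  cases Z
  · have e : _root_.sg p A = co _ A ≫ co A _ ≫ _root_.sg p A := (co_co_assoc _ _ _).symm
    have e2 := congrArg (fun k => v ≫ ar k) e
    refine e2.trans ?_
    have e3 : (v ≫ un ◁ (β_ (of (.pos p ⋏ .natom p)) (of A)).hom) ≫ (α_ un (of A) (of (.pos p ⋏ .natom p))).inv =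
       v ≫ ar (co _ A) := Category.comp_id (obj := Ob P) _
    rw [e3]
    exact (Category.assoc (obj := Ob P) v (ar (co _ A)) (sgx p A)).symm
  · rename_i E
    have e : _root_.dj (𝟙 E) (_root_.sg p A) = _root_.dj (𝟙 E) (co _ A) ≫ oT E A _ ≫ co (E ⋎ A) _ ≫ _root_.sg p _ := by
      rw [sg_oT, dj_dj, co_co_assoc, Category.id_comp]
    have e2 := congrArg (fun k => v ≫ ar k) e
    refine e2.trans ?_
    refine Eq.trans ?_ (congrArg (fun k => k ≫ sgx p (E ⋎ A)) (Category.assoc (obj := Ob P) v _ _).symm)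
    refine Eq.trans ?_ (Category.assoc (obj := Ob P) v _ _).symm
    exact congrArg (fun k => v ≫ ar k) (Category.assoc (obj := Form P) _ _ _).symm

/-- Every arrow preserves cut-free points. -/
theorem Nice.term {A B : Form P} (f : Term P A B) : Nice (ar (qq f)) := by
  induction f with
  | id => exact .str (.id _)
  | comp g f ihg ihf => rw [qq_comp, ar_comp]; exact ihf.comp ihg
  | conj f g ihf ihg => rw [qq_cj]; exact ihf.cj ihg
  | disj f g ihf ihg => rw [qq_dj]; exact ihf.dj ihg
  | bConjTo A B C => exact Nice.aT A B C
  | bConjFrom A B C => exact Nice.aF A B C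
  | bDisjTo A B C => exact .str (.ascI (of A) (of B) (of C))
  | bDisjFrom A B C => exact .str (.asc (of A) (of B) (of C))
  | cConj A B => exact Nice.ca A B
  | cDisj A B => exact .str (.bra (of B) (of A))
  | d A B C => exact Nice.dd A B C
  | delta p A => exact Nice.dl p A
  | sigma p A => exact Nice.sg p A
  | mix A B => exact Nice.mx A B

theorem Nice.all {A B : Form P} (f : A ⟶ B) : Nice (ar f) := by
  obtain ⟨f, rfl⟩ := qq_ex f; exact Nice.term f

end Ob

open CategoryTheory MonoidalCategory

theorem rc_nat2 {C : Type*} [Category C] [MonoidalCategory C] [SymmetricCategory C] (X : C) {Y Y' : C}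
    (f : Y ⟶ Y') (Z : C) : (X ◁ f) ▷ Z ≫ rc X Y' Z = rc X Y Z ≫ (X ⊗ Z) ◁ f := by
  simp only [rc, Category.assoc]
  rw [associator_naturality_middle_assoc, ← whiskerLeft_comp_assoc, BraidedCategory.braiding_naturality_left,
    whiskerLeft_comp_assoc, associator_inv_naturality_right]

namespace Ob

variable {P : Type}

/-- Two points that agree up to structural arrows. -/
def Sim {X Y : Ob P} (t : un ⟶ X) (u : un ⟶ Y) : Prop := ∃ e : X ⟶ Y, Str e ∧ t ≫ e = u

theorem Sim.refl {X : Ob P} (t : un ⟶ X) : Sim t t := ⟨𝟙 X, .id X, Category.comp_id t⟩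
theorem Sim.symm {X Y : Ob P} {t : un ⟶ X} {u : un ⟶ Y} (h : Sim t u) : Sim u t := by
  obtain ⟨e, he, rfl⟩ := h
  obtain ⟨g, hg, h1, -⟩ := he.inv
  exact ⟨g, hg, by rw [Category.assoc, h1, Category.comp_id]⟩
theorem Sim.trans {X Y Z : Ob P} {t : un ⟶ X} {u : un ⟶ Y} {v : un ⟶ Z} (h : Sim t u) (k : Sim u v) :
    Sim t v := by
  obtain ⟨e, he, rfl⟩ := h
  obtain ⟨g, hg, rfl⟩ := k
  exact ⟨_, he.comp hg, by rw [Category.assoc]⟩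
theorem Sim.str {X Y : Ob P} (t : un ⟶ X) {e : X ⟶ Y} (he : Str e) : Sim t (t ≫ e) := ⟨e, he, rfl⟩
theorem Sim.comps {X Y : Ob P} {t : un ⟶ X} {u : un ⟶ Y} (h : Sim t u) : comps X = comps Y := by
  obtain ⟨e, he, rfl⟩ := h; exact he.comps_eq
theorem Sim.of_eq {X : Ob P} {t u : un ⟶ X} (h : t = u) : Sim t u := h ▸ .refl t

/-- Juxtaposition. -/
def mixp {X Y : Ob P} (t : un ⟶ X) (u : un ⟶ Y) : un ⟶ X ⊗ Y := t ≫ (ρ_ X).inv ≫ X ◁ u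

theorem CF.mixp {X Y : Ob P} {t : un ⟶ X} {u : un ⟶ Y} (ht : CF t) (hu : CF u) : CF (mixp t u) := ht.mix hu

theorem mixp_eq {X Y : Ob P} (t : un ⟶ X) (u : un ⟶ Y) : mixp t u = u ≫ (λ_ Y).inv ≫ t ▷ Y := mix_comm0 t u

theorem mixp_r {X Y Z : Ob P} (t : un ⟶ X) (u : un ⟶ Y) (f : Y ⟶ Z) : mixp t (u ≫ f) = mixp t u ≫ X ◁ f := by
  simp [mixp]
theorem mixp_l {X Y Z : Ob P} (t : un ⟶ X) (u : un ⟶ Y) (f : X ⟶ Z) : mixp (t ≫ f) u = mixp t u ≫ f ▷ Y := by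
  simp [mixp_eq]

theorem Sim.mixc {X Y X' Y' : Ob P} {t : un ⟶ X} {u : un ⟶ Y} {t' : un ⟶ X'} {u' : un ⟶ Y'}
    (h : Sim t t') (k : Sim u u') : Sim (mixp t u) (mixp t' u') := by
  obtain ⟨e, he, rfl⟩ := h
  obtain ⟨g, hg, rfl⟩ := k
  exact ⟨_, (he.wr Y).comp (hg.wl _), by rw [mixp_r, mixp_l, Category.assoc]⟩

theorem Sim.mix_comm {X Y : Ob P} (t : un ⟶ X) (u : un ⟶ Y) : Sim (mixp t u) (mixp u t) := by
  refine ⟨(β_ X Y).hom, .bra _ _, ?_⟩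
  rw [mixp_eq u t, mixp, Category.assoc, Category.assoc, BraidedCategory.braiding_naturality_right]
  congr 1
  have : (ρ_ X).inv ≫ (β_ X (𝟙_ (Ob P))).hom = (λ_ X).inv := by
    simp
  rw [← this]; simp only [Category.assoc]

theorem Sim.mix_assoc {X Y Z : Ob P} (t : un ⟶ X) (u : un ⟶ Y) (v : un ⟶ Z) :
    Sim (mixp (mixp t u) v) (mixp t (mixp u v)) := by
  refine ⟨(α_ X Y Z).hom, .asc _ _ _, ?_⟩
  rw [mixp_eq u v]
  rw [mixp_r, mixp_eq _ v, mixp_eq t v, mixp]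
  have : mixp t u = t ≫ (ρ_ X).inv ≫ X ◁ u := rfl
  simp [comp_whiskerRight]

theorem Sim.mix_un {X : Ob P} (t : un ⟶ un) (u : un ⟶ X) : Sim u (mixp t u) := by
  obtain rfl : t = 𝟙 un := Subsingleton.elim _ _
  exact ⟨_, .lamI X, by rw [mixp_eq, id_whiskerRight]; exact congrArg (u ≫ ·) (Category.comp_id _).symm⟩

/-- Apply an arrow to the last component. -/
def app {X F Z : Ob P} (w : un ⟶ X ⊗ F) (a : F ⟶ Z) : un ⟶ X ⊗ Z := w ≫ X ◁ a

theorem app_l {X Y F Z : Ob P} (w : un ⟶ X ⊗ F) (f : X ⟶ Y) (a : F ⟶ Z) :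
    app (w ≫ f ▷ F) a = app w a ≫ f ▷ Z := by
  simp [app, whisker_exchange]

theorem app_r {X F Z Z' : Ob P} (w : un ⟶ X ⊗ F) (a : F ⟶ Z) (b : Z ⟶ Z') :
    app w (a ≫ b) = app w a ≫ X ◁ b := by
  simp [app]

/-- Juxtaposition keeping the focus. -/
def plus {X F Y : Ob P} (w : un ⟶ X ⊗ F) (u : un ⟶ Y) : un ⟶ (X ⊗ Y) ⊗ F := mixp w u ≫ rc X F Y

theorem Sim.plus {X F Y : Ob P} (w : un ⟶ X ⊗ F) (u : un ⟶ Y) : Sim (mixp w u) (plus w u) :=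
  .str _ (.rc _ _ _)

theorem CF.plus {X F Y : Ob P} {t : un ⟶ X ⊗ F} {u : un ⟶ Y} (ht : CF t) (hu : CF u) : CF (plus t u) :=
  (ht.mix hu).exch (.rc _ _ _)

theorem app_plus {X F Y Z : Ob P} (w : un ⟶ X ⊗ F) (u : un ⟶ Y) (a : F ⟶ Z) :
    app (plus w u) a = plus (app w a) u := by
  simp only [app, Ob.plus, mixp_l, Category.assoc]
  rw [rc_nat2]

theorem app_int {X F G Z W : Ob P} (w : un ⟶ (X ⊗ F) ⊗ G) (a : G ⟶ Z) (b : F ⟶ W) :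
    Sim (app (app w a ≫ rc X F Z) b) (app (app (w ≫ rc X F G) b ≫ rc X G W) a) := by
  refine ⟨rc X Z W, .rc _ _ _, ?_⟩
  simp only [app, Category.assoc]
  rw [← rc_nat2, whisker_exchange_assoc, ← Category.assoc (_ ◁ a), rc_nat3, Category.assoc]

end Ob

open CategoryTheory MonoidalCategory

/-- Signed letters of a formula. -/
def Form.lits {P : Type} : Form P → Multiset (Bool × P)
  | .pos p => {(true, p)}
  | .natom p => {(false, p)}
  | .conj A B => A.lits + B.lits
  | .disj A B => A.lits + B.lits

theorem Form.lits_ne {P : Type} (A : Form P) : ∃ l, l ∈ A.lits := by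
  induction A with
  | pos p => exact ⟨_, Multiset.mem_singleton_self _⟩
  | natom p => exact ⟨_, Multiset.mem_singleton_self _⟩
  | conj A B ih _ => exact ih.imp fun l h => Multiset.mem_add.2 (.inl h)
  | disj A B ih _ => exact ih.imp fun l h => Multiset.mem_add.2 (.inl h)

/-- All letters satisfy a predicate. -/
def Form.All {P : Type} (S : P → Prop) (A : Form P) : Prop := ∀ l ∈ A.lits, S l.2

theorem Form.all_conj {P : Type} {S : P → Prop} {A B : Form P} : (A ⋏ B).All S ↔ A.All S ∧ B.All S := by
  simp only [Form.All, Form.lits, Multiset.mem_add]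
  exact ⟨fun h => ⟨fun l k => h l (.inl k), fun l k => h l (.inr k)⟩, fun h l k => k.elim (h.1 l) (h.2 l)⟩

theorem Form.all_disj {P : Type} {S : P → Prop} {A B : Form P} : (A ⋎ B).All S ↔ A.All S ∧ B.All S := by
  simp only [Form.All, Form.lits, Multiset.mem_add]
  exact ⟨fun h => ⟨fun l k => h l (.inl k), fun l k => h l (.inr k)⟩, fun h l k => k.elim (h.1 l) (h.2 l)⟩

theorem Form.All.absurd {P : Type} {S T : P → Prop} (hd : ∀ p, S p → T p → False) {A : Form P}
    (h : A.All S) (k : A.All T) : False := by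
  obtain ⟨l, hl⟩ := A.lits_ne
  exact hd _ (h l hl) (k l hl)

namespace Ob

variable {P : Type}

def lits : Ob P → Multiset (Bool × P)
  | un => 0
  | of A => A.lits

theorem lits_ten (X Y : Ob P) : lits (X ⊗ Y) = lits X + lits Y := by
  cases Y
  · exact (add_zero _).symm
  · cases X
    · exact (zero_add _).symm
    · rfl

theorem lits_bind (X : Ob P) : lits X = (comps X).bind Form.lits := by
  cases X with
  | un => rfl
  | of A =>
    change A.lits = (fc A).bind Form.lits
    induction A with
    | disj A B ih1 ih2 => rw [fc, Multiset.add_bind, ← ih1, ← ih2]; rfl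
    | _ => exact (Multiset.singleton_bind _ _).symm

theorem comps_nodup {X : Ob P} (h : (lits X).Nodup) : (comps X).Nodup := by
  rw [Multiset.nodup_iff_le]
  intro K hK
  obtain ⟨m, hm⟩ := Multiset.le_iff_exists_add.1 hK
  rw [lits_bind, hm] at h
  simp only [Multiset.add_bind, Multiset.cons_bind] at h
  obtain ⟨l, hl⟩ := K.lits_ne
  have h2 := (Multiset.nodup_add.1 (Multiset.nodup_add.1 h).1).2.2
  exact Multiset.disjoint_left.1 h2 hl (Multiset.mem_add.2 (.inl hl))

theorem lits_nil {X : Ob P} (h : lits X = 0) : X = un := by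
  cases X with
  | un => rfl
  | of A => obtain ⟨l, hl⟩ := A.lits_ne; change A.lits = 0 at h; rw [h] at hl; simp at hl

theorem comps_irr {X : Ob P} {K : Form P} (h : K ∈ comps X) : Irr K := by
  obtain ⟨_, _, o⟩ := Occ.ex h; exact o.irr

theorem ex_ob (m : Multiset (Form P)) (h : ∀ K ∈ m, Irr K) : ∃ X : Ob P, comps X = m := by
  induction m using Multiset.induction_on with
  | empty => exact ⟨un, rfl⟩
  | cons K m ih =>
    obtain ⟨X, hX⟩ := ih fun K hK => h K (Multiset.mem_cons_of_mem hK)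
    refine ⟨X ⊗ of K, ?_⟩
    rw [comps_ten, hX]
    change m + fc K = _
    rw [fc_irr (h K (Multiset.mem_cons_self _ _)), add_comm, Multiset.singleton_add]

/-- All letters satisfy a predicate. -/
def All (S : P → Prop) (X : Ob P) : Prop := ∀ l ∈ lits X, S l.2
/-- Each component lies on one side. -/
def Pure (S T : P → Prop) (m : Multiset (Form P)) : Prop := ∀ K ∈ m, K.All S ∨ K.All T

theorem all_comps {S : P → Prop} {X : Ob P} : All S X ↔ ∀ K ∈ comps X, K.All S := by
  simp only [All, lits_bind, Multiset.mem_bind, Form.All]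
  exact ⟨fun h K hK l hl => h l ⟨K, hK, hl⟩, fun h l ⟨K, hK, hl⟩ => h K hK l hl⟩

theorem all_ten {S : P → Prop} {X Y : Ob P} : All S (X ⊗ Y) ↔ All S X ∧ All S Y := by
  simp only [All, lits_ten, Multiset.mem_add]
  exact ⟨fun h => ⟨fun l k => h l (.inl k), fun l k => h l (.inr k)⟩, fun h l k => k.elim (h.1 l) (h.2 l)⟩

theorem Pure.symm {S T : P → Prop} {m} (h : Pure S T m) : Pure T S m := fun K hK => (h K hK).symm

theorem pure_add {S T : P → Prop} {m n : Multiset (Form P)} : Pure S T (m + n) ↔ Pure S T m ∧ Pure S T n := by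
  simp only [Pure, Multiset.mem_add]
  exact ⟨fun h => ⟨fun l k => h l (.inl k), fun l k => h l (.inr k)⟩, fun h l k => k.elim (h.1 l) (h.2 l)⟩

theorem All.pure {S : P → Prop} (T : P → Prop) {X : Ob P} (h : All S X) : Pure S T (comps X) :=
  fun K hK => .inl (all_comps.1 h K hK)

theorem Sim.lits {X Y : Ob P} {t : un ⟶ X} {u : un ⟶ Y} (h : Sim t u) : lits X = lits Y := by
  rw [lits_bind, lits_bind, h.comps]

/-- Refocusing. -/
theorem Sim.refocus {X X' F : Ob P} {t : un ⟶ X ⊗ F} {u : un ⟶ X' ⊗ F} (h : Sim t u)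
    (hn : (Ob.lits (X ⊗ F)).Nodup) : ∃ f : X ⟶ X', Str f ∧ t ≫ f ▷ F = u := by
  have hc := h.comps
  rw [comps_ten, comps_ten] at hc
  obtain ⟨f, hf⟩ := Str.exists (add_right_cancel hc)
  obtain ⟨e, he, h⟩ := h
  have hn' := comps_nodup hn
  rw [he.comps_eq] at hn'
  refine ⟨f, hf, ?_⟩
  rw [(hf.wr F).uniq he hn', h]

theorem Sim.eq {X : Ob P} {t u : un ⟶ X} (h : Sim t u) (hn : (Ob.lits X).Nodup) : t = u := by
  obtain ⟨e, he, rfl⟩ := h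
  rw [he.uniq (.id X) (comps_nodup hn), Category.comp_id]

theorem CF.extract {X F : Ob P} {t : un ⟶ X} (ht : CF t) (h : comps F ≤ comps X) :
    ∃ (Y : Ob P) (u : un ⟶ Y ⊗ F), CF u ∧ Sim t u := by
  obtain ⟨m, hm⟩ := Multiset.le_iff_exists_add.1 h
  obtain ⟨Y, hY⟩ := ex_ob m fun K hK => comps_irr (X := X) (by rw [hm]; exact Multiset.mem_add.2 (.inr hK))
  obtain ⟨e, he⟩ := Str.exists (X := X) (Y := Y ⊗ F) (by rw [comps_ten, hY, hm, add_comm])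
  exact ⟨Y, _, ht.exch he, .str t he⟩

/-- Link two points. -/
def link {X Y : Ob P} {A C : Form P} (t : un ⟶ X ⊗ of A) (u : un ⟶ Y ⊗ of C) :
    un ⟶ X ⊗ (Y ⊗ of (A ⋏ C)) := app t (act u A)
/-- Link two points, other side. -/
def linkR {X Y : Ob P} {A C : Form P} (t : un ⟶ X ⊗ of A) (u : un ⟶ Y ⊗ of C) :
    un ⟶ Y ⊗ (X ⊗ of (A ⋏ C)) := app u (act t C ≫ X ◁ ar (ca C A))

theorem CF.link {X Y : Ob P} {A C : Form P} {t : un ⟶ X ⊗ of A} {u : un ⟶ Y ⊗ of C} (ht : CF t) (hu : CF u) :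
    CF (link t u) := ht.tensor hu
theorem CF.linkR {X Y : Ob P} {A C : Form P} {t : un ⟶ X ⊗ of A} {u : un ⟶ Y ⊗ of C} (ht : CF t) (hu : CF u) :
    CF (linkR t u) := (Nice.act' ht C).lcf hu

theorem Sim.linkR {X Y : Ob P} {A C : Form P} (t : un ⟶ X ⊗ of A) (u : un ⟶ Y ⊗ of C) :
    Sim (linkR t u) (link t u) :=
  ⟨_, .sw _ _ _, by rw [Ob.link, app, link_comm, Ob.linkR, app, Category.assoc]⟩

theorem Sim.link {X Y X' Y' : Ob P} {A C : Form P} {t : un ⟶ X ⊗ of A} {u : un ⟶ Y ⊗ of C}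
    {t' : un ⟶ X' ⊗ of A} {u' : un ⟶ Y' ⊗ of C} (h : Sim t t') (k : Sim u u')
    (h1 : (Ob.lits (X ⊗ of A)).Nodup) (h2 : (Ob.lits (Y ⊗ of C)).Nodup) : Sim (link t u) (link t' u') := by
  obtain ⟨e, he, rfl⟩ := h.refocus h1
  obtain ⟨g, hg, rfl⟩ := k.refocus h2
  refine ⟨_, (he.wr _).comp ((hg.wr _).wl _), ?_⟩
  rw [Ob.link, Ob.link, act_nat1, app_r, app_l, Category.assoc]

theorem Sim.app_plus {X F Y Z : Ob P} (w : un ⟶ X ⊗ F) (u : un ⟶ Y) (a : F ⟶ Z) :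
    Sim (app (Ob.plus w u) a) (mixp (app w a) u) := by
  rw [Ob.app_plus]; exact (Sim.plus _ _).symm

theorem Sim.link_plus {X Y Z : Ob P} {A C : Form P} (t : un ⟶ X ⊗ of A) (u : un ⟶ Y ⊗ of C) (v : un ⟶ Z) :
    Sim (Ob.link (Ob.plus t v) u) (mixp (Ob.link t u) v) := .app_plus _ _ _
theorem Sim.link_plus' {X Y Z : Ob P} {A C : Form P} (t : un ⟶ X ⊗ of A) (u : un ⟶ Y ⊗ of C) (v : un ⟶ Z) :
    Sim (Ob.link t (Ob.plus u v)) (mixp (Ob.link t u) v) :=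
  (Sim.linkR _ _).symm.trans ((Sim.app_plus _ _ _).trans ((Sim.linkR _ _).mixc (.refl _)))

theorem Sim.link_plus2 {X Y Z W : Ob P} {A C : Form P} (t : un ⟶ X ⊗ of A) (u : un ⟶ Y ⊗ of C) (v : un ⟶ Z)
    (w : un ⟶ W) : Sim (Ob.link (Ob.plus t v) (Ob.plus u w)) (mixp (Ob.link t u) (mixp v w)) :=
  (Sim.link_plus _ _ _).trans (((Sim.link_plus' _ _ _).mixc (.refl _)).trans ((Sim.mix_assoc _ _ _).trans
    ((Sim.refl _).mixc (.mix_comm _ _))))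

end Ob

open CategoryTheory MonoidalCategory

namespace Ob

variable {P : Type}

/-- Splitting into two. -/
def MS (S T : P → Prop) {X : Ob P} (t : un ⟶ X) : Prop :=
  ∃ (Γ Δ : Ob P) (t1 : un ⟶ Γ) (t2 : un ⟶ Δ), CF t1 ∧ CF t2 ∧ All S Γ ∧ All T Δ ∧ Sim t (mixp t1 t2)

/-- Splitting at a conjunction. -/
def XS (S T : P → Prop) (A C : Form P) {X : Ob P} (t : un ⟶ X) : Prop :=
  ∃ (Γ Δ : Ob P) (t1 : un ⟶ Γ ⊗ of A) (t2 : un ⟶ Δ ⊗ of C), CF t1 ∧ CF t2 ∧ All S Γ ∧ All T Δ ∧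
    Sim t (link t1 t2)

theorem MS.sim {S T : P → Prop} {X Y : Ob P} {t : un ⟶ X} {u : un ⟶ Y} (h : MS S T t) (k : Sim u t) :
    MS S T u := by
  obtain ⟨Γ, Δ, t1, t2, a, b, c, d, e⟩ := h
  exact ⟨Γ, Δ, t1, t2, a, b, c, d, k.trans e⟩

theorem XS.sim {S T : P → Prop} {A C : Form P} {X Y : Ob P} {t : un ⟶ X} {u : un ⟶ Y} (h : XS S T A C t)
    (k : Sim u t) : XS S T A C u := by
  obtain ⟨Γ, Δ, t1, t2, a, b, c, d, e⟩ := h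
  exact ⟨Γ, Δ, t1, t2, a, b, c, d, k.trans e⟩

theorem MS.symm {S T : P → Prop} {X : Ob P} {t : un ⟶ X} (h : MS S T t) : MS T S t := by
  obtain ⟨Γ, Δ, t1, t2, a, b, c, d, e⟩ := h
  exact ⟨Δ, Γ, t2, t1, b, a, d, c, e.trans (.mix_comm _ _)⟩

theorem all_un (S : P → Prop) : All S un := fun _ h => (Multiset.notMem_zero _ h).elim

theorem MS.left {S : P → Prop} (T : P → Prop) {X : Ob P} {t : un ⟶ X} (ht : CF t) (h : All S X) : MS S T t :=
  ⟨X, un, t, 𝟙 un, ht, .nil, h, all_un _, (Sim.mix_un _ _).trans (.mix_comm _ _)⟩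
theorem MS.right (S : P → Prop) {T : P → Prop} {X : Ob P} {t : un ⟶ X} (ht : CF t) (h : All T X) : MS S T t :=
  (MS.left S ht h).symm

theorem MS.mixp {S T : P → Prop} {X Y : Ob P} {t : un ⟶ X} {u : un ⟶ Y} (h : MS S T t) (k : MS S T u) :
    MS S T (mixp t u) := by
  obtain ⟨Γ, Δ, t1, t2, a, b, c, d, e⟩ := h
  obtain ⟨Γ', Δ', t1', t2', a', b', c', d', e'⟩ := k
  refine ⟨_, _, Ob.mixp t1 t1', Ob.mixp t2 t2', a.mixp a', b.mixp b', all_ten.2 ⟨c, c'⟩, all_ten.2 ⟨d, d'⟩, ?_⟩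
  refine (e.mixc e').trans ((Sim.mix_assoc _ _ _).trans (.trans ?_ (Sim.mix_assoc _ _ _).symm))
  refine (Sim.refl _).mixc ?_
  exact (Sim.mix_assoc _ _ _).symm.trans (((Sim.mix_comm _ _).mixc (.refl _)).trans (Sim.mix_assoc _ _ _))

theorem XS.mixp {S T : P → Prop} {A C : Form P} {X Y : Ob P} {t : un ⟶ X} {u : un ⟶ Y} (h : XS S T A C t)
    (k : MS S T u) : XS S T A C (mixp t u) := by
  obtain ⟨Γ, Δ, t1, t2, a, b, c, d, e⟩ := h
  obtain ⟨Γ', Δ', t1', t2', a', b', c', d', e'⟩ := k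
  exact ⟨_, _, Ob.plus t1 t1', Ob.plus t2 t2', a.plus a', b.plus b', all_ten.2 ⟨c, c'⟩, all_ten.2 ⟨d, d'⟩,
    (e.mixc e').trans (Sim.link_plus2 _ _ _ _).symm⟩

theorem le_of_split {S T : P → Prop} (hd : ∀ p, S p → T p → False) {m n k : Multiset (Form P)} (h : m ≤ n + k)
    (hm : ∀ K ∈ m, K.All S) (hk : ∀ K ∈ k, K.All S → False) : m ≤ n := by
  classical
  rw [Multiset.le_iff_count] at h ⊢
  intro K
  by_cases hK : K ∈ m
  · have := h K
    rw [Multiset.count_add, Multiset.count_eq_zero_of_notMem (fun h2 => hk K h2 (hm K hK))] at this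
    exact this
  · rw [Multiset.count_eq_zero_of_notMem hK]; exact Nat.zero_le _

theorem MS.focus {S T : P → Prop} (hd : ∀ p, S p → T p → False) {X F : Ob P} {t : un ⟶ X ⊗ F} (h : MS S T t)
    (hF : All S F) : ∃ (Γ Δ : Ob P) (t1 : un ⟶ Γ ⊗ F) (t2 : un ⟶ Δ), CF t1 ∧ CF t2 ∧ All S Γ ∧ All T Δ ∧
      Sim t (plus t1 t2) := by
  obtain ⟨Γ, Δ, t1, t2, a, b, c, d, e⟩ := h
  have hc := e.comps
  rw [comps_ten, comps_ten] at hc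
  obtain ⟨Y, u, hu, k⟩ := a.extract (F := F) (le_of_split hd (k := comps Δ)
    (by rw [← hc]; exact Multiset.le_add_left _ _) (all_comps.1 hF)
    (fun K hK h => h.absurd hd (all_comps.1 d K hK)))
  refine ⟨Y, Δ, u, t2, hu, b, ?_, d, e.trans ((k.mixc (.refl _)).trans (.plus _ _))⟩
  intro l hl
  refine c l ?_
  rw [k.lits, lits_ten]; exact Multiset.mem_add.2 (.inl hl)

theorem Sim.app {X X' F Z : Ob P} {t : un ⟶ X ⊗ F} {u : un ⟶ X' ⊗ F} (h : Sim t u)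
    (hn : (Ob.lits (X ⊗ F)).Nodup) (b : F ⟶ Z) : Sim (app t b) (app u b) := by
  obtain ⟨e, he, rfl⟩ := h.refocus hn
  exact ⟨_, he.wr _, (app_l _ _ _).symm⟩

theorem XS.appS {S T : P → Prop} (hd : ∀ p, S p → T p → False) {A C : Form P} (hA : A.All S) (hC : C.All T)
    {X F Z : Ob P} {t : un ⟶ X ⊗ F}
    (h : XS S T A C t) (hF : All S F) (hZ : All S Z) (b : F ⟶ Z) (hb : Nice b) (hn : (lits (X ⊗ F)).Nodup) :
    XS S T A C (app t b) := by
  obtain ⟨Γ, Δ, t1, t2, a, b', c, d, e⟩ := h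
  have hc := e.comps
  simp only [comps_ten] at hc
  have : comps F ≤ comps Γ := by
    refine le_of_split hd (k := comps Δ + comps (of (A ⋏ C)))
      (by rw [← hc]; exact Multiset.le_add_left _ _) (all_comps.1 hF) ?_
    intro K hK h
    rcases Multiset.mem_add.1 hK with hK | hK
    · exact h.absurd hd (all_comps.1 d K hK)
    · obtain rfl := Multiset.mem_singleton.1 hK
      exact (Form.all_conj.1 h).2.absurd hd hC
  obtain ⟨m, hm⟩ := Multiset.le_iff_exists_add.1 this
  obtain ⟨Y, hY⟩ := ex_ob m fun K hK => comps_irr (X := Γ) (by rw [hm]; exact Multiset.mem_add.2 (.inr hK))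
  obtain ⟨g, hg⟩ := Str.exists (X := Γ) (Y := Y ⊗ F) (by rw [comps_ten, hY, hm, add_comm])
  have hYS : All S Y := by
    refine all_comps.2 fun K hK => all_comps.1 c K ?_
    rw [hg.comps_eq, comps_ten]; exact Multiset.mem_add.2 (.inl hK)
  have k : Sim t (Ob.app (t1 ≫ g ▷ of A) (act t2 A) ≫ rc Y F _) := by
    refine e.trans (Sim.trans ⟨g ▷ _, hg.wr _, ?_⟩ (.str _ (.rc _ _ _)))
    rw [app_l]; rfl
  refine XS.sim ?_ ((k.app hn b).trans (app_int _ _ _))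
  refine ⟨_, _, _, t2, ?_, b', ?_, d, .refl _⟩
  · exact (hb.lcf ((a.exch (hg.wr _)).exch (.rc _ _ _))).exch (.rc _ _ _)
  · exact all_ten.2 ⟨hYS, hZ⟩

theorem XS.appT {S T : P → Prop} (hd : ∀ p, S p → T p → False) {A C : Form P} (hA : A.All S) (hC : C.All T)
    {X F Z : Ob P} {t : un ⟶ X ⊗ F}
    (h : XS S T A C t) (hF : All T F) (hZ : All T Z) (b : F ⟶ Z) (hb : Nice b) (hn : (lits (X ⊗ F)).Nodup) :
    XS S T A C (app t b) := by
  obtain ⟨Δ, Γ, t2, t1, b', a, d, c, e⟩ := h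
  have hc := e.comps
  simp only [comps_ten] at hc
  have hd' : ∀ p, T p → S p → False := fun p h k => hd p k h
  have : comps F ≤ comps Γ := by
    refine le_of_split hd' (k := comps Δ + comps (of (A ⋏ C)))
      (by rw [add_left_comm, ← hc]; exact Multiset.le_add_left _ _) (all_comps.1 hF) ?_
    intro K hK h
    rcases Multiset.mem_add.1 hK with hK | hK
    · exact h.absurd hd' (all_comps.1 d K hK)
    · obtain rfl := Multiset.mem_singleton.1 hK
      exact (Form.all_conj.1 h).1.absurd hd' hA
  obtain ⟨m, hm⟩ := Multiset.le_iff_exists_add.1 this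
  obtain ⟨Y, hY⟩ := ex_ob m fun K hK => comps_irr (X := Γ) (by rw [hm]; exact Multiset.mem_add.2 (.inr hK))
  obtain ⟨g, hg⟩ := Str.exists (X := Γ) (Y := Y ⊗ F) (by rw [comps_ten, hY, hm, add_comm])
  have hYS : All T Y := by
    refine all_comps.2 fun K hK => all_comps.1 c K ?_
    rw [hg.comps_eq, comps_ten]; exact Multiset.mem_add.2 (.inl hK)
  have k : Sim t (Ob.app (t1 ≫ g ▷ of C) (act t2 C ≫ Δ ◁ ar (ca C A)) ≫ rc Y F _) := by
    refine (e.trans (Sim.linkR _ _).symm).trans (Sim.trans ⟨g ▷ _, hg.wr _, ?_⟩ (.str _ (.rc _ _ _)))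
    rw [app_l]; rfl
  refine XS.sim ?_ ((k.app hn b).trans (app_int _ _ _))
  refine ⟨_, _, t2, _, b', ?_, d, ?_, .linkR _ _⟩
  · exact (hb.lcf ((a.exch (hg.wr _)).exch (.rc _ _ _))).exch (.rc _ _ _)
  · exact all_ten.2 ⟨hYS, hZ⟩

theorem MS.link {S T : P → Prop} (hd : ∀ p, S p → T p → False) {X Y : Ob P} {A C : Form P}
    {t : un ⟶ X ⊗ of A} {u : un ⟶ Y ⊗ of C}
    (ht : MS S T t) (hu : MS S T u) (h1 : (lits (X ⊗ of A)).Nodup) (h2 : (lits (Y ⊗ of C)).Nodup)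
    (hA : A.All S) (hC : C.All S) : MS S T (link t u) := by
  obtain ⟨Γ, Δ, t1, t2, a, b, c, d, e⟩ := ht.focus hd hA
  obtain ⟨Γ', Δ', t1', t2', a', b', c', d', e'⟩ := hu.focus hd hC
  exact ⟨_, _, _, _, a.link a', b.mixp b', all_ten.2 ⟨c, all_ten.2 ⟨c', Form.all_conj.2 ⟨hA, hC⟩⟩⟩,
    all_ten.2 ⟨d, d'⟩, (e.link e' h1 h2).trans (.link_plus2 _ _ _ _)⟩

end Ob

open CategoryTheory MonoidalCategory

namespace Ob

variable {P : Type}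

theorem nd1 {X Y : Ob P} {A C : Form P} (h : (lits (X ⊗ (Y ⊗ of (A ⋏ C)))).Nodup) :
    (lits (X ⊗ of A)).Nodup := by
  refine Multiset.nodup_of_le ?_ h
  simp only [lits_ten]
  exact add_le_add_right ((Multiset.le_add_right A.lits C.lits).trans (Multiset.le_add_left _ _)) _

theorem nd2 {X Y : Ob P} {A C : Form P} (h : (lits (X ⊗ (Y ⊗ of (A ⋏ C)))).Nodup) :
    (lits (Y ⊗ of C)).Nodup := by
  refine Multiset.nodup_of_le ?_ h
  simp only [lits_ten]
  exact (add_le_add_right (Multiset.le_add_left C.lits A.lits) _).trans (Multiset.le_add_left _ _)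

theorem ndl {X Y : Ob P} (h : (lits (X ⊗ Y)).Nodup) : (lits X).Nodup := by
  rw [lits_ten] at h; exact (Multiset.nodup_add.1 h).1
theorem ndr {X Y : Ob P} (h : (lits (X ⊗ Y)).Nodup) : (lits Y).Nodup := by
  rw [lits_ten] at h; exact (Multiset.nodup_add.1 h).2.1

theorem CF.splitM {X : Ob P} {t : un ⟶ X} (ht : CF t) : ∀ (S T : P → Prop), (∀ p, S p → T p → False) →
    (lits X).Nodup → Pure S T (comps X) → MS S T t := by
  induction ht with
  | nil => intro S T _ _ _; exact .left T .nil (all_un S)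
  | ax p =>
    intro S T hd _ hp
    have h1 := hp (.natom p) (Multiset.mem_add.2 (.inl (Multiset.mem_singleton_self _)))
    rcases h1 with h1 | h1
    · refine .left T (.ax p) ?_
      have := h1 _ (Multiset.mem_singleton_self _)
      intro l hl
      rcases Multiset.mem_add.1 hl with hl | hl <;> (obtain rfl := Multiset.mem_singleton.1 hl; exact this)
    · refine .right S (.ax p) ?_
      have := h1 _ (Multiset.mem_singleton_self _)
      intro l hl
      rcases Multiset.mem_add.1 hl with hl | hl <;> (obtain rfl := Multiset.mem_singleton.1 hl; exact this)
  | mix _ _ ih1 ih2 =>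
    intro S T hd hn hp
    rw [comps_ten, pure_add] at hp
    exact (ih1 S T hd (ndl hn) hp.1).mixp (ih2 S T hd (ndr hn) hp.2)
  | @tensor X Y A C t u ht hu ih1 ih2 =>
    have key : ∀ (S T : P → Prop), (∀ p, S p → T p → False) →
        (lits (X ⊗ (Y ⊗ of (A ⋏ C)))).Nodup → Pure S T (comps (X ⊗ (Y ⊗ of (A ⋏ C)))) → (A ⋏ C).All S →
        MS S T (t ≫ X ◁ act u A) := by
      intro S T hd hn hp hS
      rw [comps_ten, comps_ten, pure_add, pure_add] at hp
      rw [Form.all_conj] at hS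
      refine MS.link hd (ih1 S T hd (nd1 hn) ?_) (ih2 S T hd (nd2 hn) ?_) (nd1 hn) (nd2 hn) hS.1 hS.2
      · rw [comps_ten, pure_add]; exact ⟨hp.1, All.pure T (X := of A) hS.1⟩
      · rw [comps_ten, pure_add]; exact ⟨hp.2.1, All.pure T (X := of C) hS.2⟩
    intro S T hd hn hp
    have hp' := hp
    rw [comps_ten, comps_ten, pure_add, pure_add] at hp'
    rcases hp'.2.2 (A ⋏ C) (Multiset.mem_singleton_self _) with h | h
    · exact key S T hd hn hp h
    · exact (key T S (fun p h k => hd p k h) hn hp.symm h).symm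
  | @exch X Y t e ht he ih =>
    intro S T hd hn hp
    have s := (Sim.str t he).symm
    exact (ih S T hd (s.lits ▸ hn) (s.comps ▸ hp)).sim s

theorem CF.splitX {A C : Form P} {X : Ob P} {t : un ⟶ X} (ht : CF t) : ∀ (S T : P → Prop),
    (∀ p, S p → T p → False) → A.All S → C.All T →
    (lits X).Nodup → ∀ m, comps X = (A ⋏ C) ::ₘ m → Pure S T m → XS S T A C t := by
  induction ht with
  | nil => intro S T hd hA hC hn m hm; exact (Multiset.zero_ne_cons hm).elim
  | ax p =>
    intro S T hd hA hC hn m hm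
    have : A ⋏ C ∈ comps (of (Form.natom p ⋎ Form.pos p)) := by rw [hm]; exact Multiset.mem_cons_self _ _
    rcases Multiset.mem_add.1 this with h | h <;> cases Multiset.mem_singleton.1 h
  | @mix X Y t u ht hu ih1 ih2 =>
    intro S T hd hA hC hn m hm hp
    have : A ⋏ C ∈ comps (X ⊗ Y) := by rw [hm]; exact Multiset.mem_cons_self _ _
    rw [comps_ten] at this hm
    rcases Multiset.mem_add.1 this with h | h
    · obtain ⟨n, hn'⟩ := Multiset.exists_cons_of_mem h
      rw [hn', Multiset.cons_add, Multiset.cons_inj_right] at hm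
      rw [← hm, pure_add] at hp
      exact (ih1 S T hd hA hC (ndl hn) n hn' hp.1).mixp (hu.splitM S T hd (ndr hn) hp.2)
    · obtain ⟨n, hn'⟩ := Multiset.exists_cons_of_mem h
      rw [hn', Multiset.add_cons, Multiset.cons_inj_right] at hm
      rw [← hm, pure_add] at hp
      exact ((ih2 S T hd hA hC (ndr hn) n hn' hp.2).mixp (ht.splitM S T hd (ndl hn) hp.1)).sim (.mix_comm _ _)
  | @tensor X Y A' C' t u ht hu ih1 ih2 =>
    intro S T hd hA hC hn m hm hp
    have hd' : ∀ p, T p → S p → False := fun p h k => hd p k h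
    have e : comps (of (A' ⋏ C')) = {A' ⋏ C'} := rfl
    rw [comps_ten, comps_ten, e] at hm
    have h1 := nd1 hn
    have h2 := nd2 hn
    by_cases hAC : A' ⋏ C' = A ⋏ C
    · cases hAC
      have hm2 : comps X + comps Y = m := by
        rw [← add_assoc, add_comm, Multiset.singleton_add, Multiset.cons_inj_right] at hm; exact hm
      rw [← hm2, pure_add] at hp
      have m1 := ht.splitM S T hd h1 (by rw [comps_ten, pure_add]; exact ⟨hp.1, All.pure T (X := of A) hA⟩)
      have m2 := hu.splitM S T hd h2 (by rw [comps_ten, pure_add]; exact ⟨hp.2, (All.pure S (X := of C) hC).symm⟩)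
      obtain ⟨Γ, Δ, t1, t2, a, b, c, d, e⟩ := m1.focus hd hA
      obtain ⟨Γ', Δ', t1', t2', a', b', c', d', e'⟩ := m2.symm.focus hd' hC
      refine XS.sim ?_ ((e.link e' h1 h2).trans (.link_plus2 _ _ _ _))
      refine XS.mixp ⟨Γ, Γ', t1, t1', a, a', c, c', .refl _⟩ ?_
      exact (MS.right S b d).mixp (.left T b' d')
    · have hmem : A' ⋏ C' ∈ m := by
        have : A' ⋏ C' ∈ (A ⋏ C) ::ₘ m := by rw [← hm]; simp
        exact (Multiset.mem_cons.1 this).resolve_left hAC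
      have hAC2 : A ⋏ C ∈ comps X ∨ A ⋏ C ∈ comps Y := by
        have : A ⋏ C ∈ comps X + (comps Y + {A' ⋏ C'}) := by rw [hm]; simp
        rcases Multiset.mem_add.1 this with h | h
        · exact .inl h
        · rcases Multiset.mem_add.1 h with h | h
          · exact .inr h
          · exact (hAC (Multiset.mem_singleton.1 h).symm).elim
      have hK := hp _ hmem
      rcases hAC2 with h | h
      · obtain ⟨n, hn'⟩ := Multiset.exists_cons_of_mem h
        rw [hn', Multiset.cons_add, Multiset.cons_inj_right] at hm
        rw [← hm, pure_add, pure_add] at hp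
        rcases hK with hK | hK
        · have hK' := Form.all_conj.1 hK
          have x := ih1 S T hd hA hC h1 (n + fc A') (by rw [comps_ten, hn', Multiset.cons_add]; rfl)
            (pure_add.2 ⟨hp.1, All.pure T (X := of A') hK'.1⟩)
          have m2 := hu.splitM S T hd h2 (by rw [comps_ten, pure_add]; exact ⟨hp.2.1, All.pure T (X := of C') hK'.2⟩)
          obtain ⟨Γ', Δ', t1', t2', a', b', c', d', e'⟩ := m2.focus hd hK'.2
          refine XS.sim ?_ (((Sim.refl _).link e' h1 h2).trans (.link_plus' _ _ _))
          exact (x.appS hd hA hC hK'.1 (all_ten (Y := of (A' ⋏ C')) |>.2 ⟨c', hK⟩) _ (Nice.act a' A') h1).mixp (.right S b' d')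
        · have hK' := Form.all_conj.1 hK
          have x := ih1 S T hd hA hC h1 (n + fc A') (by rw [comps_ten, hn', Multiset.cons_add]; rfl)
            (pure_add.2 ⟨hp.1, (All.pure S (X := of A') hK'.1).symm⟩)
          have m2 := hu.splitM S T hd h2 (by rw [comps_ten, pure_add]; exact ⟨hp.2.1, (All.pure S (X := of C') hK'.2).symm⟩)
          obtain ⟨Γ', Δ', t1', t2', a', b', c', d', e'⟩ := m2.symm.focus hd' hK'.2
          refine XS.sim ?_ (((Sim.refl _).link e' h1 h2).trans (.link_plus' _ _ _))
          exact (x.appT hd hA hC hK'.1 (all_ten (Y := of (A' ⋏ C')) |>.2 ⟨c', hK⟩) _ (Nice.act a' A') h1).mixp (.left T b' d')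
      · obtain ⟨n, hn'⟩ := Multiset.exists_cons_of_mem h
        rw [hn', Multiset.cons_add, Multiset.add_cons, Multiset.cons_inj_right] at hm
        rw [← hm, pure_add, pure_add] at hp
        rcases hK with hK | hK
        · have hK' := Form.all_conj.1 hK
          have x := ih2 S T hd hA hC h2 (n + fc C') (by rw [comps_ten, hn', Multiset.cons_add]; rfl)
            (pure_add.2 ⟨hp.2.1, All.pure T (X := of C') hK'.2⟩)
          have m2 := ht.splitM S T hd h1 (by rw [comps_ten, pure_add]; exact ⟨hp.1, All.pure T (X := of A') hK'.1⟩)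
          obtain ⟨Γ', Δ', t1', t2', a', b', c', d', e'⟩ := m2.focus hd hK'.1
          refine XS.sim ?_ ((e'.link (Sim.refl _) h1 h2).trans ((Sim.link_plus _ _ _).trans
            ((Sim.linkR _ _).symm.mixc (.refl _))))
          exact (x.appS hd hA hC hK'.2 (all_ten (Y := of (A' ⋏ C')) |>.2 ⟨c', hK⟩) _ (Nice.act' a' C') h2).mixp (.right S b' d')
        · have hK' := Form.all_conj.1 hK
          have x := ih2 S T hd hA hC h2 (n + fc C') (by rw [comps_ten, hn', Multiset.cons_add]; rfl)
            (pure_add.2 ⟨hp.2.1, (All.pure S (X := of C') hK'.2).symm⟩)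
          have m2 := ht.splitM S T hd h1 (by rw [comps_ten, pure_add]; exact ⟨hp.1, (All.pure S (X := of A') hK'.1).symm⟩)
          obtain ⟨Γ', Δ', t1', t2', a', b', c', d', e'⟩ := m2.symm.focus hd' hK'.1
          refine XS.sim ?_ ((e'.link (Sim.refl _) h1 h2).trans ((Sim.link_plus _ _ _).trans
            ((Sim.linkR _ _).symm.mixc (.refl _))))
          exact (x.appT hd hA hC hK'.2 (all_ten (Y := of (A' ⋏ C')) |>.2 ⟨c', hK⟩) _ (Nice.act' a' C') h2).mixp (.left T b' d')
  | @exch X Y t e ht he ih =>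
    intro S T hd hA hC hn m hm hp
    have s := (Sim.str t he).symm
    exact (ih S T hd hA hC (s.lits ▸ hn) m (s.comps ▸ hm) hp).sim s

end Ob

open CategoryTheory MonoidalCategory

namespace Ob

variable {P : Type}

open Classical in
theorem CF.bal {X : Ob P} {t : un ⟶ X} (ht : CF t) (p : P) :
    (lits X).count (true, p) = (lits X).count (false, p) := by
  induction ht with
  | nil => rfl
  | ax q =>
    change Multiset.count _ ({_} + {_}) = Multiset.count _ ({_} + {_})
    by_cases h : p = q <;> simp [Multiset.count_singleton, h]
  | mix _ _ a b => simp only [lits_ten, Multiset.count_add, a, b]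
  | @tensor X Y A C t u _ _ a b =>
    have e : lits (of (A ⋏ C)) = lits (of A) + lits (of C) := rfl
    simp only [lits_ten, Multiset.count_add] at a b
    simp only [lits_ten, Multiset.count_add, e]
    omega
  | @exch X Y t e _ he a => rwa [← (Sim.str t he).lits]

theorem CF.bal_mem {X : Ob P} {t : un ⟶ X} (ht : CF t) {l : Bool × P} (hl : l ∈ lits X) (b : Bool) :
    (b, l.2) ∈ lits X := by
  classical
  have h := ht.bal l.2
  obtain ⟨c, p⟩ := l
  rw [← Multiset.count_pos] at hl ⊢
  cases b <;> cases c <;> simp only at * <;> omega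

theorem CF.sep {X Y : Ob P} {t : un ⟶ X} {u : un ⟶ Y} (ht : CF t) (hu : CF u) (h : (lits X + lits Y).Nodup) (p : P) :
    (∃ l ∈ lits X, l.2 = p) → (∃ l ∈ lits Y, l.2 = p) → False := by
  rintro ⟨l, hl, rfl⟩ ⟨k, hk, e⟩
  have h1 := ht.bal_mem hl true
  have h2 := hu.bal_mem hk true
  rw [e] at h2
  exact Multiset.disjoint_left.1 (Multiset.nodup_add.1 h).2.2 h1 h2

theorem thin_ax {p : P} {Y : Ob P} {t : un ⟶ Y} (ht : CF t) (h : comps Y = comps (of (.natom p ⋎ .pos p))) :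
    Sim (pt (dPt p)) t := by
  induction ht with
  | nil => exact absurd (comps_nil h.symm) (by simp)
  | ax q =>
    have : Form.natom p ∈ comps (of (Form.natom q ⋎ Form.pos q)) := by
      rw [h]; exact Multiset.mem_add.2 (.inl (Multiset.mem_singleton_self _))
    rcases Multiset.mem_add.1 this with h | h
    · cases Multiset.mem_singleton.1 h; exact .refl _
    · cases Multiset.mem_singleton.1 h
  | @mix X Y t u ht hu ih1 ih2 =>
    have hl : lits X + lits Y = {(false, p)} + {(true, p)} := by
      rw [← lits_ten, lits_bind, h, ← lits_bind]; rfl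
    have key : lits X = 0 ∨ lits Y = 0 := by
      by_contra hc
      push Not at hc
      obtain ⟨l, hl1⟩ := Multiset.exists_mem_of_ne_zero hc.1
      obtain ⟨k, hk1⟩ := Multiset.exists_mem_of_ne_zero hc.2
      have e1 : l.2 = p := by
        have : l ∈ lits X + lits Y := Multiset.mem_add.2 (.inl hl1)
        rw [hl] at this
        rcases Multiset.mem_add.1 this with h | h <;> rw [Multiset.mem_singleton.1 h]
      have e2 : k.2 = p := by
        have : k ∈ lits X + lits Y := Multiset.mem_add.2 (.inr hk1)
        rw [hl] at this
        rcases Multiset.mem_add.1 this with h | h <;> rw [Multiset.mem_singleton.1 h]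
      refine ht.sep hu ?_ p ⟨l, hl1, e1⟩ ⟨k, hk1, e2⟩
      rw [hl]; simp
    rcases key with k | k
    · obtain rfl := lits_nil k
      rw [comps_ten] at h
      exact (ih2 ((zero_add (comps Y)).symm.trans h)).trans (.mix_un t u)
    · obtain rfl := lits_nil k
      rw [comps_ten] at h
      exact (ih1 ((add_zero (comps X)).symm.trans h)).trans ((Sim.mix_un u t).trans (.mix_comm _ _))
  | @tensor X Y A C t u ht hu ih1 ih2 =>
    have : A ⋏ C ∈ comps (of (Form.natom p ⋎ Form.pos p)) := by
      rw [← h, comps_ten, comps_ten]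
      exact Multiset.mem_add.2 (.inr (Multiset.mem_add.2 (.inr (Multiset.mem_singleton_self _))))
    rcases Multiset.mem_add.1 this with h | h <;> cases Multiset.mem_singleton.1 h
  | @exch X Y t e ht he ih => exact (ih (he.comps_eq.trans h)).trans (.str t he)

theorem thin_sim {X : Ob P} {t : un ⟶ X} (ht : CF t) : ∀ {Y : Ob P} {t' : un ⟶ Y}, CF t' → comps X = comps Y →
    (lits X).Nodup → Sim t t' := by
  induction ht with
  | nil =>
    intro Y t' _ h _
    obtain rfl := comps_nil h.symm
    exact .of_eq (Subsingleton.elim _ _)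
  | ax p => intro Y t' ht' h _; exact thin_ax ht' h.symm
  | @mix X1 X2 t u ht hu ih1 ih2 =>
    intro Y t' ht' h hn
    have hn' := hn
    rw [lits_ten] at hn'
    have hY : lits Y = lits (X1 ⊗ X2) := by rw [lits_bind, lits_bind, h]
    obtain ⟨Γ, Δ, t1, t2, a, b, c, d, e⟩ := ht'.splitM (fun p => ∃ l ∈ lits X1, l.2 = p)
      (fun p => ∃ l ∈ lits X2, l.2 = p) (ht.sep hu hn') (hY ▸ hn) (by
        rw [← h, comps_ten, pure_add]
        exact ⟨All.pure _ fun l hl => ⟨l, hl, rfl⟩, (All.pure _ fun l hl => ⟨l, hl, rfl⟩).symm⟩)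
    have hc := h.trans e.comps
    rw [comps_ten, comps_ten] at hc
    have c1 : comps X1 ≤ comps Γ := le_of_split (ht.sep hu hn') (k := comps Δ) (hc ▸ Multiset.le_add_right _ _)
      (all_comps.1 fun l hl => ⟨l, hl, rfl⟩) (fun K hK h => h.absurd (ht.sep hu hn') (all_comps.1 d K hK))
    have c2 : comps X2 ≤ comps Δ := le_of_split (fun p h k => ht.sep hu hn' p k h) (k := comps Γ)
      (by rw [add_comm, ← hc]; exact Multiset.le_add_left _ _)
      (all_comps.1 fun l hl => ⟨l, hl, rfl⟩) (fun K hK h => (all_comps.1 c K hK).absurd (ht.sep hu hn') h)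
    have e1 : comps X1 = comps Γ := by
      refine Multiset.eq_of_le_of_card_le c1 ?_
      have := congrArg Multiset.card hc
      have := Multiset.card_le_card c2
      simp only [Multiset.card_add] at *
      omega
    have e2 : comps X2 = comps Δ := by rw [e1] at hc; exact add_left_cancel hc
    exact ((ih1 a e1 (ndl hn)).mixc (ih2 b e2 (ndr hn))).trans e.symm
  | @tensor X1 X2 A C t u ht hu ih1 ih2 =>
    intro Y t' ht' h hn
    have hn' : (lits (X1 ⊗ of A) + lits (X2 ⊗ of C)).Nodup := by
      have e : lits (X1 ⊗ of A) + lits (X2 ⊗ of C) = lits (X1 ⊗ (X2 ⊗ of (A ⋏ C))) := by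
        have e : lits (of (A ⋏ C)) = lits (of A) + lits (of C) := rfl
        simp only [lits_ten, e]; abel
      rw [e]; exact hn
    have hd := ht.sep hu hn'
    have hY : lits Y = lits (X1 ⊗ (X2 ⊗ of (A ⋏ C))) := by rw [lits_bind, lits_bind, h]
    have a1 : All (fun p => ∃ l ∈ lits (X1 ⊗ of A), l.2 = p) (X1 ⊗ of A) := fun l hl => ⟨l, hl, rfl⟩
    have a2 : All (fun p => ∃ l ∈ lits (X2 ⊗ of C), l.2 = p) (X2 ⊗ of C) := fun l hl => ⟨l, hl, rfl⟩
    rw [all_ten] at a1 a2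
    obtain ⟨Γ, Δ, t1, t2, a, b, c, d, e⟩ := ht'.splitX (A := A) (C := C) _ _ hd a1.2 a2.2 (hY ▸ hn)
        (comps X1 + comps X2) (by
          rw [← h, comps_ten, comps_ten, ← add_assoc, add_comm]; rfl)
        (pure_add.2 ⟨All.pure _ a1.1, (All.pure _ a2.1).symm⟩)
    have hc := h.trans e.comps
    simp only [comps_ten, ← add_assoc] at hc
    have hc := add_right_cancel hc
    have c1 : comps X1 ≤ comps Γ := le_of_split hd (k := comps Δ) (hc ▸ Multiset.le_add_right _ _)
      (all_comps.1 a1.1) (fun K hK h => h.absurd hd (all_comps.1 d K hK))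
    have c2 : comps X2 ≤ comps Δ := le_of_split (fun p h k => hd p k h) (k := comps Γ)
      (by rw [add_comm, ← hc]; exact Multiset.le_add_left _ _)
      (all_comps.1 a2.1) (fun K hK h => (all_comps.1 c K hK).absurd hd h)
    have e1 : comps X1 = comps Γ := by
      refine Multiset.eq_of_le_of_card_le c1 ?_
      have := congrArg Multiset.card hc
      have := Multiset.card_le_card c2
      simp only [Multiset.card_add] at *
      omega
    have e2 : comps X2 = comps Δ := by rw [e1] at hc; exact add_left_cancel hc
    refine Sim.trans (Sim.link (ih1 a ?_ (nd1 hn)) (ih2 b ?_ (nd2 hn)) (nd1 hn) (nd2 hn)) e.symm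
    · rw [comps_ten, comps_ten, e1]
    · rw [comps_ten, comps_ten, e2]
  | @exch X X' t e ht he ih =>
    intro Y t' ht' h hn
    have s := Sim.str t he
    exact s.symm.trans (ih ht' (he.comps_eq.trans h) (by rw [s.lits]; exact hn))

theorem thin {X : Ob P} {t t' : un ⟶ X} (ht : CF t) (ht' : CF t') (hn : (lits X).Nodup) : t = t' :=
  (thin_sim ht ht' rfl hn).eq hn

end Ob

open CategoryTheory MonoidalCategory

section Copoints

variable {P : Type} {A B C D E F : Form P}

/-- A copoint of `E`: a virtual arrow from `E` to the (absent) unit of disjunction. -/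
structure Copt (E : Form P) where
  app : ∀ X : Form P, (E ⋎ X) ⟶ X
  nat : ∀ {X Y : Form P} (f : X ⟶ Y), app X ≫ f = dj (𝟙 E) f ≫ app Y
  bl : ∀ X Y : Form P, oF E X Y ≫ app (X ⋎ Y) = dj (app X) (𝟙 Y)
  dlaw : ∀ X Y : Form P, dd X Y E ≫ co _ _ ≫ app (X ⋏ Y) = cj (𝟙 X) (co _ _ ≫ app Y)

/-- Precomposition of a copoint. -/
def Copt.map (e : Copt E) (f : F ⟶ E) : Copt F where
  app X := dj f (𝟙 X) ≫ e.app X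
  nat g := by
    rw [Category.assoc, e.nat, dj_dj_assoc, dj_dj_assoc]; simp
  bl X Y := by
    rw [← Category.assoc, ← dj_id X Y, oF_nat, Category.assoc, e.bl, dj_dj, Category.id_comp]
  dlaw X Y := by
    rw [← Category.assoc (co _ _), co_nat, Category.assoc, ← cj_id X Y, ← Category.assoc (dd _ _ _), dd_nat,
      Category.assoc, e.dlaw, cj_cj, Category.id_comp, ← Category.assoc, ← co_nat, Category.assoc]

theorem Copt.map_app (e : Copt E) (f : F ⟶ E) (X : Form P) : (e.map f).app X = dj f (𝟙 X) ≫ e.app X := rfl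

theorem Copt.dlaw' (e : Copt E) (X Y : Form P) : dr E X Y ≫ e.app (X ⋏ Y) = cj (e.app X) (𝟙 Y) := by
  rw [dr_def]
  simp only [Category.assoc]
  rw [← Category.assoc (dj _ _), ← co_nat, Category.assoc, ← e.nat, ← Category.assoc (co _ _),
    ← Category.assoc (dd _ _ _), e.dlaw, cj_cj_assoc, co_co_assoc, Category.id_comp, ← ca_nat, ca_ca_assoc]

theorem Copt.slide (e : Copt E) (X Y : Form P) :
    oT X E Y ≫ dj (co X E ≫ e.app X) (𝟙 Y) = dj (𝟙 X) (e.app Y) := by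
  have h : oT X E Y ≫ dj (co X E) (𝟙 Y) ≫ oF E X Y = co X (E ⋎ Y) ≫ oF E Y X ≫ dj (𝟙 E) (co Y X) := by
    have h := o_hex1 X E Y
    have h2 : co X (E ⋎ Y) ≫ oF E Y X = oT X E Y ≫ dj (co X E) (𝟙 Y) ≫ oF E X Y ≫ dj (𝟙 E) (co X Y) := by
      rw [← h, oT_oF_assoc]
    rw [← Category.assoc (co _ _), h2]
    simp only [Category.assoc]
    rw [dj_inv _ _ (co_co X Y), Category.comp_id]
  rw [dj_comp_one, ← e.bl, ← Category.assoc (dj _ _), ← Category.assoc, h]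
  simp only [Category.assoc]
  rw [← e.nat, ← Category.assoc (oF _ _ _), e.bl, ← co_nat, co_co_assoc]

/-- The basic copoint. -/
def sC (p : P) : Copt (Form.pos p ⋏ Form.natom p) where
  app X := sg p X
  nat f := sg_nat p f
  bl X Y := oF_sg p X Y
  dlaw X Y := dd_sg p X Y

/-- Linear duality data. -/
structure LD (A A' : Form P) where
  δ : Pt (A' ⋎ A)
  ε : Copt (A ⋏ A')
  cf : Ob.CF (Ob.pt δ)
  tri : δ.app A ≫ dd A A' A ≫ ε.app A = 𝟙 A

theorem Ob.CF.pmap {t : Pt A} (h : Ob.CF (Ob.pt t)) (f : A ⟶ B) : Ob.CF (Ob.pt (t.map f)) :=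
  (Ob.Nice.all f).cf h

/-- positive literals -/
def LD.pos (p : P) : LD (Form.pos p) (Form.natom p) where
  δ := dPt p
  ε := sC p
  cf := .ax p
  tri := dl_sg p

/-- negative literals -/
def LD.neg (p : P) : LD (Form.natom p) (Form.pos p) where
  δ := (dPt p).map (co _ _)
  ε := (sC p).map (ca _ _)
  cf := Ob.CF.pmap (.ax p) _
  tri := by
    rw [Pt.map_app, Copt.map_app, Category.assoc]; exact dl_sg' p

theorem conj_aux {B' : Form P} (δ : Pt (B' ⋎ B)) (ε : Copt (B ⋏ B'))
    (tri : δ.app B ≫ dd B B' B ≫ ε.app B = 𝟙 B) :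
    ca A B ≫ cj (𝟙 B) (δ.app A ≫ xx A B' B) ≫ dd B B' (A ⋏ B) ≫ ε.app (A ⋏ B) = 𝟙 _ := by
  have hx : xx A B' B = ca _ _ ≫ dr B' B A ≫ dj (𝟙 _) (ca B A) := by
    rw [dr_xx]; simp only [Category.assoc]
    rw [ca_ca_assoc, dj_inv _ _ (ca_ca _ _), Category.comp_id]
  have h1 : cj (𝟙 B) (xx A B' B) ≫ dd B B' (A ⋏ B) =
      cj (𝟙 B) (ca _ _) ≫ aT _ _ _ ≫ cj (dd B B' B) (𝟙 A) ≫ dr (B ⋏ B') B A ≫ dj (𝟙 _) (ca _ _) := by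
    rw [← Category.assoc (cj (dd _ _ _) _), dd_dr_aF]
    simp only [Category.assoc]
    rw [aT_aF_assoc, hx, cj_one_comp, cj_one_comp]
    simp only [Category.assoc]
    rw [← dd_nat, cj_id]
  rw [cj_one_comp, Category.assoc, ← Category.assoc (cj _ (xx _ _ _)), h1, ← δ.slide B A]
  simp only [Category.assoc]
  rw [← Category.assoc (cj _ (ca _ _)) (cj _ (ca _ _)), cj_inv _ _ (ca_ca _ _), Category.id_comp,
    aF_aT_assoc, ← ε.nat, ← Category.assoc (dr _ _ _), ε.dlaw', cj_cj_assoc, cj_cj_assoc]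
  simp only [Category.assoc, Category.id_comp, tri, cj_id, ca_ca]

/-- conjunction -/
def LD.conj {A' B' : Form P} (u : LD A A') (v : LD B B') : LD (A ⋏ B) (A' ⋎ B') where
  δ := u.δ.map (dj (𝟙 A') (v.δ.app A ≫ xx A B' B) ≫ oT A' B' (A ⋏ B))
  ε := v.ε.map (cj (ca A B) (𝟙 _) ≫ aF B A _ ≫ cj (𝟙 B) (dd A A' B' ≫ u.ε.app B'))
  cf := u.cf.pmap _
  tri := by
    rw [Pt.map_app, Copt.map_app]
    obtain ⟨α, hα⟩ : ∃ α, α = v.δ.app A ≫ xx A B' B := ⟨_, rfl⟩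
    have h := conj_aux (A := A) v.δ v.ε v.tri
    rw [← hα] at h ⊢
    have e1 : dd (A ⋏ B) (A' ⋎ B') (A ⋏ B) ≫
        dj (cj (ca A B) (𝟙 _) ≫ aF B A _ ≫ cj (𝟙 B) (dd A A' B' ≫ u.ε.app B')) (𝟙 (A ⋏ B)) =
        cj (ca A B) (𝟙 _) ≫ aF B A _ ≫ cj (𝟙 B) (cj (𝟙 A) (oF A' B' (A ⋏ B)) ≫ dd A A' _ ≫ u.ε.app _) ≫
          dd B B' (A ⋏ B) := by
      rw [dj_comp_one, dj_comp_one, ← Category.assoc (dd _ _ _), dd_nat, dj_id, Category.assoc]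
      congr 1
      rw [← Category.assoc (dd _ _ _), dd_aF]
      simp only [Category.assoc]
      congr 1
      rw [dd_nat, cj_cj_assoc, ← Category.assoc (cj (𝟙 A) (oF _ _ _)), dd_oF]
      simp only [Category.assoc]
      rw [u.ε.bl, dj_dj, Category.id_comp, Category.id_comp]
    rw [Category.assoc, ← Category.assoc (dd _ _ _), e1]
    refine Eq.trans ?_ h
    obtain ⟨w, hw⟩ : ∃ w, w = dd B B' (A ⋏ B) ≫ v.ε.app (A ⋏ B) := ⟨_, rfl⟩
    simp only [Category.assoc]
    rw [← hw]
    trans (u.δ.app (A ⋏ B) ≫ cj (ca A B) (𝟙 _) ≫ aF B A _) ≫ cj (𝟙 B) (cj (𝟙 A) (dj (𝟙 A') α) ≫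
      dd A A' _ ≫ u.ε.app _) ≫ w
    · simp only [Category.assoc]
      congr 1
      have e3 : cj (𝟙 A) (dj (𝟙 A') α) = cj (𝟙 A) (dj (𝟙 A') α ≫ oT A' B' (A ⋏ B)) ≫ cj (𝟙 A) (oF _ _ _) := by
        rw [cj_cj, Category.assoc, oT_oF, Category.comp_id, Category.comp_id]
      rw [e3, cj_cj_assoc, Category.id_comp, Category.comp_id, Category.assoc, cj_one_comp B (cj _ _) (cj _ _ ≫ _),
        Category.assoc, ← Category.assoc (aF _ _ (A' ⋎ A)), aF_nat, cj_id, Category.assoc, cj_cj_assoc, Category.id_comp,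
        Category.comp_id]
    · rw [← Category.assoc (u.δ.app _), ← u.δ.nat, Category.assoc, Category.assoc, ← Category.assoc (u.δ.app _), u.δ.bl, cj_cj_assoc, Category.id_comp]
      congr 2
      rw [← Category.assoc (cj _ _), ← dd_nat, Category.assoc, cj_id, ← u.ε.nat]
      have := u.tri
      simp only [← Category.assoc] at this ⊢
      rw [this, Category.id_comp]

/-- disjunction -/
def LD.disj {A' B' : Form P} (u : LD A A') (v : LD B B') : LD (B ⋎ A) (A' ⋏ B') where
  δ := u.δ.map (dj (v.δ.app A' ≫ dd A' B' B) (𝟙 A) ≫ oF _ B A)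
  ε := v.ε.map (aT _ A' B' ≫ cj (dr B A A' ≫ co _ _ ≫ u.ε.app B) (𝟙 B'))
  cf := u.cf.pmap _
  tri := by
    rw [Pt.map_app, Copt.map_app]
    obtain ⟨D, hD⟩ : ∃ D, D = B ⋎ A := ⟨_, rfl⟩
    obtain ⟨ψ, hψ⟩ : ∃ ψ, ψ = dr B A A' ≫ co _ _ ≫ u.ε.app B := ⟨_, rfl⟩
    rw [← hψ]
    obtain ⟨φ, hφ⟩ : ∃ φ, φ = aT (B ⋎ A) A' B' ≫ cj ψ (𝟙 B') := ⟨_, rfl⟩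
    obtain ⟨β, hβ⟩ : ∃ β, β = v.δ.app A' ≫ dd A' B' B := ⟨_, rfl⟩
    rw [← hφ, ← hβ]
    have e1 : cj (𝟙 (B ⋎ A)) β ≫ dd (B ⋎ A) _ B ≫ dj φ (𝟙 B) ≫ v.ε.app B = ψ := by
      have h := dd_aF (B ⋎ A) A' B' B
      have h' : cj (𝟙 (B ⋎ A)) (dd A' B' B) ≫ dd (B ⋎ A) _ B =
          aT _ _ _ ≫ dd (_ ⋏ _) B' B ≫ dj (aF _ _ _) (𝟙 _) := by rw [h, aT_aF_assoc]
      rw [hβ, hφ, cj_one_comp, dj_comp_one, Category.assoc, ← Category.assoc (cj _ (dd _ _ _)), h', ← v.δ.bl]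
      simp only [Category.assoc]
      rw [dj_dj_assoc, aF_aT, aF_aT_assoc, Category.id_comp, dj_id, Category.id_comp, ← Category.assoc (dd _ _ _),
        dd_nat, dj_id, Category.assoc, ← Category.assoc, ← v.δ.nat, Category.assoc, v.tri, Category.comp_id]
    have e2 : cj (𝟙 (B ⋎ A)) (oF _ B A) ≫ dd (B ⋎ A) _ (B ⋎ A) ≫ dj φ (𝟙 _) ≫ v.ε.app (B ⋎ A) =
        dd (B ⋎ A) _ A ≫ dj (dd (B ⋎ A) (A' ⋏ B') B ≫ dj φ (𝟙 B) ≫ v.ε.app B) (𝟙 A) := by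
      rw [← Category.assoc, dd_oF]
      simp only [Category.assoc]
      rw [← dj_id B A, ← Category.assoc (oF _ _ _), oF_nat, Category.assoc, v.ε.bl, dj_dj, dj_dj]
      simp only [Category.comp_id]
    rw [cj_one_comp]
    simp only [Category.assoc]
    rw [e2, ← Category.assoc (cj _ _), ← dd_nat, Category.assoc, dj_dj, Category.id_comp, e1, hψ, dj_comp_one]
    have h3 := dd_dr_oF B A A' A
    have h4 : dd (B ⋎ A) A' A ≫ dj (dr B A A') (𝟙 A) = dr B A (A' ⋎ A) ≫ dj (𝟙 B) (dd A A' A) ≫ oT _ _ _ := by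
      rw [← Category.assoc (dr _ _ _), h3]
      simp only [Category.assoc]
      rw [oF_oT, Category.comp_id]
    rw [← Category.assoc (dd _ _ _), h4]
    simp only [Category.assoc]
    rw [u.ε.slide, ← Category.assoc, u.δ.dlaw', dj_dj, dj_dj, u.tri]
    simp [dj_id]

/-- Dual formula. -/
def Form.dual : Form P → Form P
  | .pos p => .natom p
  | .natom p => .pos p
  | A ⋏ B => A.dual ⋎ B.dual
  | A ⋎ B => B.dual ⋏ A.dual

def LD.all : ∀ A : Form P, LD A A.dual
  | .pos p => .pos p
  | .natom p => .neg p
  | .conj A B => .conj (LD.all A) (LD.all B)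
  | .disj B A => .disj (LD.all A) (LD.all B)

theorem LD.inj {A' : Form P} (u : LD A A') {f g : A ⟶ B} (h : u.δ.map (dj (𝟙 A') f) = u.δ.map (dj (𝟙 A') g)) :
    f = g := by
  have key : ∀ f : A ⟶ B, f = (u.δ.map (dj (𝟙 A') f)).app A ≫ dd A A' B ≫ u.ε.app B := by
    intro f
    rw [Pt.map_app, Category.assoc, ← Category.assoc (cj _ _), ← dd_nat, Category.assoc, cj_id, ← u.ε.nat]
    have := u.tri
    simp only [← Category.assoc] at this ⊢
    rw [this, Category.id_comp]
  rw [key f, h, ← key]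

theorem MPN_thin (f g : A ⟶ B) (h : (A.dual.lits + B.lits).Nodup) : f = g :=
  (LD.all A).inj (Ob.thin ((LD.all A).cf.pmap _) ((LD.all A).cf.pmap _) h)

end Copoints

section Relabel

/-- Renaming of letters. -/
def Form.map {P Q : Type} (φ : P → Q) : Form P → Form Q
  | .pos p => .pos (φ p)
  | .natom p => .natom (φ p)
  | .conj A B => .conj (A.map φ) (B.map φ)
  | .disj A B => .disj (A.map φ) (B.map φ)

/-- Renaming of letters in arrow terms. -/
def Term.map {P Q : Type} (φ : P → Q) : ∀ {A B : Form P}, Term P A B → Term Q (A.map φ) (B.map φ)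
  | _, _, .id A => .id (A.map φ)
  | _, _, .comp g f => .comp (g.map φ) (f.map φ)
  | _, _, .conj f g => .conj (f.map φ) (g.map φ)
  | _, _, .disj f g => .disj (f.map φ) (g.map φ)
  | _, _, .bConjTo A B C => .bConjTo (A.map φ) (B.map φ) (C.map φ)
  | _, _, .bConjFrom A B C => .bConjFrom (A.map φ) (B.map φ) (C.map φ)
  | _, _, .bDisjTo A B C => .bDisjTo (A.map φ) (B.map φ) (C.map φ)
  | _, _, .bDisjFrom A B C => .bDisjFrom (A.map φ) (B.map φ) (C.map φ)
  | _, _, .cConj A B => .cConj (A.map φ) (B.map φ)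
  | _, _, .cDisj A B => .cDisj (A.map φ) (B.map φ)
  | _, _, .d A B C => .d (A.map φ) (B.map φ) (C.map φ)
  | _, _, .delta p A => .delta (φ p) (A.map φ)
  | _, _, .sigma p A => .sigma (φ p) (A.map φ)
  | _, _, .mix A B => .mix (A.map φ) (B.map φ)

theorem Eqv.map {P Q : Type} (φ : P → Q) {A B : Form P} {f g : Term P A B} (h : Eqv f g) :
    Eqv (f.map φ) (g.map φ) := by
  induction h with
  | refl _ => exact .refl _
  | symm _ ih => exact .symm ih
  | trans _ _ ih1 ih2 => exact .trans ih1 ih2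
  | congComp _ _ ih1 ih2 => exact .congComp ih1 ih2
  | congConj _ _ ih1 ih2 => exact .congConj ih1 ih2
  | congDisj _ _ ih1 ih2 => exact .congDisj ih1 ih2
  | catIdR _ => exact .catIdR _
  | catIdL _ => exact .catIdL _
  | catAssoc _ _ _ => exact .catAssoc _ _ _
  | conjOne _ _ => exact .conjOne _ _
  | disjOne _ _ => exact .disjOne _ _
  | conjTwo _ _ _ _ => exact .conjTwo _ _ _ _
  | disjTwo _ _ _ _ => exact .disjTwo _ _ _ _
  | bConjNat _ _ _ => exact .bConjNat _ _ _
  | bDisjNat _ _ _ => exact .bDisjNat _ _ _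
  | cConjNat _ _ => exact .cConjNat _ _
  | cDisjNat _ _ => exact .cDisjNat _ _
  | dNat _ _ _ => exact .dNat _ _ _
  | bConjIso₁ _ _ _ => exact .bConjIso₁ _ _ _
  | bConjIso₂ _ _ _ => exact .bConjIso₂ _ _ _
  | bDisjIso₁ _ _ _ => exact .bDisjIso₁ _ _ _
  | bDisjIso₂ _ _ _ => exact .bDisjIso₂ _ _ _
  | bConjPent _ _ _ _ => exact .bConjPent _ _ _ _
  | bDisjPent _ _ _ _ => exact .bDisjPent _ _ _ _
  | cConjIso _ _ => exact .cConjIso _ _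
  | cDisjIso _ _ => exact .cDisjIso _ _
  | bcConj _ _ _ => exact .bcConj _ _ _
  | bcDisj _ _ _ => exact .bcDisj _ _ _
  | dConj _ _ _ _ => exact .dConj _ _ _ _
  | dDisj _ _ _ _ => exact .dDisj _ _ _ _
  | dBConj _ _ _ _ => exact .dBConj _ _ _ _
  | dBDisj _ _ _ _ => exact .dBDisj _ _ _ _
  | deltaNat _ _ => exact .deltaNat _ _
  | sigmaNat _ _ => exact .sigmaNat _ _
  | bDelta _ _ _ => exact .bDelta _ _ _
  | bSigma _ _ _ => exact .bSigma _ _ _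
  | dSigmaConj _ _ _ => exact .dSigmaConj _ _ _
  | dDeltaDisj _ _ _ => exact .dDeltaDisj _ _ _
  | sigmaDelta _ => exact .sigmaDelta _
  | sigmaDelta' _ => exact .sigmaDelta' _
  | mixNat _ _ => exact .mixNat _ _
  | mixBConj _ _ _ => exact .mixBConj _ _ _
  | mixBDisj _ _ _ => exact .mixBDisj _ _ _
  | mixC _ _ => exact .mixC _ _

variable {P L : Type}

/-- Labelling of the letter occurrences. -/
def Form.lab : Form P → (ℕ → L) → Form (P × L)
  | .pos p, a => .pos (p, a 0)
  | .natom p, a => .natom (p, a 0)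
  | .conj A B, a => .conj (A.lab a) (B.lab fun i => a (A.size + i))
  | .disj A B, a => .disj (A.lab a) (B.lab fun i => a (A.size + i))

theorem Form.lab_map (A : Form P) (a : ℕ → L) : (A.lab a).map Prod.fst = A := by
  induction A generalizing a with
  | pos p => rfl
  | natom p => rfl
  | conj A B ih1 ih2 => simp only [Form.lab, Form.map, ih1, ih2]
  | disj A B ih1 ih2 => simp only [Form.lab, Form.map, ih1, ih2]

theorem Form.lab_congr (A : Form P) {a b : ℕ → L} (h : ∀ i < A.size, a i = b i) : A.lab a = A.lab b := by
  induction A generalizing a b with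
  | pos p => simp only [Form.lab]; rw [h 0 Nat.one_pos]
  | natom p => simp only [Form.lab]; rw [h 0 Nat.one_pos]
  | conj A B ih1 ih2 =>
    simp only [Form.size] at h
    simp only [Form.lab]
    rw [ih1 fun i hi => h i (by omega), ih2 fun i hi => h _ (by omega)]
  | disj A B ih1 ih2 =>
    simp only [Form.size] at h
    simp only [Form.lab]
    rw [ih1 fun i hi => h i (by omega), ih2 fun i hi => h _ (by omega)]

/-- An arrow term has a labelled version. -/
def Lifts {A B : Form P} (f : Term P A B) (X Y : Form (P × L)) : Prop :=
  ∃ f' : Term (P × L) X Y, HEq (f'.map Prod.fst) f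

theorem heq_comp {A B C A' B' C' : Form P} (hA : A = A') (hB : B = B') (hC : C = C')
    {f : Term P A B} {f' : Term P A' B'} {g : Term P B C} {g' : Term P B' C'} (hf : HEq f f') (hg : HEq g g') :
    HEq (g ⬝ f) (g' ⬝ f') := by
  subst hA hB hC; cases hf; cases hg; rfl

theorem heq_conj {A B C D A' B' C' D' : Form P} (hA : A = A') (hB : B = B') (hC : C = C') (hD : D = D')
    {f : Term P A B} {f' : Term P A' B'} {g : Term P C D} {g' : Term P C' D'} (hf : HEq f f') (hg : HEq g g') :
    HEq (f ⊼ g) (f' ⊼ g') := by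
  subst hA hB hC hD; cases hf; cases hg; rfl

theorem heq_disj {A B C D A' B' C' D' : Form P} (hA : A = A') (hB : B = B') (hC : C = C') (hD : D = D')
    {f : Term P A B} {f' : Term P A' B'} {g : Term P C D} {g' : Term P C' D'} (hf : HEq f f') (hg : HEq g g') :
    HEq (f ⊽ g) (f' ⊽ g') := by
  subst hA hB hC hD; cases hf; cases hg; rfl

theorem heq_eqv {A B A' B' : Form P} (hA : A = A') (hB : B = B')
    {f g : Term P A B} {f' g' : Term P A' B'} (hf : HEq f f') (hg : HEq g g') (h : Eqv f g) : Eqv f' g' := by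
  subst hA hB; cases hf; cases hg; exact h

theorem tg_symm {α : Type} {r : α → α → Prop} (hs : ∀ x y, r x y → r y x) {x y : α}
    (h : Relation.TransGen r x y) : Relation.TransGen r y x := by
  induction h with
  | single h => exact .single (hs _ _ h)
  | tail _ h ih => exact .head (hs _ _ h) ih

/-- One step in the glued graph. -/
def gStep (Pr R : GRel) : ℕ ⊕ ℕ ⊕ ℕ → ℕ ⊕ ℕ ⊕ ℕ → Prop := fun x y =>
      (∃ x' y', Sum.map id Sum.inl x' = x ∧ Sum.map id Sum.inl y' = y ∧ R x' y') ∨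
      (∃ x' y', Sum.inr x' = x ∧ Sum.inr y' = y ∧ Pr x' y')

theorem gStep_symm {Pr R : GRel} (hP : ∀ u v, Pr u v → Pr v u) (hR : ∀ u v, R u v → R v u) (x y : ℕ ⊕ ℕ ⊕ ℕ)
    (h : gStep Pr R x y) : gStep Pr R y x := by
  rcases h with ⟨x', y', hx, hy, h⟩ | ⟨x', y', hx, hy, h⟩
  · exact .inl ⟨y', x', hy, hx, hR _ _ h⟩
  · exact .inr ⟨y', x', hy, hx, hP _ _ h⟩

theorem gComp_iff {Pr R : GRel} {u v : ℕ ⊕ ℕ} : gComp Pr R u v ↔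
    Relation.TransGen (gStep Pr R) (Sum.map id Sum.inr u) (Sum.map id Sum.inr v) := Iff.rfl

theorem G_symm {A B : Form P} (f : Term P A B) : ∀ u v, Term.G f u v → Term.G f v u := by
  have hfun : ∀ m φ u v, gFun m φ u v → gFun m φ v u := by
    rintro m φ u v ⟨i, hi, hu, hv⟩; exact ⟨i, hi, hv, hu⟩
  have hid : ∀ m u v, gId m u v → gId m v u := by
    rintro m u v ⟨i, hi, hu, hv⟩; exact ⟨i, hi, hv, hu⟩
  have hpar : ∀ m n (R S : GRel), (∀ u v, R u v → R v u) → (∀ u v, S u v → S v u) →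
      ∀ u v, gPar m n R S u v → gPar m n R S v u := by
    rintro m n R S hR hS u v (h | ⟨u', v', h, hu, hv⟩)
    · exact .inl (hR _ _ h)
    · exact .inr ⟨v', u', hS _ _ h, hv, hu⟩
  induction f with
  | id A => exact hid _
  | comp g f ihg ihf =>
    intro u v h
    exact tg_symm (gStep_symm ihg ihf) h
  | conj f g ihf ihg => exact hpar _ _ _ _ ihf ihg
  | disj f g ihf ihg => exact hpar _ _ _ _ ihf ihg
  | bConjTo => exact hid _
  | bConjFrom => exact hid _
  | bDisjTo => exact hid _
  | bDisjFrom => exact hid _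
  | cConj => exact hfun _ _
  | cDisj => exact hfun _ _
  | d => exact hid _
  | delta p A =>
    rintro u v (⟨i, hi, hu, hv⟩ | ⟨i, hi, hu, hv⟩)
    · exact .inl ⟨i, hi, hv, hu⟩
    · exact .inr ⟨i, hi, hv, hu⟩
  | sigma p A =>
    rintro u v (⟨i, hi, hu, hv⟩ | ⟨i, hi, hu, hv⟩)
    · exact .inl ⟨i, hi, hv, hu⟩
    · exact .inr ⟨i, hi, hv, hu⟩
  | mix => exact hid _

end Relabel

section Lift

variable {P L : Type}

theorem lift_mid [Inhabited L] {R S : GRel} (hR : ∀ u v, R u v → R v u) (hS : ∀ u v, S u v → S v u) {a b : ℕ → L}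
    (h : ∀ u v, gComp S R u v → Sum.elim a b u = Sum.elim a b v) :
    ∃ c : ℕ → L, (∀ u v, R u v → Sum.elim a c u = Sum.elim a c v) ∧
      (∀ u v, S u v → Sum.elim c b u = Sum.elim c b v) := by
  classical
  let T := Relation.TransGen (gStep S R)
  have ts : ∀ {x y}, T x y → T y x := fun k => tg_symm (gStep_symm hS hR) k
  let lb : ℕ ⊕ ℕ ⊕ ℕ → L := fun x => match x with
    | .inl i => a i
    | .inr (.inr k) => b k
    | .inr (.inl j) => if k : ∃ u : ℕ ⊕ ℕ, T (Sum.map id Sum.inr u) (.inr (.inl j)) then Sum.elim a b k.choose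
        else default
  have hlb : ∀ u, lb (Sum.map id Sum.inr u) = Sum.elim a b u := by rintro (i | i) <;> rfl
  have key1 : ∀ u y, T (Sum.map id Sum.inr u) y → lb y = Sum.elim a b u := by
    rintro u (i | j | k) hu
    · exact (h u (.inl i) hu).symm
    · have k : ∃ u : ℕ ⊕ ℕ, T (Sum.map id Sum.inr u) (.inr (.inl j)) := ⟨u, hu⟩
      simp only [lb, dif_pos k]
      exact h _ _ (k.choose_spec.trans (ts hu))
    · exact (h u (.inr k) hu).symm
  have key : ∀ x y, T x y → lb x = lb y := by
    intro x y hxy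
    by_cases k : ∃ u : ℕ ⊕ ℕ, T (Sum.map id Sum.inr u) x
    · obtain ⟨u, hu⟩ := k
      rw [key1 u x hu, key1 u y (hu.trans hxy)]
    · have k' : ¬ ∃ u : ℕ ⊕ ℕ, T (Sum.map id Sum.inr u) y := fun ⟨u, hu⟩ => k ⟨u, hu.trans (ts hxy)⟩
      rcases x with i | j | i
      · exact (k ⟨.inl i, hxy.trans (ts hxy)⟩).elim
      · rcases y with i' | j' | i'
        · exact (k' ⟨.inl i', (ts hxy).trans hxy⟩).elim
        · simp only [lb, dif_neg k, dif_neg k']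
        · exact (k' ⟨.inr i', (ts hxy).trans hxy⟩).elim
      · exact (k ⟨.inr i, hxy.trans (ts hxy)⟩).elim
  refine ⟨fun j => lb (.inr (.inl j)), fun u v huv => ?_, fun u v huv => ?_⟩
  · have := key _ _ (.single (.inl ⟨u, v, rfl, rfl, huv⟩))
    rcases u with u | u <;> rcases v with v | v <;> exact this
  · have := key _ _ (.single (.inr ⟨u, v, rfl, rfl, huv⟩))
    rcases u with u | u <;> rcases v with v | v <;> exact this

theorem par_lab {m n : ℕ} {R S : GRel} {a b : ℕ → L}
    (h : ∀ u v, gPar m n R S u v → Sum.elim a b u = Sum.elim a b v) :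
    (∀ u v, R u v → Sum.elim a b u = Sum.elim a b v) ∧
    (∀ u v, S u v → Sum.elim (fun i => a (m + i)) (fun i => b (n + i)) u =
      Sum.elim (fun i => a (m + i)) (fun i => b (n + i)) v) := by
  refine ⟨fun u v k => h u v (.inl k), fun u v k => ?_⟩
  have := h _ _ (.inr ⟨u, v, k, rfl, rfl⟩)
  rcases u with u | u <;> rcases v with v | v <;>
    simpa only [Sum.map_inl, Sum.map_inr, Sum.elim_inl, Sum.elim_inr, Nat.add_comm] using this

theorem id_lab {n : ℕ} {a b : ℕ → L} (h : ∀ u v, gId n u v → Sum.elim a b u = Sum.elim a b v) :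
    ∀ i < n, a i = b i := fun i hi => h (.inl i) (.inr i) ⟨i, hi, .inl rfl, .inr rfl⟩

theorem swap_lab {m n : ℕ} {a b : ℕ → L} (h : ∀ u v, gSwap m n u v → Sum.elim a b u = Sum.elim a b v) :
    (∀ i < m, a i = b (n + i)) ∧ (∀ i < n, a (m + i) = b i) := by
  constructor
  · intro i hi
    refine h (.inl i) (.inr (n + i)) ⟨i, by omega, .inl rfl, .inr ?_⟩
    simp only [if_pos hi, Nat.add_comm]
  · intro i hi
    refine h (.inl (m + i)) (.inr i) ⟨m + i, by omega, .inl rfl, .inr ?_⟩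
    dsimp only
    rw [if_neg (by omega), Nat.add_sub_cancel_left]

theorem heq_prim1 {F K : Form P → Form P} (t : ∀ A, Term P (F A) (K A)) {A A' : Form P} (hA : A = A') :
    HEq (t A) (t A') := by subst hA; rfl

theorem heq_prim2 {F K : Form P → Form P → Form P} (t : ∀ A B, Term P (F A B) (K A B)) {A A' B B' : Form P}
    (hA : A = A') (hB : B = B') : HEq (t A B) (t A' B') := by subst hA hB; rfl

theorem heq_prim3 {F K : Form P → Form P → Form P → Form P} (t : ∀ A B C, Term P (F A B C) (K A B C))
    {A A' B B' C C' : Form P} (hA : A = A') (hB : B = B') (hC : C = C') : HEq (t A B C) (t A' B' C') := by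
  subst hA hB hC; rfl

theorem lift [Inhabited L] {A B : Form P} (f : Term P A B) : ∀ (a b : ℕ → L),
    (∀ u v, Term.G f u v → Sum.elim a b u = Sum.elim a b v) → Lifts f (A.lab a) (B.lab b) := by
  induction f with
  | id A =>
    intro a b h
    rw [A.lab_congr (id_lab h)]
    exact ⟨.id _, by simp only [Term.map]; rw [Form.lab_map]⟩
  | comp g f ihg ihf =>
    intro a b h
    obtain ⟨c, h1, h2⟩ := lift_mid (G_symm f) (G_symm g) h
    obtain ⟨f', hf⟩ := ihf a c h1
    obtain ⟨g', hg⟩ := ihg c b h2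
    exact ⟨g' ⬝ f', heq_comp (Form.lab_map _ _) (Form.lab_map _ _) (Form.lab_map _ _) hf hg⟩
  | conj f g ihf ihg =>
    intro a b h
    obtain ⟨h1, h2⟩ := par_lab h
    obtain ⟨f', hf⟩ := ihf _ _ h1
    obtain ⟨g', hg⟩ := ihg _ _ h2
    exact ⟨f' ⊼ g', heq_conj (Form.lab_map _ _) (Form.lab_map _ _) (Form.lab_map _ _) (Form.lab_map _ _) hf hg⟩
  | disj f g ihf ihg =>
    intro a b h
    obtain ⟨h1, h2⟩ := par_lab h
    obtain ⟨f', hf⟩ := ihf _ _ h1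
    obtain ⟨g', hg⟩ := ihg _ _ h2
    exact ⟨f' ⊽ g', heq_disj (Form.lab_map _ _) (Form.lab_map _ _) (Form.lab_map _ _) (Form.lab_map _ _) hf hg⟩
  | bConjTo A B C =>
    intro a b h
    rw [Form.lab_congr (a := a) (b := b) (A ⋏ (B ⋏ C)) (id_lab h)]
    simp only [Form.lab, Form.size, Nat.add_assoc]
    exact ⟨.bConjTo _ _ _, heq_prim3 Term.bConjTo (Form.lab_map _ _) (Form.lab_map _ _) (Form.lab_map _ _)⟩
  | bConjFrom A B C =>
    intro a b h
    rw [Form.lab_congr (a := a) (b := b) ((A ⋏ B) ⋏ C) (id_lab h)]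
    simp only [Form.lab, Form.size, Nat.add_assoc]
    exact ⟨.bConjFrom _ _ _, heq_prim3 Term.bConjFrom (Form.lab_map _ _) (Form.lab_map _ _) (Form.lab_map _ _)⟩
  | bDisjTo A B C =>
    intro a b h
    rw [Form.lab_congr (a := a) (b := b) (A ⋎ (B ⋎ C)) (id_lab h)]
    simp only [Form.lab, Form.size, Nat.add_assoc]
    exact ⟨.bDisjTo _ _ _, heq_prim3 Term.bDisjTo (Form.lab_map _ _) (Form.lab_map _ _) (Form.lab_map _ _)⟩
  | bDisjFrom A B C =>
    intro a b h
    rw [Form.lab_congr (a := a) (b := b) ((A ⋎ B) ⋎ C) (id_lab h)]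
    simp only [Form.lab, Form.size, Nat.add_assoc]
    exact ⟨.bDisjFrom _ _ _, heq_prim3 Term.bDisjFrom (Form.lab_map _ _) (Form.lab_map _ _) (Form.lab_map _ _)⟩
  | cConj A B =>
    intro a b h
    obtain ⟨h1, h2⟩ := swap_lab h
    simp only [Form.lab]
    rw [A.lab_congr h1, B.lab_congr h2]
    exact ⟨.cConj _ _, heq_prim2 Term.cConj (Form.lab_map _ _) (Form.lab_map _ _)⟩
  | cDisj A B =>
    intro a b h
    obtain ⟨h1, h2⟩ := swap_lab h
    simp only [Form.lab]
    rw [B.lab_congr h1, A.lab_congr h2]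
    exact ⟨.cDisj _ _, heq_prim2 Term.cDisj (Form.lab_map _ _) (Form.lab_map _ _)⟩
  | d A B C =>
    intro a b h
    rw [Form.lab_congr (a := a) (b := b) (A ⋏ (B ⋎ C)) (id_lab h)]
    simp only [Form.lab, Form.size, Nat.add_assoc]
    exact ⟨.d _ _ _, heq_prim3 Term.d (Form.lab_map _ _) (Form.lab_map _ _) (Form.lab_map _ _)⟩
  | delta p A =>
    intro a b h
    have h1 : ∀ i < A.size, a i = b i := fun i hi =>
      h (.inl i) (.inr i) (.inl ⟨i, hi, .inl rfl, .inr rfl⟩)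
    have h2 : b A.size = b (A.size + 1) :=
      h (.inr A.size) (.inr (A.size + 1)) (.inr ⟨0, Nat.one_pos, .inl rfl, .inr rfl⟩)
    rw [A.lab_congr h1]
    simp only [Form.lab, Form.size, Nat.add_zero, ← h2]
    exact ⟨.delta _ _, heq_prim1 (Term.delta p) (Form.lab_map _ _)⟩
  | sigma p A =>
    intro a b h
    have h1 : ∀ i < A.size, b i = a (1 + 1 + i) := fun i hi =>
      h (.inr i) (.inl _) (.inl ⟨i, hi, .inr rfl, .inl rfl⟩)
    have h2 : a 0 = a 1 :=
      h (.inl 0) (.inl 1) (.inr ⟨0, Nat.one_pos, .inl rfl, .inr rfl⟩)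
    rw [A.lab_congr h1]
    simp only [Form.lab, Form.size, Nat.add_zero, ← h2]
    exact ⟨.sigma _ _, heq_prim1 (Term.sigma p) (Form.lab_map _ _)⟩
  | mix A B =>
    intro a b h
    rw [Form.lab_congr (a := a) (b := b) (A ⋏ B) (id_lab h)]
    exact ⟨.mix _ _, heq_prim2 Term.mix (Form.lab_map _ _) (Form.lab_map _ _)⟩

end Lift

section Polarity

/-- Polarity of the vertices of a split relation. -/
def polr (s t : ℕ → Bool) : ℕ ⊕ ℕ → Bool := Sum.elim (fun i => !s i) t

/-- Properties of the split relations coming from arrow terms. -/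
structure Good (m n : ℕ) (s t : ℕ → Bool) (R : GRel) : Prop where
  symm : ∀ u v, R u v → R v u
  trans : ∀ u v w, R u v → R v w → R u w
  supp : ∀ u v, R u v → Sum.elim (fun i => i < m) (fun j => j < n) u
  pol : ∀ u v, R u v → u ≠ v → polr s t u ≠ polr s t v

/-- Directed step in the glued graph. -/
def dStep (s t w : ℕ → Bool) (Pr R : GRel) : ℕ ⊕ ℕ ⊕ ℕ → ℕ ⊕ ℕ ⊕ ℕ → Prop := fun x y =>
  (∃ x' y', Sum.map id Sum.inl x' = x ∧ Sum.map id Sum.inl y' = y ∧ R x' y' ∧ polr s t x' = true ∧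
    polr s t y' = false) ∨
  (∃ x' y', Sum.inr x' = x ∧ Sum.inr y' = y ∧ Pr x' y' ∧ polr t w x' = true ∧ polr t w y' = false)

theorem inj1 : Function.Injective (Sum.map id Sum.inl : ℕ ⊕ ℕ → ℕ ⊕ ℕ ⊕ ℕ) :=
  Function.Injective.sumMap Function.injective_id Sum.inl_injective

theorem inj2 : Function.Injective (Sum.map id Sum.inr : ℕ ⊕ ℕ → ℕ ⊕ ℕ ⊕ ℕ) :=
  Function.Injective.sumMap Function.injective_id Sum.inr_injective

theorem mid_pol {s t w : ℕ → Bool} {x' y' : ℕ ⊕ ℕ} (h : Sum.map id Sum.inl x' = (Sum.inr y' : ℕ ⊕ ℕ ⊕ ℕ)) :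
    polr t w y' = !polr s t x' := by
  rcases x' with i | i
  · simp at h
  · simp only [Sum.map_inr, Sum.inr.injEq] at h
    subst h
    rfl

variable {m n k : ℕ} {s t w : ℕ → Bool} {R S : GRel}

theorem Good.uniq (hR : Good m n s t R) {x y z : ℕ ⊕ ℕ} (h1 : R x y) (h2 : R x z)
    (h : polr s t y = polr s t z) : y = z := by
  by_contra hne
  exact hR.pol y z (hR.trans _ _ _ (hR.symm _ _ h1) h2) hne h

theorem dStep_runiq (hR : Good m n s t R) (hS : Good n k t w S) {x y z : ℕ ⊕ ℕ ⊕ ℕ}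
    (h1 : dStep s t w S R x y) (h2 : dStep s t w S R x z) : y = z := by
  rcases h1 with ⟨x1, y1, hx1, rfl, h1, p1, q1⟩ | ⟨x1, y1, hx1, rfl, h1, p1, q1⟩ <;>
  rcases h2 with ⟨x2, z1, hx2, rfl, h2, p2, q2⟩ | ⟨x2, z1, hx2, rfl, h2, p2, q2⟩
  · obtain rfl := inj1 (hx1.trans hx2.symm)
    rw [hR.uniq h1 h2 (q1.trans q2.symm)]
  · have := mid_pol (s := s) (t := t) (w := w) (hx1.trans hx2.symm)
    simp_all
  · have := mid_pol (s := s) (t := t) (w := w) (hx2.trans hx1.symm)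
    simp_all
  · obtain rfl := Sum.inr_injective (hx1.trans hx2.symm)
    rw [hS.uniq h1 h2 (q1.trans q2.symm)]

theorem dStep_luniq (hR : Good m n s t R) (hS : Good n k t w S) {x y z : ℕ ⊕ ℕ ⊕ ℕ}
    (h1 : dStep s t w S R y x) (h2 : dStep s t w S R z x) : y = z := by
  rcases h1 with ⟨y1, x1, rfl, hx1, h1, p1, q1⟩ | ⟨y1, x1, rfl, hx1, h1, p1, q1⟩ <;>
  rcases h2 with ⟨z1, x2, rfl, hx2, h2, p2, q2⟩ | ⟨z1, x2, rfl, hx2, h2, p2, q2⟩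
  · obtain rfl := inj1 (hx1.trans hx2.symm)
    rw [hR.uniq (hR.symm _ _ h1) (hR.symm _ _ h2) (p1.trans p2.symm)]
  · have := mid_pol (s := s) (t := t) (w := w) (hx1.trans hx2.symm)
    simp_all
  · have := mid_pol (s := s) (t := t) (w := w) (hx2.trans hx1.symm)
    simp_all
  · obtain rfl := Sum.inr_injective (hx1.trans hx2.symm)
    rw [hS.uniq (hS.symm _ _ h1) (hS.symm _ _ h2) (p1.trans p2.symm)]

theorem gStep_dir (hR : Good m n s t R) (hS : Good n k t w S) {x y : ℕ ⊕ ℕ ⊕ ℕ}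
    (h : gStep S R x y) : x = y ∨ dStep s t w S R x y ∨ dStep s t w S R y x := by
  rcases h with ⟨x', y', rfl, rfl, h⟩ | ⟨x', y', rfl, rfl, h⟩
  · by_cases e : x' = y'
    · exact .inl (by rw [e])
    · have := hR.pol _ _ h e
      cases hx : polr s t x' <;> cases hy : polr s t y' <;> simp [hx, hy] at this
      · exact .inr (.inr (.inl ⟨_, _, rfl, rfl, hR.symm _ _ h, hy, hx⟩))
      · exact .inr (.inl (.inl ⟨_, _, rfl, rfl, h, hx, hy⟩))
  · by_cases e : x' = y'
    · exact .inl (by rw [e])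
    · have := hS.pol _ _ h e
      cases hx : polr t w x' <;> cases hy : polr t w y' <;> simp [hx, hy] at this
      · exact .inr (.inr (.inr ⟨_, _, rfl, rfl, hS.symm _ _ h, hy, hx⟩))
      · exact .inr (.inl (.inr ⟨_, _, rfl, rfl, h, hx, hy⟩))

theorem path_dir {α : Type} {D U : α → α → Prop} (hU : ∀ x y, U x y → x = y ∨ D x y ∨ D y x)
    (hr : ∀ {x y z}, D x y → D x z → y = z) (hl : ∀ {x y z}, D y x → D z x → y = z) {x y : α}
    (h : Relation.ReflTransGen U x y) : Relation.ReflTransGen D x y ∨ Relation.ReflTransGen D y x := by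
  induction h with
  | refl => exact .inl .refl
  | tail _ h ih =>
    rcases hU _ _ h with rfl | h | h
    · exact ih
    · rcases ih with ih | ih
      · exact .inl (ih.tail h)
      · rcases ih.cases_head with rfl | ⟨c, h1, h2⟩
        · exact .inl (.single h)
        · rw [hr h h1]; exact .inr h2
    · rcases ih with ih | ih
      · rcases ih.cases_tail with rfl | ⟨c, h1, h2⟩
        · exact .inr (.single h)
        · rw [hl h h2]; exact .inl h1
      · exact .inr (.head h ih)

theorem dStep_out {u : ℕ ⊕ ℕ} {y : ℕ ⊕ ℕ ⊕ ℕ} (h : dStep s t w S R (Sum.map id Sum.inr u) y) :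
    polr s w u = true := by
  rcases h with ⟨x', y', hx, rfl, h, p, q⟩ | ⟨x', y', hx, rfl, h, p, q⟩ <;>
    rcases u with u | u <;> rcases x' with x' | x' <;> simp at hx <;> subst hx <;> exact p

theorem dStep_in {u : ℕ ⊕ ℕ} {y : ℕ ⊕ ℕ ⊕ ℕ} (h : dStep s t w S R y (Sum.map id Sum.inr u)) :
    polr s w u = false := by
  rcases h with ⟨y', x', rfl, hx, h, p, q⟩ | ⟨y', x', rfl, hx, h, p, q⟩ <;>
    rcases u with u | u <;> rcases x' with x' | x' <;> simp at hx <;> subst hx <;> exact q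

theorem dpath_pol {u v : ℕ ⊕ ℕ} (hne : u ≠ v)
    (h : Relation.ReflTransGen (dStep s t w S R) (Sum.map id Sum.inr u) (Sum.map id Sum.inr v)) :
    polr s w u = true ∧ polr s w v = false := by
  constructor
  · rcases h.cases_head with e | ⟨c, h1, h2⟩
    · exact (hne (inj2 e)).elim
    · exact dStep_out h1
  · rcases h.cases_tail with e | ⟨c, h1, h2⟩
    · exact (hne (inj2 e.symm)).elim
    · exact dStep_in h2

theorem Good.comp (hR : Good m n s t R) (hS : Good n k t w S) : Good m k s w (gComp S R) where
  symm u v h := tg_symm (gStep_symm hS.symm hR.symm) h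
  trans u v w h1 h2 := Relation.TransGen.trans h1 h2
  supp u v h := by
    obtain ⟨c, h1, -⟩ := Relation.TransGen.head'_iff.1 (gComp_iff.1 h)
    rcases h1 with ⟨x', y', hx, rfl, h⟩ | ⟨x', y', hx, rfl, h⟩
    · have := hR.supp _ _ h
      rcases u with u | u <;> rcases x' with x' | x' <;> simp at hx <;> subst hx <;> exact this
    · have := hS.supp _ _ h
      rcases u with u | u <;> rcases x' with x' | x' <;> simp at hx <;> subst hx <;> exact this
  pol u v h hne := by
    rcases path_dir (fun x y => gStep_dir hR hS) (dStep_runiq hR hS) (dStep_luniq hR hS)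
      (gComp_iff.1 h).to_reflTransGen with h | h
    · obtain ⟨h1, h2⟩ := dpath_pol hne h
      rw [h1, h2]; decide
    · obtain ⟨h1, h2⟩ := dpath_pol hne.symm h
      rw [h1, h2]; decide

/-- Concatenation of sign sequences. -/
def scat (m : ℕ) (s s' : ℕ → Bool) : ℕ → Bool := fun i => if i < m then s i else s' (i - m)

theorem Good.par {m' n' : ℕ} {s' t' : ℕ → Bool} (hR : Good m n s t R) (hS : Good m' n' s' t' S) :
    Good (m + m') (n + n') (scat m s s') (scat n t t') (gPar m n R S) where
  symm u v h := by
    rcases h with h | ⟨u', v', h, hu, hv⟩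
    · exact .inl (hR.symm _ _ h)
    · exact .inr ⟨v', u', hS.symm _ _ h, hv, hu⟩
  trans u v w h1 h2 := by
    rcases h1 with h1 | ⟨u1, v1, h1, rfl, rfl⟩ <;> rcases h2 with h2 | ⟨u2, v2, h2, e, rfl⟩
    · exact .inl (hR.trans _ _ _ h1 h2)
    · have := hR.supp _ _ (hR.symm _ _ h1)
      subst e
      rcases u2 with u2 | u2 <;> simp at this
    · have := hR.supp _ _ h2
      rcases v1 with u2 | u2 <;> simp at this
    · have : v1 = u2 := by
        rcases v1 with i | i <;> rcases u2 with j | j <;> simp at e <;> subst e <;> rfl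
      subst this
      exact .inr ⟨_, _, hS.trans _ _ _ h1 h2, rfl, rfl⟩
  supp u v h := by
    rcases h with h | ⟨u', v', h, rfl, rfl⟩
    · have := hR.supp _ _ h
      rcases u with u | u <;> simp at this ⊢ <;> omega
    · have := hS.supp _ _ h
      rcases u' with u | u <;> simp at this ⊢ <;> omega
  pol u v h hne := by
    rcases h with h | ⟨u', v', h, rfl, rfl⟩
    · have h1 := hR.supp _ _ h
      have h2 := hR.supp _ _ (hR.symm _ _ h)
      have h3 := hR.pol _ _ h hne
      rcases u with u | u <;> rcases v with v | v <;> simp at h1 h2 <;>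
        simpa [polr, scat, h1, h2] using h3
    · have h3 := hS.pol _ _ h (fun e => hne (by rw [e]))
      rcases u' with u | u <;> rcases v' with v | v <;> simpa [polr, scat] using h3

theorem Good.id (h : ∀ i < m, s i = t i) : Good m m s t (gId m) where
  symm := by rintro u v ⟨i, hi, hu, hv⟩; exact ⟨i, hi, hv, hu⟩
  trans := by
    rintro u v w ⟨i, hi, hu, hv⟩ ⟨j, hj, hv', hw⟩
    have : i = j := by rcases hv with rfl | rfl <;> simpa using hv'
    subst this
    exact ⟨i, hi, hu, hw⟩
  supp := by
    rintro u v ⟨i, hi, rfl | rfl, hv⟩ <;> exact hi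
  pol := by
    rintro u v ⟨i, hi, rfl | rfl, rfl | rfl⟩ hne <;> simp [polr, h i hi] at hne ⊢

theorem Good.swap (h1 : ∀ i < m, s i = t (i + n)) (h2 : ∀ i < n, s (m + i) = t i) :
    Good (m + n) (n + m) s t (gSwap m n) where
  symm := by rintro u v ⟨i, hi, hu, hv⟩; exact ⟨i, hi, hv, hu⟩
  trans := by
    rintro u v w ⟨i, hi, hu, hv⟩ ⟨j, hj, hv', hw⟩
    have : i = j := by
      rcases hv with rfl | rfl <;> simp at hv'
      · exact hv'
      · split_ifs at hv' <;> omega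
    subst this
    exact ⟨i, hi, hu, hw⟩
  supp := by
    rintro u v ⟨i, hi, rfl | rfl, hv⟩
    · exact hi
    · simp only [Sum.elim_inr]; split_ifs <;> omega
  pol := by
    have key : ∀ i < m + n, s i = t (if i < m then i + n else i - m) := by
      intro i hi
      split_ifs with k
      · exact h1 i k
      · have := h2 (i - m) (by omega)
        rwa [Nat.add_sub_cancel' (by omega)] at this
    rintro u v ⟨i, hi, rfl | rfl, rfl | rfl⟩ hne <;> simp only [polr, Sum.elim_inl, Sum.elim_inr, key i hi] <;>
      simp at hne ⊢

theorem Good.delta (h : ∀ i < m, s i = t i) (h1 : t m ≠ t (m + 1)) : Good m (m + (1 + 1)) s t (gDelta m 1) where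
  symm := by
    rintro u v (⟨i, hi, hu, hv⟩ | ⟨i, hi, hu, hv⟩)
    · exact .inl ⟨i, hi, hv, hu⟩
    · exact .inr ⟨i, hi, hv, hu⟩
  trans := by
    rintro u v w (⟨i, hi, hu, hv⟩ | ⟨i, hi, hu, hv⟩) (⟨j, hj, hv', hw⟩ | ⟨j, hj, hv', hw⟩)
    · have : i = j := by rcases hv with rfl | rfl <;> simpa using hv'
      subst this
      exact .inl ⟨i, hi, hu, hw⟩
    · rcases hv with rfl | rfl <;> simp at hv'
      omega
    · rcases hv with rfl | rfl <;> simp at hv' <;> omega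
    · obtain rfl : i = j := by omega
      exact .inr ⟨i, hi, hu, hw⟩
  supp := by
    rintro u v (⟨i, hi, rfl | rfl, hv⟩ | ⟨i, hi, rfl | rfl, hv⟩) <;> simp <;> omega
  pol := by
    rintro u v (⟨i, hi, rfl | rfl, rfl | rfl⟩ | ⟨i, hi, hu, hv⟩) hne
    · simp at hne
    · simp [polr, h i hi]
    · simp [polr, h i hi]
    · simp at hne
    · obtain rfl : i = 0 := by omega
      rcases hu with rfl | rfl <;> rcases hv with rfl | rfl
      · simp at hne
      · exact h1
      · exact h1.symm
      · simp at hne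

theorem Good.sigma (h : ∀ i < m, s (2 + i) = t i) (h1 : s 0 ≠ s 1) : Good (1 + 1 + m) m s t (gSigma m 1) where
  symm := by
    rintro u v (⟨i, hi, hu, hv⟩ | ⟨i, hi, hu, hv⟩)
    · exact .inl ⟨i, hi, hv, hu⟩
    · exact .inr ⟨i, hi, hv, hu⟩
  trans := by
    rintro u v w (⟨i, hi, hu, hv⟩ | ⟨i, hi, hu, hv⟩) (⟨j, hj, hv', hw⟩ | ⟨j, hj, hv', hw⟩)
    · have : i = j := by rcases hv with rfl | rfl <;> simpa using hv'
      subst this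
      exact .inl ⟨i, hi, hu, hw⟩
    · rcases hv with rfl | rfl <;> simp at hv'
      omega
    · rcases hv with rfl | rfl <;> simp at hv' <;> omega
    · obtain rfl : i = j := by omega
      exact .inr ⟨i, hi, hu, hw⟩
  supp := by
    rintro u v (⟨i, hi, rfl | rfl, hv⟩ | ⟨i, hi, rfl | rfl, hv⟩) <;> simp <;> omega
  pol := by
    rintro u v (⟨i, hi, rfl | rfl, rfl | rfl⟩ | ⟨i, hi, hu, hv⟩) hne
    · simp at hne
    · simp [polr, h i hi]
    · simp [polr, h i hi]
    · simp at hne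
    · obtain rfl : i = 0 := by omega
      rcases hu with rfl | rfl <;> rcases hv with rfl | rfl
      · simp at hne
      · simpa [polr] using h1
      · simpa [polr] using h1.symm
      · simp at hne

/-- Sign of the letter occurrences of a formula. -/
def Form.sgn {P : Type} : Form P → ℕ → Bool
  | .pos _ => fun _ => true
  | .natom _ => fun _ => false
  | .conj A B => scat A.size A.sgn B.sgn
  | .disj A B => scat A.size A.sgn B.sgn

theorem scat_assoc (m n : ℕ) (a b c : ℕ → Bool) : scat m a (scat n b c) = scat (m + n) (scat m a b) c := by
  funext i
  simp only [scat]
  split_ifs <;> first | rfl | omega | (congr 1; omega)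

theorem scat_left {m : ℕ} {a b : ℕ → Bool} {i : ℕ} (h : i < m) : scat m a b i = a i := if_pos h

theorem scat_right {m : ℕ} {a b : ℕ → Bool} {i : ℕ} : scat m a b (m + i) = b i := by simp [scat]

theorem G_good {P : Type} {A B : Form P} (f : Term P A B) : Good A.size B.size A.sgn B.sgn (Term.G f) := by
  have hsw : ∀ m n (a b : ℕ → Bool), Good (m + n) (n + m) (scat m a b) (scat n b a) (gSwap m n) := by
    intro m n a b
    refine Good.swap (fun i hi => ?_) (fun i hi => ?_)
    · rw [scat_left hi, Nat.add_comm, scat_right]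
    · rw [scat_left hi, scat_right]
  induction f with
  | id A => exact Good.id fun i _ => rfl
  | comp g f ihg ihf => exact ihf.comp ihg
  | conj f g ihf ihg => exact ihf.par ihg
  | disj f g ihf ihg => exact ihf.par ihg
  | bConjTo A B C =>
    simp only [Form.size, Form.sgn, Term.G, scat_assoc, ← Nat.add_assoc]
    exact Good.id fun i _ => rfl
  | bConjFrom A B C =>
    simp only [Form.size, Form.sgn, Term.G, scat_assoc, ← Nat.add_assoc]
    exact Good.id fun i _ => rfl
  | bDisjTo A B C =>
    simp only [Form.size, Form.sgn, Term.G, scat_assoc, ← Nat.add_assoc]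
    exact Good.id fun i _ => rfl
  | bDisjFrom A B C =>
    simp only [Form.size, Form.sgn, Term.G, scat_assoc, ← Nat.add_assoc]
    exact Good.id fun i _ => rfl
  | cConj A B => exact hsw _ _ _ _
  | cDisj A B => exact hsw _ _ _ _
  | d A B C =>
    simp only [Form.size, Form.sgn, Term.G, scat_assoc, ← Nat.add_assoc]
    exact Good.id fun i _ => rfl
  | delta p A =>
    refine Good.delta (fun i hi => (scat_left hi).symm) ?_
    simp [Form.sgn, Form.size, scat]
  | sigma p A =>
    refine Good.sigma (fun i hi => ?_) ?_
    · exact scat_right (m := 1 + 1)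
    · simp [Form.sgn, Form.size, scat]
  | mix A B => exact Good.id fun i _ => rfl

end Polarity

section Final

variable {P L : Type}

theorem range_split {β : Type} (m n : ℕ) (f : ℕ → β) :
    (Multiset.range (m + n)).map f = (Multiset.range m).map f + (Multiset.range n).map (fun i => f (m + i)) := by
  rw [Multiset.range_add, Multiset.map_add, Multiset.map_map]; rfl

theorem lits_lab (A : Form P) (a : ℕ → L) :
    (A.lab a).lits.map (fun x => (x.1, x.2.2)) = (Multiset.range A.size).map fun i => (A.sgn i, a i) := by
  have key : ∀ (A B : Form P) (a : ℕ → L),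
      ((Multiset.range (A.size + B.size)).map fun i => (scat A.size A.sgn B.sgn i, a i)) =
      ((Multiset.range A.size).map fun i => (A.sgn i, a i)) +
      ((Multiset.range B.size).map fun i => (B.sgn i, a (A.size + i))) := by
    intro A B a
    rw [range_split]
    simp only [scat_right]
    congr 1
    refine Multiset.map_congr rfl fun i hi => ?_
    rw [scat_left (Multiset.mem_range.1 hi)]
  induction A generalizing a with
  | pos p => rfl
  | natom p => rfl
  | conj A B ih1 ih2 =>
    simp only [Form.lab, Form.lits, Form.size, Form.sgn, Multiset.map_add, ih1, ih2, key]
  | disj A B ih1 ih2 =>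
    simp only [Form.lab, Form.lits, Form.size, Form.sgn, Multiset.map_add, ih1, ih2, key]

theorem lits_dual {Q : Type} (A : Form Q) : A.dual.lits = A.lits.map fun x => (!x.1, x.2) := by
  induction A with
  | pos p => rfl
  | natom p => rfl
  | conj A B ih1 ih2 => simp only [Form.dual, Form.lits, Multiset.map_add, ih1, ih2]
  | disj A B ih1 ih2 => simp only [Form.dual, Form.lits, Multiset.map_add, ih1, ih2, add_comm]

theorem lits_nodup (A B : Form P) (a b : ℕ → L)
    (h : ∀ u v, Sum.elim (fun i => i < A.size) (fun j => j < B.size) u →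
      Sum.elim (fun i => i < A.size) (fun j => j < B.size) v →
      polr A.sgn B.sgn u = polr A.sgn B.sgn v → Sum.elim a b u = Sum.elim a b v → u = v) :
    ((A.lab a).dual.lits + (B.lab b).lits).Nodup := by
  apply Multiset.Nodup.of_map (fun x : Bool × (P × L) => (x.1, x.2.2))
  have e1 : (A.lab a).dual.lits.map (fun x : Bool × (P × L) => (x.1, x.2.2)) =
      (Multiset.range A.size).map fun i => (!A.sgn i, a i) := by
    have := congrArg (Multiset.map fun x : Bool × L => (!x.1, x.2)) (lits_lab A a)
    rw [Multiset.map_map, Multiset.map_map] at this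
    rw [lits_dual, Multiset.map_map]
    exact this
  rw [Multiset.map_add, e1, lits_lab, Multiset.nodup_add]
  refine ⟨?_, ?_, ?_⟩
  · refine Multiset.Nodup.map_on (fun i hi j hj e => ?_) (Multiset.nodup_range _)
    have := Prod.mk.inj e
    exact Sum.inl_injective (h (.inl i) (.inl j) (Multiset.mem_range.1 hi) (Multiset.mem_range.1 hj) this.1 this.2)
  · refine Multiset.Nodup.map_on (fun i hi j hj e => ?_) (Multiset.nodup_range _)
    have := Prod.mk.inj e
    exact Sum.inr_injective (h (.inr i) (.inr j) (Multiset.mem_range.1 hi) (Multiset.mem_range.1 hj) this.1 this.2)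
  · rw [Multiset.disjoint_left]
    intro x hx hy
    obtain ⟨i, hi, rfl⟩ := Multiset.mem_map.1 hx
    obtain ⟨j, hj, e⟩ := Multiset.mem_map.1 hy
    have := Prod.mk.inj e
    have := h (.inl i) (.inr j) (Multiset.mem_range.1 hi) (Multiset.mem_range.1 hj) this.1.symm this.2.symm
    cases this

theorem quot_good {m n : ℕ} {s t : ℕ → Bool} {R : GRel} (hR : Good m n s t R) {u v : ℕ ⊕ ℕ}
    (h : Quot.mk R u = Quot.mk R v) : R u v ∨ u = v := by
  have := Quot.eqvGen_exact h
  clear h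
  induction this with
  | rel _ _ h => exact .inl h
  | refl _ => exact .inr rfl
  | symm _ _ h ih =>
    rcases ih with h | h
    · exact .inl (hR.symm _ _ h)
    · exact .inr h.symm
  | trans _ _ _ h1 h2 ih1 ih2 =>
    rcases ih1 with h1 | rfl
    · rcases ih2 with h2 | rfl
      · exact .inl (hR.trans _ _ _ h1 h2)
      · exact .inl h1
    · exact ih2

theorem coherence_aux {A B : Form P} (f g : Term P A B) (h : Term.G f = Term.G g) : Eqv f g := by
  let a : ℕ → Quot (Term.G f) := fun i => Quot.mk _ (.inl i)
  let b : ℕ → Quot (Term.G f) := fun i => Quot.mk _ (.inr i)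
  have hab : ∀ u, Sum.elim a b u = Quot.mk (Term.G f) u := by rintro (i | i) <;> rfl
  have : Inhabited (Quot (Term.G f)) := ⟨a 0⟩
  obtain ⟨f', hf⟩ := lift f a b fun u v k => by rw [hab, hab]; exact Quot.sound k
  obtain ⟨g', hg⟩ := lift g a b fun u v k => by rw [hab, hab]; exact Quot.sound (h ▸ k)
  have hn : ((A.lab a).dual.lits + (B.lab b).lits).Nodup := by
    refine lits_nodup A B a b fun u v _ _ h1 h2 => ?_
    rw [hab, hab] at h2
    rcases quot_good (G_good f) h2 with k | k
    · by_contra hne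
      exact (G_good f).pol _ _ k hne h1
    · exact k
  have : Eqv f' g' := qq_eq.1 (MPN_thin _ _ hn)
  exact heq_eqv (Form.lab_map _ _) (Form.lab_map _ _) hf hg (this.map Prod.fst)

end Final

/-- **MPN Coherence**: the functor `G` from MPN to Br is faithful; that is, for all
arrow terms `f, g : A ⊢ B` of MPN, if `Gf = Gg` in Br then `f = g` in MPN. -/
theorem MPN_coherence {P : Type} {A B : Form P} (f g : Term P A B) :
    Term.G f = Term.G g → Eqv f g := by
  exact coherence_aux f g
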